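/- Let d = 3 and define ω : ℝ³ → ℝ by ω(ξ) = √(1 + Σ_{j=1}^{3} 2(1 − cos ξ_j)). For t ∈ ℝ and x ∈ ℤ³, let I(t,x) = ∫_{[0,2π]³} e^{i(x·ξ − t ω(ξ))} a(ξ) dξ, where the amplitude is a(ξ) = 1 or a(ξ) = 1/ω(ξ). Then there exists a constant C > 0, independent of t, such that sup_{x ∈ ℤ³} |I(t,x)| ≤ C(1 + |t|)^{-7/6} for all t ∈ ℝ. -/

import Mathlib

open MeasureTheory Real
open scoped ENNReal

noncomputable section

/-- Dispersion relation of the discrete Klein--Gordon equation on `ℤ^d`. -/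
def omegaKG (d : ℕ) (ξ : Fin d → ℝ) : ℝ :=
  Real.sqrt (1 + ∑ j : Fin d, 2 * (1 - Real.cos (ξ j)))

/-- The fundamental domain `[0, 2π]^d` of the torus. -/
def cube (d : ℕ) : Set (Fin d → ℝ) := Set.Icc 0 (fun _ => 2 * Real.pi)

/-- The oscillatory integral `I(t,x) = ∫_{[0,2π]^d} e^{i(x·ξ − t ω(ξ))} a(ξ) dξ`. -/
def oscInt (d : ℕ) (a : (Fin d → ℝ) → ℂ) (t : ℝ) (x : Fin d → ℤ) : ℂ :=
  ∫ ξ in cube d,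
    Complex.exp (Complex.I * (((∑ j : Fin d, (x j : ℝ) * ξ j) - t * omegaKG d ξ : ℝ) : ℂ)) * a ξ

namespace DiscreteKG

/-! ### Van der Corput estimates -/

theorem hasDerivAt_cexp_I_mul {φ : ℝ → ℝ} {φ' x : ℝ} (h : HasDerivAt φ φ' x) :
    HasDerivAt (fun y => Complex.exp (Complex.I * (φ y : ℂ)))
      (Complex.I * (φ' : ℂ) * Complex.exp (Complex.I * (φ x : ℂ))) x := by
  have := ((h.ofReal_comp).const_mul Complex.I).cexp
  convert this using 1
  ring

theorem norm_cexp_I_mul (y : ℝ) : ‖Complex.exp (Complex.I * (y : ℂ))‖ = 1 := by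
  rw [mul_comm]; exact Complex.norm_exp_ofReal_mul_I y

theorem intervalIntegrable_of_hasDerivAt_of_bound {A A' : ℝ → ℂ} {a b C : ℝ} (hab : a ≤ b)
    (hA : ∀ x ∈ Set.Icc a b, HasDerivAt A (A' x) x) (hb : ∀ x ∈ Set.Icc a b, ‖A' x‖ ≤ C) :
    IntervalIntegrable A' volume a b := by
  have h1 : IntervalIntegrable (deriv A) volume a b := by
    refine (intervalIntegrable_const (c := C)).mono_fun
      (measurable_deriv A).aestronglyMeasurable ?_
    refine (ae_restrict_iff' measurableSet_uIoc).2 (Filter.Eventually.of_forall fun x hx => ?_)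
    rw [Set.uIoc_of_le hab] at hx
    have hx' := Set.Ioc_subset_Icc_self hx
    beta_reduce
    rw [(hA x hx').deriv]
    exact (hb x hx').trans (le_abs_self C)
  refine h1.congr fun x hx => ?_
  rw [Set.uIoc_of_le hab] at hx
  exact (hA x (Set.Ioc_subset_Icc_self hx)).deriv

/-- A differentiable amplitude on `[a, b]` whose size and total variation are at most `N`. -/
def BVAmp (A A' : ℝ → ℂ) (a b N : ℝ) : Prop :=
  ∀ x ∈ Set.Icc a b, HasDerivAt A (A' x) x ∧ ‖A x‖ ≤ N ∧ ‖A' x‖ * (b - a) ≤ N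

theorem BVAmp.mono {A A' : ℝ → ℂ} {a b c d N : ℝ} (h : BVAmp A A' a b N) (hac : a ≤ c)
    (hdb : d ≤ b) : BVAmp A A' c d N := by
  intro x hx
  obtain ⟨h1, h2, h3⟩ := h x ⟨hac.trans hx.1, hx.2.trans hdb⟩
  exact ⟨h1, h2, (mul_le_mul_of_nonneg_left (by linarith) (norm_nonneg _)).trans h3⟩

/-- The oscillatory integral over an interval. -/
def osc (φ : ℝ → ℝ) (A : ℝ → ℂ) (a b : ℝ) : ℂ :=
  ∫ x in a..b, Complex.exp (Complex.I * (φ x : ℂ)) * A x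

theorem norm_osc_le {φ : ℝ → ℝ} {A A' : ℝ → ℂ} {a b N : ℝ} (hab : a ≤ b)
    (hA : BVAmp A A' a b N) : ‖osc φ A a b‖ ≤ N * (b - a) := by
  have := intervalIntegral.norm_integral_le_of_norm_le_const (a := a) (b := b) (C := N)
    (f := fun x => Complex.exp (Complex.I * (φ x : ℂ)) * A x) (by
      intro x hx
      rw [Set.uIoc_of_le hab] at hx
      rw [norm_mul, norm_cexp_I_mul, one_mul]
      exact (hA x (Set.Ioc_subset_Icc_self hx)).2.1)
  rwa [abs_of_nonneg (by linarith)] at this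

theorem osc_split {φ φ' : ℝ → ℝ} {A A' : ℝ → ℂ} {a b N c : ℝ}
    (hφ : ∀ x ∈ Set.Icc a b, HasDerivAt φ (φ' x) x)
    (hA : BVAmp A A' a b N) (hc : c ∈ Set.Icc a b) :
    osc φ A a b = osc φ A a c + osc φ A c b := by
  have hcont : ContinuousOn (fun x => Complex.exp (Complex.I * (φ x : ℂ)) * A x)
      (Set.Icc a b) := by
    intro x hx
    exact ((hasDerivAt_cexp_I_mul (hφ x hx)).continuousAt.mul
      (hA x hx).1.continuousAt).continuousWithinAt
  unfold osc
  rw [intervalIntegral.integral_add_adjacent_intervals]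
  · exact (hcont.mono (Set.Icc_subset_Icc le_rfl hc.2)).intervalIntegrable_of_Icc hc.1
  · exact (hcont.mono (Set.Icc_subset_Icc hc.1 le_rfl)).intervalIntegrable_of_Icc hc.2

theorem vdc_first {φ φ1 φ2 : ℝ → ℝ} {A A' : ℝ → ℂ} {a b N m : ℝ} (hab : a ≤ b) (hm : 0 < m)
    (h1 : ∀ x ∈ Set.Icc a b, HasDerivAt φ (φ1 x) x)
    (h2 : ∀ x ∈ Set.Icc a b, HasDerivAt φ1 (φ2 x) x)
    (hc : ContinuousOn φ2 (Set.Icc a b))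
    (hs : (∀ x ∈ Set.Icc a b, 0 ≤ φ2 x) ∨ (∀ x ∈ Set.Icc a b, φ2 x ≤ 0))
    (hl : ∀ x ∈ Set.Icc a b, m ≤ |φ1 x|)
    (hA : BVAmp A A' a b N) : ‖osc φ A a b‖ ≤ 5 * N / m := by
  rcases hab.eq_or_lt with rfl | hlt
  · have hN : 0 ≤ N := (norm_nonneg _).trans (hA a ⟨le_rfl, le_rfl⟩).2.1
    simp only [osc, intervalIntegral.integral_same, norm_zero]; positivity
  have hN : 0 ≤ N := (norm_nonneg _).trans (hA a ⟨le_rfl, hab⟩).2.1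
  have hne : ∀ x ∈ Set.Icc a b, φ1 x ≠ 0 := fun x hx h => by
    have := hl x hx; rw [h, abs_zero] at this; linarith
  have hI := Set.uIcc_of_le hab
  set u : ℝ → ℂ := fun x => A x / (Complex.I * φ1 x) with hu
  set u' : ℝ → ℂ := fun x => A' x / (Complex.I * φ1 x)
    - A x * φ2 x / (Complex.I * (φ1 x) ^ 2) with hu'
  have du : ∀ x ∈ Set.Icc a b, HasDerivAt u (u' x) x := by
    intro x hx
    have hx0 : (φ1 x : ℂ) ≠ 0 := by exact_mod_cast hne x hx
    have := (hA x hx).1.div (((h2 x hx).ofReal_comp).const_mul Complex.I)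
      (mul_ne_zero Complex.I_ne_zero hx0)
    refine this.congr_deriv ?_
    have hI0 := Complex.I_ne_zero
    simp only [hu']
    field_simp
  have hA'b : ∀ x ∈ Set.Icc a b, ‖A' x‖ ≤ N / (b - a) := fun x hx => by
    rw [le_div_iff₀ (by linarith)]; exact (hA x hx).2.2
  obtain ⟨σ, hσ1, hσ2⟩ : ∃ σ : ℝ, |σ| = 1 ∧ ∀ x ∈ Set.Icc a b, |φ2 x| = σ * φ2 x := by
    rcases hs with hs | hs
    · exact ⟨1, by simp, fun x hx => by rw [abs_of_nonneg (hs x hx), one_mul]⟩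
    · exact ⟨-1, by simp, fun x hx => by rw [abs_of_nonpos (hs x hx)]; ring⟩
  have hφ1c : ContinuousOn φ1 (Set.Icc a b) := fun x hx => (h2 x hx).continuousAt.continuousWithinAt
  have hAc : ContinuousOn A (Set.Icc a b) := fun x hx => (hA x hx).1.continuousAt.continuousWithinAt
  have hgc : ContinuousOn (fun x => σ * φ2 x / (φ1 x) ^ 2) (Set.Icc a b) :=
    (continuousOn_const.mul hc).div (hφ1c.pow 2) fun x hx => pow_ne_zero 2 (hne x hx)
  have hgi : IntervalIntegrable (fun x => σ * φ2 x / (φ1 x) ^ 2) volume a b :=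
    hgc.intervalIntegrable_of_Icc hab
  have hub : ∀ x ∈ Set.Icc a b, ‖u' x‖ ≤ N / (b - a) / m + N * (σ * φ2 x / (φ1 x) ^ 2) := by
    intro x hx
    refine (norm_sub_le _ _).trans (add_le_add ?_ ?_)
    · rw [norm_div, norm_mul, Complex.norm_I, one_mul, Complex.norm_real, Real.norm_eq_abs]
      exact div_le_div₀ (by have := hA'b x hx; exact (norm_nonneg _).trans this) (hA'b x hx) hm
        (hl x hx)
    · rw [norm_div, norm_mul, norm_mul, Complex.norm_I, one_mul, norm_pow, Complex.norm_real,
        Complex.norm_real, Real.norm_eq_abs, Real.norm_eq_abs, sq_abs, hσ2 x hx, mul_div_assoc]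
      refine mul_le_mul_of_nonneg_right (hA x hx).2.1 (div_nonneg ?_ (sq_nonneg _))
      rw [← hσ2 x hx]; exact abs_nonneg _
  obtain ⟨K, hK⟩ := (isCompact_Icc (a := a) (b := b)).exists_bound_of_continuousOn hgc
  have hu'i : IntervalIntegrable u' volume a b :=
    intervalIntegrable_of_hasDerivAt_of_bound hab du (C := N / (b - a) / m + N * K) fun x hx =>
      (hub x hx).trans (by
        gcongr; exact (le_abs_self _).trans (hK x hx))
  have hv'i : IntervalIntegrable (fun x => Complex.I * (φ1 x : ℂ) *
      Complex.exp (Complex.I * (φ x : ℂ))) volume a b := by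
    refine ContinuousOn.intervalIntegrable_of_Icc hab ?_
    refine (continuousOn_const.mul (Complex.continuous_ofReal.comp_continuousOn hφ1c)).mul ?_
    exact fun x hx => (hasDerivAt_cexp_I_mul (h1 x hx)).continuousAt.continuousWithinAt
  have key := intervalIntegral.integral_mul_deriv_eq_deriv_mul (a := a) (b := b) (u := u) (u' := u')
    (v := fun x => Complex.exp (Complex.I * (φ x : ℂ))) (by rwa [hI])
    (by rw [hI]; exact fun x hx => hasDerivAt_cexp_I_mul (h1 x hx)) hu'i hv'i
  have hosc : osc φ A a b = ∫ x in a..b, u x * (Complex.I * (φ1 x : ℂ) *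
      Complex.exp (Complex.I * (φ x : ℂ))) := by
    refine intervalIntegral.integral_congr fun x hx => ?_
    rw [hI] at hx
    have hx0 : (φ1 x : ℂ) ≠ 0 := by exact_mod_cast hne x hx
    simp only [hu]
    have hI0 := Complex.I_ne_zero
    field_simp
  have hbu : ∀ x ∈ Set.Icc a b, ‖u x * Complex.exp (Complex.I * (φ x : ℂ))‖ ≤ N / m := by
    intro x hx
    rw [norm_mul, norm_cexp_I_mul, mul_one, norm_div, norm_mul, Complex.norm_I, one_mul,
      Complex.norm_real, Real.norm_eq_abs]
    exact div_le_div₀ hN (hA x hx).2.1 hm (hl x hx)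
  have hint : ‖∫ x in a..b, u' x * Complex.exp (Complex.I * (φ x : ℂ))‖
      ≤ ∫ x in a..b, (N / (b - a) / m + N * (σ * φ2 x / (φ1 x) ^ 2)) := by
    refine intervalIntegral.norm_integral_le_of_norm_le hab ?_
      (intervalIntegrable_const.add (hgi.const_mul N))
    refine Filter.Eventually.of_forall fun x hx => ?_
    rw [norm_mul, norm_cexp_I_mul, mul_one]
    exact hub x (Set.Ioc_subset_Icc_self hx)
  have hgv : ∫ x in a..b, σ * φ2 x / (φ1 x) ^ 2 = -σ / φ1 b - -σ / φ1 a := by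
    refine intervalIntegral.integral_eq_sub_of_hasDerivAt (f := fun x => -σ / φ1 x) ?_ hgi
    intro x hx
    rw [hI] at hx
    have := (hasDerivAt_const x (-σ)).div (h2 x hx) (hne x hx)
    refine this.congr_deriv ?_
    ring
  have hσb : ∀ x ∈ Set.Icc a b, |-σ / φ1 x| ≤ 1 / m := by
    intro x hx
    rw [abs_div, abs_neg, hσ1]
    exact div_le_div_of_nonneg_left zero_le_one hm (hl x hx)
  rw [intervalIntegral.integral_add intervalIntegrable_const (hgi.const_mul N),
    intervalIntegral.integral_const, intervalIntegral.integral_const_mul, hgv] at hint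
  have ha : a ∈ Set.Icc a b := ⟨le_rfl, hab⟩
  have hb : b ∈ Set.Icc a b := ⟨hab, le_rfl⟩
  have e1 := abs_le.1 (hσb a ha)
  have e2 := abs_le.1 (hσb b hb)
  have e3 : (b - a) • (N / (b - a) / m) = N / m := by
    rw [smul_eq_mul]; field_simp [(by linarith : b - a ≠ 0)]
  rw [e3] at hint
  have e4 : N * (-σ / φ1 b - -σ / φ1 a) ≤ N * (2 / m) := by
    refine mul_le_mul_of_nonneg_left ?_ hN
    have : 2 / m = 1 / m + 1 / m := by ring
    linarith
  rw [hosc, key]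
  calc _ ≤ ‖u b * Complex.exp (Complex.I * (φ b : ℂ))‖ + ‖u a * Complex.exp (Complex.I * (φ a : ℂ))‖
        + ‖∫ x in a..b, u' x * Complex.exp (Complex.I * (φ x : ℂ))‖ :=
        (norm_sub_le _ _).trans (add_le_add_left (norm_sub_le _ _) _)
    _ ≤ N / m + N / m + (N / m + N * (2 / m)) :=
        add_le_add (add_le_add (hbu b hb) (hbu a ha)) (hint.trans (by linarith))
    _ = 5 * N / m := by ring

theorem exists_split_of_monotoneOn {g : ℝ → ℝ} {a b : ℝ} (hab : a ≤ b)
    (hc : ContinuousOn g (Set.Icc a b)) (hm : MonotoneOn g (Set.Icc a b)) (τ : ℝ) :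
    ∃ c ∈ Set.Icc a b, (a < c → ∀ x ∈ Set.Icc a c, g x ≤ τ) ∧
      (c < b → ∀ x ∈ Set.Icc c b, τ ≤ g x) := by
  rcases le_total (g b) τ with h | h
  · exact ⟨b, ⟨hab, le_rfl⟩, fun _ x hx => (hm hx ⟨hab, le_rfl⟩ hx.2).trans h,
      fun h' => absurd h' (lt_irrefl _)⟩
  rcases le_total τ (g a) with h' | h'
  · exact ⟨a, ⟨le_rfl, hab⟩, fun h' => absurd h' (lt_irrefl _),
      fun _ x hx => h'.trans (hm ⟨le_rfl, hab⟩ hx hx.1)⟩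
  obtain ⟨c, hc1, hc2⟩ := intermediate_value_Icc hab hc ⟨h', h⟩
  refine ⟨c, hc1, fun _ x hx => ?_, fun _ x hx => ?_⟩
  · rw [← hc2]; exact hm ⟨hx.1, hx.2.trans hc1.2⟩ hc1 hx.2
  · rw [← hc2]; exact hm hc1 ⟨hc1.1.trans hx.1, hx.2⟩ hx.1

theorem exists_split_of_deriv_ge {g g' : ℝ → ℝ} {a b μ m : ℝ} (hab : a ≤ b) (hμ : 0 < μ)
    (hm : 0 < m) (hg : ∀ x ∈ Set.Icc a b, HasDerivAt g (g' x) x)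
    (hl : ∀ x ∈ Set.Icc a b, μ ≤ g' x) :
    ∃ c d, a ≤ c ∧ c ≤ d ∧ d ≤ b ∧ d - c ≤ 2 * m / μ ∧
      (a < c → ∀ x ∈ Set.Icc a c, m ≤ |g x|) ∧ (d < b → ∀ x ∈ Set.Icc d b, m ≤ |g x|) := by
  have hc : ContinuousOn g (Set.Icc a b) := fun x hx => (hg x hx).continuousAt.continuousWithinAt
  have hmono : MonotoneOn g (Set.Icc a b) :=
    monotoneOn_of_hasDerivWithinAt_nonneg (f' := g') (convex_Icc a b) hc
      (fun x hx => (hg x (interior_subset hx)).hasDerivWithinAt)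
      (fun x hx => hμ.le.trans (hl x (interior_subset hx)))
  obtain ⟨c, hc1, hc2, hc3⟩ := exists_split_of_monotoneOn hab hc hmono (-m)
  have hsub : Set.Icc c b ⊆ Set.Icc a b := Set.Icc_subset_Icc hc1.1 le_rfl
  obtain ⟨d, hd1, hd2, hd3⟩ := exists_split_of_monotoneOn hc1.2 (hc.mono hsub) (hmono.mono hsub) m
  refine ⟨c, d, hc1.1, hd1.1, hd1.2, ?_, fun h x hx => ?_, fun h x hx => ?_⟩
  · rcases hd1.1.eq_or_lt with h | h
    · rw [h, sub_self]; positivity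
    have h1 := hd2 h d ⟨hd1.1, le_rfl⟩
    have h2 := hc3 (h.trans_le hd1.2) c ⟨le_rfl, hc1.2⟩
    have h3 := (convex_Icc a b).mul_sub_le_image_sub_of_le_deriv hc
      (fun x hx => (hg x (interior_subset hx)).differentiableAt.differentiableWithinAt)
      (C := μ) (fun x hx => by
        rw [(hg x (interior_subset hx)).deriv]; exact hl x (interior_subset hx))
      c hc1 d (hsub hd1) hd1.1
    rw [le_div_iff₀ hμ]; linarith
  · have := hc2 h x hx
    rw [abs_of_neg (by linarith)]; linarith
  · exact (hd3 h x hx).trans (le_abs_self _)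

theorem exists_split_of_abs_deriv_ge {g g' : ℝ → ℝ} {a b μ m : ℝ} (hab : a ≤ b) (hμ : 0 < μ)
    (hm : 0 < m) (hg : ∀ x ∈ Set.Icc a b, HasDerivAt g (g' x) x)
    (hl : ∀ x ∈ Set.Icc a b, μ ≤ |g' x|) :
    ∃ c d, a ≤ c ∧ c ≤ d ∧ d ≤ b ∧ d - c ≤ 2 * m / μ ∧
      (a < c → ∀ x ∈ Set.Icc a c, m ≤ |g x|) ∧ (d < b → ∀ x ∈ Set.Icc d b, m ≤ |g x|) := by
  rcases hasDerivWithinAt_forall_lt_or_forall_gt_of_forall_ne (convex_Icc a b) (m := 0)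
    (fun x hx => (hg x hx).hasDerivWithinAt)
    (fun x hx h => by have := hl x hx; rw [h, abs_zero] at this; linarith) with h | h
  · obtain ⟨c, d, h1, h2, h3, h4, h5, h6⟩ := exists_split_of_deriv_ge (g := fun x => -g x)
      (g' := fun x => -g' x) hab hμ hm (fun x hx => (hg x hx).neg)
      (fun x hx => by have := hl x hx; rwa [abs_of_neg (h x hx)] at this)
    exact ⟨c, d, h1, h2, h3, h4, by simpa using h5, by simpa using h6⟩
  · exact exists_split_of_deriv_ge hab hμ hm hg
      (fun x hx => by have := hl x hx; rwa [abs_of_pos (h x hx)] at this)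

/-- If the oscillatory integral is at most `B` on subintervals where `|g| ≥ m`, and `|g'| ≥ μ`
throughout, then on the whole interval the loss is controlled by the set `|g| < m`. -/
theorem norm_osc_le_of_split {φ φ' g g' : ℝ → ℝ} {A A' : ℝ → ℂ} {a b N μ m B : ℝ}
    (hab : a ≤ b) (hμ : 0 < μ) (hm : 0 < m) (hB : 0 ≤ B)
    (hφ : ∀ x ∈ Set.Icc a b, HasDerivAt φ (φ' x) x)
    (hg : ∀ x ∈ Set.Icc a b, HasDerivAt g (g' x) x)
    (hl : ∀ x ∈ Set.Icc a b, μ ≤ |g' x|)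
    (hA : BVAmp A A' a b N)
    (hbd : ∀ c d, a ≤ c → c ≤ d → d ≤ b → (∀ x ∈ Set.Icc c d, m ≤ |g x|) →
      ‖osc φ A c d‖ ≤ B) :
    ‖osc φ A a b‖ ≤ 2 * B + 2 * N * m / μ := by
  have hN : 0 ≤ N := (norm_nonneg _).trans (hA a ⟨le_rfl, hab⟩).2.1
  obtain ⟨c, d, h1, h2, h3, h4, h5, h6⟩ := exists_split_of_abs_deriv_ge hab hμ hm hg hl
  have s1 := osc_split (c := c) hφ hA ⟨h1, h2.trans h3⟩
  have s2 := osc_split (c := d) (a := c)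
    (fun x hx => hφ x (Set.Icc_subset_Icc h1 le_rfl hx)) (hA.mono h1 le_rfl) ⟨h2, h3⟩
  have e1 : ‖osc φ A a c‖ ≤ B := by
    rcases h1.eq_or_lt with h | h
    · simp [osc, h, hB]
    · exact hbd a c le_rfl h1 (h2.trans h3) (h5 h)
  have e2 : ‖osc φ A d b‖ ≤ B := by
    rcases h3.eq_or_lt with h | h
    · simp [osc, h, hB]
    · exact hbd d b (h1.trans h2) h3 le_rfl (h6 h)
  have e3 : ‖osc φ A c d‖ ≤ N * (2 * m / μ) :=
    (norm_osc_le h2 (hA.mono h1 h3)).trans (mul_le_mul_of_nonneg_left h4 hN)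
  rw [s1, s2]
  calc _ ≤ ‖osc φ A a c‖ + (‖osc φ A c d‖ + ‖osc φ A d b‖) :=
        (norm_add_le _ _).trans (add_le_add_right (norm_add_le _ _) _)
    _ ≤ B + (N * (2 * m / μ) + B) := by gcongr
    _ = _ := by ring

theorem vdc_second {φ φ1 φ2 : ℝ → ℝ} {A A' : ℝ → ℂ} {a b N μ : ℝ} (hab : a ≤ b) (hμ : 0 < μ)
    (h1 : ∀ x ∈ Set.Icc a b, HasDerivAt φ (φ1 x) x)
    (h2 : ∀ x ∈ Set.Icc a b, HasDerivAt φ1 (φ2 x) x)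
    (hc : ContinuousOn φ2 (Set.Icc a b))
    (hl : ∀ x ∈ Set.Icc a b, μ ≤ |φ2 x|)
    (hA : BVAmp A A' a b N) : ‖osc φ A a b‖ ≤ 12 * N * μ ^ (-(1 / 2) : ℝ) := by
  have hN : 0 ≤ N := (norm_nonneg _).trans (hA a ⟨le_rfl, hab⟩).2.1
  have hs : (∀ x ∈ Set.Icc a b, 0 ≤ φ2 x) ∨ (∀ x ∈ Set.Icc a b, φ2 x ≤ 0) := by
    rcases hasDerivWithinAt_forall_lt_or_forall_gt_of_forall_ne (convex_Icc a b) (m := 0)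
      (fun x hx => (h2 x hx).hasDerivWithinAt)
      (fun x hx h => by have := hl x hx; rw [h, abs_zero] at this; linarith) with h | h
    · exact Or.inr fun x hx => (h x hx).le
    · exact Or.inl fun x hx => (h x hx).le
  set m : ℝ := μ ^ (1 / 2 : ℝ) with hmdef
  have hm : 0 < m := Real.rpow_pos_of_pos hμ _
  have hmm : m * m = μ := by rw [hmdef, ← Real.rpow_add hμ]; norm_num
  have hinv : μ ^ (-(1 / 2) : ℝ) = 1 / m := by rw [Real.rpow_neg hμ.le, ← hmdef, one_div]
  have := norm_osc_le_of_split (B := 5 * N / m) hab hμ hm (by positivity) h1 h2 hl hA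
    (fun c d hc1 hcd hd hx => by
      have hsub : Set.Icc c d ⊆ Set.Icc a b := Set.Icc_subset_Icc hc1 hd
      exact vdc_first hcd hm (fun x hx => h1 x (hsub hx)) (fun x hx => h2 x (hsub hx))
        (hc.mono hsub) (hs.imp (fun h x hx => h x (hsub hx)) (fun h x hx => h x (hsub hx)))
        hx (hA.mono hc1 hd))
  refine this.trans_eq ?_
  rw [hinv, ← hmm]
  field_simp
  ring

theorem vdc_third {φ φ1 φ2 w g g' : ℝ → ℝ} {A A' : ℝ → ℂ} {a b N μ w0 : ℝ} (hab : a ≤ b)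
    (hμ : 0 < μ) (hw0 : 0 < w0)
    (h1 : ∀ x ∈ Set.Icc a b, HasDerivAt φ (φ1 x) x)
    (h2 : ∀ x ∈ Set.Icc a b, HasDerivAt φ1 (φ2 x) x)
    (hc : ContinuousOn φ2 (Set.Icc a b))
    (hφ2 : ∀ x ∈ Set.Icc a b, φ2 x = w x * g x)
    (hw : ∀ x ∈ Set.Icc a b, w0 ≤ |w x|)
    (hg : ∀ x ∈ Set.Icc a b, HasDerivAt g (g' x) x)
    (hl : ∀ x ∈ Set.Icc a b, μ ≤ |g' x|)
    (hA : BVAmp A A' a b N) : ‖osc φ A a b‖ ≤ 26 * N * (w0 * μ) ^ (-(1 / 3) : ℝ) := by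
  have hN : 0 ≤ N := (norm_nonneg _).trans (hA a ⟨le_rfl, hab⟩).2.1
  set m : ℝ := μ * (w0 * μ) ^ (-(1 / 3) : ℝ) with hmdef
  have hwμ : 0 < w0 * μ := by positivity
  have hm : 0 < m := by positivity
  have := norm_osc_le_of_split (B := 12 * N * (w0 * m) ^ (-(1 / 2) : ℝ)) hab hμ hm (by positivity)
    h1 hg hl hA
    (fun c d hc1 hcd hd hx => by
      have hsub : Set.Icc c d ⊆ Set.Icc a b := Set.Icc_subset_Icc hc1 hd
      exact vdc_second hcd (by positivity) (fun x hx => h1 x (hsub hx))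
        (fun x hx => h2 x (hsub hx)) (hc.mono hsub)
        (fun x hx' => by
          rw [hφ2 x (hsub hx'), abs_mul]
          exact mul_le_mul (hw x (hsub hx')) (hx x hx') hm.le (abs_nonneg _))
        (hA.mono hc1 hd))
  refine this.trans_eq ?_
  have e1 : (w0 * m) ^ (-(1 / 2) : ℝ) = (w0 * μ) ^ (-(1 / 3) : ℝ) := by
    rw [hmdef, ← mul_assoc]
    nth_rewrite 1 [← Real.rpow_one (w0 * μ)]
    rw [← Real.rpow_add hwμ, ← Real.rpow_mul hwμ.le]
    norm_num
  have e2 : 2 * N * m / μ = 2 * N * (w0 * μ) ^ (-(1 / 3) : ℝ) := by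
    rw [hmdef]; field_simp
  rw [e1, e2]; ring

/-! ### Bessel functions of integer order -/

/-- `π` times the Bessel function `J_x(z)`, for integer `x`. -/
def bes (x z : ℝ) : ℝ := ∫ ξ in (0 : ℝ)..π, cos (x * ξ - z * sin ξ)

/-- The derivative of `bes` in `z`. -/
def besD (x z : ℝ) : ℝ := ∫ ξ in (0 : ℝ)..π, sin ξ * sin (x * ξ - z * sin ξ)

/-- The second derivative of `bes` in `z`. -/
def besDD (x z : ℝ) : ℝ := ∫ ξ in (0 : ℝ)..π, -(sin ξ ^ 2 * cos (x * ξ - z * sin ξ))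

theorem hasDerivAt_intervalIntegral_of_abs_deriv_le {F F' : ℝ → ℝ → ℝ} {a b : ℝ} (z : ℝ)
    (hF : ∀ z, Continuous (F z)) (hF' : ∀ z, Continuous (F' z))
    (hd : ∀ z ξ, HasDerivAt (fun z => F z ξ) (F' z ξ) z) (hb : ∀ z ξ, |F' z ξ| ≤ 1) :
    HasDerivAt (fun z => ∫ ξ in a..b, F z ξ) (∫ ξ in a..b, F' z ξ) z :=
  (intervalIntegral.hasDerivAt_integral_of_dominated_loc_of_deriv_le (μ := volume)
    (bound := fun _ => 1) (s := Set.univ) Filter.univ_mem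
    (Filter.Eventually.of_forall fun z => (hF z).aestronglyMeasurable)
    ((hF z).intervalIntegrable _ _) (hF' z).aestronglyMeasurable
    (Filter.Eventually.of_forall fun ξ _ z _ => hb z ξ) intervalIntegrable_const
    (Filter.Eventually.of_forall fun ξ _ z _ => hd z ξ)).2

theorem hasDerivAt_bes_phase (x ξ z : ℝ) :
    HasDerivAt (fun z => x * ξ - z * sin ξ) (-sin ξ) z := by
  simpa using ((hasDerivAt_id z).mul_const (sin ξ)).const_sub (x * ξ)

theorem hasDerivAt_bes_phase_right (x z ξ : ℝ) :
    HasDerivAt (fun ξ => x * ξ - z * sin ξ) (x - z * cos ξ) ξ :=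
  (((hasDerivAt_id ξ).const_mul x).sub ((hasDerivAt_sin ξ).const_mul z)).congr_deriv (by simp)

theorem hasDerivAt_bes (x z : ℝ) : HasDerivAt (bes x) (besD x z) z := by
  refine hasDerivAt_intervalIntegral_of_abs_deriv_le
    (F := fun z ξ => cos (x * ξ - z * sin ξ)) (F' := fun z ξ => sin ξ * sin (x * ξ - z * sin ξ)) z
    (fun z => by fun_prop) (fun z => by fun_prop) (fun z ξ => ?_) (fun z ξ => ?_)
  · exact (hasDerivAt_bes_phase x ξ z).cos.congr_deriv (by ring)
  · rw [abs_mul]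
    exact mul_le_one₀ (abs_sin_le_one _) (abs_nonneg _) (abs_sin_le_one _)

theorem hasDerivAt_besD (x z : ℝ) : HasDerivAt (besD x) (besDD x z) z := by
  refine hasDerivAt_intervalIntegral_of_abs_deriv_le
    (F := fun z ξ => sin ξ * sin (x * ξ - z * sin ξ))
    (F' := fun z ξ => -(sin ξ ^ 2 * cos (x * ξ - z * sin ξ))) z
    (fun z => by fun_prop) (fun z => by fun_prop) (fun z ξ => ?_) (fun z ξ => ?_)
  · exact ((hasDerivAt_bes_phase x ξ z).sin.const_mul (sin ξ)).congr_deriv (by ring)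
  · rw [abs_neg, abs_mul, abs_pow]
    exact mul_le_one₀ (pow_le_one₀ (abs_nonneg _) (abs_sin_le_one _)) (abs_nonneg _)
      (abs_cos_le_one _)

theorem continuous_bes (x : ℝ) : Continuous (bes x) :=
  continuous_iff_continuousAt.2 fun z => (hasDerivAt_bes x z).continuousAt

theorem continuous_besD (x : ℝ) : Continuous (besD x) :=
  continuous_iff_continuousAt.2 fun z => (hasDerivAt_besD x z).continuousAt

/-- Bessel's equation. -/
theorem bes_ode (k : ℤ) (z : ℝ) :
    z ^ 2 * besDD k z + z * besD k z + (z ^ 2 - (k : ℝ) ^ 2) * bes k z = 0 := by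
  have hd : ∀ ξ ∈ Set.uIcc 0 π, HasDerivAt
      (fun ξ => -((k + z * cos ξ) * sin (k * ξ - z * sin ξ)))
      (z ^ 2 * -(sin ξ ^ 2 * cos (k * ξ - z * sin ξ)) + z * (sin ξ * sin (k * ξ - z * sin ξ))
        + (z ^ 2 - (k : ℝ) ^ 2) * cos (k * ξ - z * sin ξ)) ξ := by
    intro ξ _
    have h1 := hasDerivAt_bes_phase_right k z ξ
    have h2 : HasDerivAt (fun ξ => (k : ℝ) + z * cos ξ) (z * -sin ξ) ξ :=
      ((hasDerivAt_cos ξ).const_mul z).const_add _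
    refine ((h2.mul h1.sin).neg).congr_deriv ?_
    linear_combination (z ^ 2 * cos (k * ξ - z * sin ξ)) * sin_sq_add_cos_sq ξ
  have h0 := intervalIntegral.integral_eq_sub_of_hasDerivAt hd
    (Continuous.intervalIntegrable (by fun_prop) _ _)
  have hs : sin ((k : ℝ) * π) = 0 := sin_int_mul_pi k
  simp only [cos_pi, sin_pi, mul_zero, sub_zero, hs, neg_zero, sin_zero] at h0
  rw [intervalIntegral.integral_add, intervalIntegral.integral_add,
    intervalIntegral.integral_const_mul, intervalIntegral.integral_const_mul,
    intervalIntegral.integral_const_mul] at h0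
  · exact h0
  all_goals exact Continuous.intervalIntegrable (by fun_prop) _ _

theorem abs_bes_le_four (x z : ℝ) : |bes x z| ≤ 4 := by
  have := intervalIntegral.norm_integral_le_of_norm_le_const (a := 0) (b := π) (C := 1)
    (f := fun ξ => cos (x * ξ - z * sin ξ)) (fun ξ _ => abs_cos_le_one _)
  rw [Real.norm_eq_abs, sub_zero, abs_of_pos pi_pos, one_mul] at this
  exact this.trans pi_le_four

theorem bes_eq_re_osc (x z : ℝ) :
    bes x z = (osc (fun ξ => x * ξ - z * sin ξ) (fun _ => 1) 0 π).re := by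
  unfold osc bes
  rw [← Complex.reCLM_apply, ← ContinuousLinearMap.intervalIntegral_comp_comm]
  · refine intervalIntegral.integral_congr fun ξ _ => ?_
    simp only [mul_one, Complex.reCLM_apply]
    rw [mul_comm Complex.I, Complex.exp_ofReal_mul_I_re]
  · exact Continuous.intervalIntegrable (by fun_prop) _ _

theorem one_half_le_cos {ξ : ℝ} (h : |ξ| ≤ π / 4) : 1 / 2 ≤ cos ξ := by
  rw [← cos_abs, ← cos_pi_div_three]
  exact cos_le_cos_of_nonneg_of_le_pi (abs_nonneg _) (by linarith [pi_pos])
    (by linarith [pi_pos])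

theorem abs_bes_le (x : ℝ) {z : ℝ} (hz : 0 < z) : |bes x z| ≤ 128 * z ^ (-(1 / 3) : ℝ) := by
  rcases le_total z 1 with h1 | h1
  · have : 1 ≤ z ^ (-(1 / 3) : ℝ) := Real.one_le_rpow_of_pos_of_le_one_of_nonpos hz h1 (by norm_num)
    linarith [abs_bes_le_four x z]
  set φ : ℝ → ℝ := fun ξ => x * ξ - z * sin ξ
  have d1 : ∀ ξ, HasDerivAt φ (x - z * cos ξ) ξ := hasDerivAt_bes_phase_right x z
  have d2 : ∀ ξ, HasDerivAt (fun ξ => x - z * cos ξ) (z * sin ξ) ξ := fun ξ => by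
    simpa using ((hasDerivAt_cos ξ).const_mul z).const_sub x
  have d3 : ∀ ξ, HasDerivAt (fun ξ => z * sin ξ) (z * cos ξ) ξ := fun ξ =>
    (hasDerivAt_sin ξ).const_mul z
  have hA : ∀ a b, BVAmp (fun _ => 1) (fun _ => 0) a b 1 := fun a b ξ _ =>
    ⟨hasDerivAt_const ξ 1, by simp, by simp⟩
  have hπ := pi_pos
  have third : ∀ a b, a ≤ b → (∀ ξ ∈ Set.Icc a b, 1 / 2 ≤ |cos ξ|) →
      ‖osc φ (fun _ => 1) a b‖ ≤ 26 * (z / 2) ^ (-(1 / 3) : ℝ) := by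
    intro a b hab hc
    have := vdc_third (w := fun _ => 1) (w0 := 1) (μ := z / 2) hab (by positivity) one_pos
      (fun ξ _ => d1 ξ) (fun ξ _ => d2 ξ) (by fun_prop) (fun ξ _ => (one_mul _).symm)
      (fun ξ _ => by simp) (fun ξ _ => d3 ξ)
      (fun ξ hξ => by
        rw [abs_mul, abs_of_pos hz]
        have := mul_le_mul_of_nonneg_left (hc ξ hξ) hz.le
        linarith) (hA a b)
    simpa using this
  have e1 := third 0 (π / 4) (by positivity) fun ξ hξ =>
    (one_half_le_cos (by rw [abs_of_nonneg hξ.1]; exact hξ.2)).trans (le_abs_self _)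
  have e3 := third (3 * π / 4) π (by linarith) fun ξ hξ => by
    rw [← abs_neg, ← cos_pi_sub]
    exact (one_half_le_cos (by
      rw [abs_of_nonneg (by linarith [hξ.2])]; linarith [hξ.1])).trans (le_abs_self _)
  have e2 := vdc_second (μ := z / 2) (a := π / 4) (b := 3 * π / 4) (by linarith) (by positivity)
    (fun ξ _ => d1 ξ) (fun ξ _ => d2 ξ) (by fun_prop) (fun ξ hξ => by
        have : 1 / 2 ≤ sin ξ := by
          rw [← cos_pi_div_two_sub]
          exact one_half_le_cos (abs_le.2 ⟨by linarith [hξ.2], by linarith [hξ.1]⟩)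
        rw [abs_of_nonneg (by positivity)]
        nlinarith) (hA _ _)
  have s1 := osc_split (c := π / 4) (a := 0) (b := π) (fun ξ _ => d1 ξ) (hA 0 π)
    ⟨by positivity, by linarith⟩
  have s2 := osc_split (c := 3 * π / 4) (a := π / 4) (b := π) (fun ξ _ => d1 ξ) (hA _ π)
    ⟨by linarith, by linarith⟩
  have p1 : (z / 2) ^ (-(1 / 3) : ℝ) ≤ 2 * z ^ (-(1 / 3) : ℝ) := by
    rw [Real.div_rpow hz.le (by norm_num), Real.rpow_neg zero_le_two, div_inv_eq_mul, mul_comm]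
    gcongr
    exact (Real.rpow_le_rpow_of_exponent_le one_le_two (by norm_num)).trans_eq (Real.rpow_one 2)
  have p2 : (z / 2) ^ (-(1 / 2) : ℝ) ≤ 2 * z ^ (-(1 / 3) : ℝ) := by
    rw [Real.div_rpow hz.le (by norm_num), Real.rpow_neg zero_le_two, div_inv_eq_mul, mul_comm]
    have := Real.rpow_le_rpow_of_exponent_le h1 (show (-(1 / 2) : ℝ) ≤ -(1 / 3) by norm_num)
    gcongr
    exact (Real.rpow_le_rpow_of_exponent_le one_le_two (by norm_num)).trans_eq (Real.rpow_one 2)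
  rw [bes_eq_re_osc]
  refine (Complex.abs_re_le_norm _).trans ?_
  rw [s1, s2]
  refine (norm_add_le _ _).trans ((add_le_add_right (norm_add_le _ _) _).trans ?_)
  linarith

/-- The mass of a Bessel function in its forbidden region is bounded. -/
theorem integral_abs_bes_forbidden (k : ℤ) :
    ∫ z in (0 : ℝ)..|(k : ℝ)|, |bes k z| ≤ 20000 := by
  set n : ℝ := |(k : ℝ)| with hn
  rcases eq_or_ne k 0 with hk | hk
  · simp [hn, hk]
  have hn1 : 1 ≤ n := by
    rw [hn, ← Int.cast_abs]; exact_mod_cast Int.one_le_abs hk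
  have hn0 : 0 < n := by linarith
  have hsq : (k : ℝ) ^ 2 = n ^ 2 := (sq_abs _).symm
  obtain ⟨m, hm1, hmn⟩ : ∃ m : ℝ, 1 ≤ m ∧ m ^ 3 = n :=
    ⟨n ^ (1 / 3 : ℝ), Real.one_le_rpow hn1 (by norm_num), by
      rw [← Real.rpow_natCast, ← Real.rpow_mul hn0.le]; norm_num⟩
  have hm0 : 0 < m := by linarith
  have hinv : n ^ (-(1 / 3) : ℝ) = 1 / m := by
    rw [← hmn, ← Real.rpow_natCast, ← Real.rpow_mul hm0.le,
      show ((3 : ℕ) : ℝ) * -(1 / 3) = -1 by norm_num, Real.rpow_neg_one, one_div]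
  have hc := continuous_bes k
  have hc' := continuous_besD k
  have energy : ∫ z in (0 : ℝ)..n, (n - z) ^ 2 * bes k z ^ 2 ≤ 8192 * m := by
    have := intervalIntegral.integral_le_sub_of_hasDeriv_right_of_le (a := 0) (b := n)
      (g := fun z => (n - z) * (bes k z * (z * besD k z)) + 1 / 2 * (z * bes k z ^ 2))
      (g' := fun z => (n - z) * (z * besD k z ^ 2 + bes k z * (besD k z + z * besDD k z))
        + 1 / 2 * bes k z ^ 2)
      (φ := fun z => (n - z) ^ 2 * bes k z ^ 2) hn0.le (by fun_prop)
      (fun z _ => by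
        have h0 := hasDerivAt_bes k z
        have h1 := hasDerivAt_besD k z
        have h2 := (((hasDerivAt_id z).const_sub n).mul (h0.mul ((hasDerivAt_id z).mul h1))).add
          (((hasDerivAt_id z).mul (h0.pow 2)).const_mul (1 / 2))
        refine (h2.congr_deriv ?_).hasDerivWithinAt
        simp
        ring)
      (Continuous.integrableOn_Icc (by fun_prop))
      (fun z hz => by
        have ode := bes_ode k z
        rw [hsq] at ode
        have hz0 := hz.1
        have hzn := hz.2
        have e : besD k z + z * besDD k z = (n ^ 2 - z ^ 2) * bes k z / z := by
          field_simp; linear_combination ode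
        rw [e]
        have e2 : bes k z * ((n ^ 2 - z ^ 2) * bes k z / z)
            = (n - z) * bes k z ^ 2 + (n - z) * bes k z ^ 2 * (n / z) := by
          field_simp; ring
        rw [e2]
        have a1 : 0 ≤ (n - z) * (z * besD k z ^ 2) := by
          have : 0 ≤ n - z := by linarith
          positivity
        have a2 : 0 ≤ (n - z) * ((n - z) * bes k z ^ 2 * (n / z)) := by
          have : 0 ≤ n - z := by linarith
          positivity
        nlinarith [sq_nonneg (bes k z)])
    refine this.trans ?_
    have hb := abs_bes_le k hn0
    rw [hinv] at hb
    have hb2 : bes k n ^ 2 ≤ (128 * (1 / m)) ^ 2 := sq_le_sq' (abs_le.1 hb).1 (abs_le.1 hb).2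
    have : n * bes k n ^ 2 ≤ n * (128 * (1 / m)) ^ 2 := by gcongr
    have e : n * (128 * (1 / m)) ^ 2 = 16384 * m := by rw [← hmn]; field_simp; norm_num
    simp only [sub_self, zero_mul, mul_zero, zero_add]
    linarith
  set p : ℝ := n - m / 2 with hp
  have hmn' : m ≤ n := by rw [← hmn]; nlinarith [sq_nonneg (m - 1), mul_pos hm0 hm0]
  have hp0 : n / 2 ≤ p := by rw [hp]; linarith
  have hpn : p < n := by rw [hp]; linarith
  have hint : ∀ a b, IntervalIntegrable (fun z => |bes k z|) volume a b := fun a b =>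
    Continuous.intervalIntegrable (by fun_prop) _ _
  rw [← intervalIntegral.integral_add_adjacent_intervals (hint 0 p) (hint p n)]
  have near : ∫ z in p..n, |bes k z| ≤ 128 := by
    have h := intervalIntegral.norm_integral_le_of_norm_le_const (a := p) (b := n)
      (C := 256 * (1 / m)) (f := fun z => |bes k z|) (by
        intro z hz
        rw [Set.uIoc_of_le hpn.le] at hz
        have hz' : n / 2 ≤ z := hp0.trans hz.1.le
        rw [Real.norm_eq_abs, abs_abs]
        refine (abs_bes_le k (by linarith)).trans ?_
        have h1 : z ^ (-(1 / 3) : ℝ) ≤ (n / 2) ^ (-(1 / 3) : ℝ) :=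
          Real.rpow_le_rpow_of_nonpos (by positivity) hz' (by norm_num)
        have h2 : (n / 2) ^ (-(1 / 3) : ℝ) ≤ 2 * (1 / m) := by
          rw [Real.div_rpow hn0.le (by norm_num), Real.rpow_neg zero_le_two, div_inv_eq_mul,
            mul_comm, hinv]
          gcongr
          exact (Real.rpow_le_rpow_of_exponent_le one_le_two (by norm_num)).trans_eq
            (Real.rpow_one 2)
        linarith)
    rw [abs_of_pos (by linarith)] at h
    refine (le_abs_self _).trans (h.trans_eq ?_)
    rw [hp]; field_simp; ring
  have far : ∫ z in (0 : ℝ)..p, |bes k z| ≤ 4096 + 1 := by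
    have hgc : ContinuousOn (fun z => 1 / (n - z) ^ 2) (Set.Icc 0 p) :=
      continuousOn_const.div (by fun_prop) fun z hz =>
        pow_ne_zero 2 (by have := hz.2; linarith)
    have hgi : IntervalIntegrable (fun z => 1 / (n - z) ^ 2) volume 0 p :=
      hgc.intervalIntegrable_of_Icc (by linarith)
    have hfi : ∀ a b, IntervalIntegrable (fun z => (n - z) ^ 2 * bes k z ^ 2) volume a b :=
      fun a b => Continuous.intervalIntegrable (by fun_prop) _ _
    have h1 : ∫ z in (0 : ℝ)..p, |bes k z| ≤ ∫ z in (0 : ℝ)..p,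
        (1 / (2 * m) * ((n - z) ^ 2 * bes k z ^ 2) + m / 2 * (1 / (n - z) ^ 2)) := by
      refine intervalIntegral.integral_mono_on (by linarith) (hint _ _)
        (((hfi _ _).const_mul _).add (hgi.const_mul _)) fun z hz => ?_
      have hzn : 0 < n - z := by have := hz.2; linarith
      have : 0 ≤ ((n - z) * |bes k z| - m / (n - z)) ^ 2 / (2 * m) := by positivity
      have e : ((n - z) * |bes k z| - m / (n - z)) ^ 2 / (2 * m) =
          1 / (2 * m) * ((n - z) ^ 2 * bes k z ^ 2) + m / 2 * (1 / (n - z) ^ 2) - |bes k z| := by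
        rw [← sq_abs (bes k z)]; field_simp; ring
      linarith
    refine h1.trans ?_
    rw [intervalIntegral.integral_add ((hfi _ _).const_mul _) (hgi.const_mul _),
      intervalIntegral.integral_const_mul, intervalIntegral.integral_const_mul]
    have h2 : ∫ z in (0 : ℝ)..p, (n - z) ^ 2 * bes k z ^ 2 ≤ 8192 * m := by
      refine le_trans ?_ energy
      refine intervalIntegral.integral_mono_interval le_rfl (by linarith) hpn.le
        (Filter.Eventually.of_forall fun z => ?_) (hfi _ _)
      simp only [Pi.zero_apply]; positivity
    have h3 : ∫ z in (0 : ℝ)..p, 1 / (n - z) ^ 2 = 1 / (n - p) - 1 / (n - 0) := by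
      refine intervalIntegral.integral_eq_sub_of_hasDerivAt (f := fun z => 1 / (n - z)) ?_ hgi
      intro z hz
      rw [Set.uIcc_of_le (by linarith)] at hz
      have hzn : n - z ≠ 0 := by have := hz.2; linarith
      have := (hasDerivAt_const z (1 : ℝ)).div ((hasDerivAt_id z).const_sub n) hzn
      refine this.congr_deriv ?_
      simp
    have e1 : 1 / (2 * m) * (8192 * m) = 4096 := by field_simp; norm_num
    have e2 : m / 2 * (1 / (n - p)) = 1 := by
      have : n - p = m / 2 := by rw [hp]; ring
      rw [this]; field_simp
    have e3 : 0 ≤ m / 2 * (1 / (n - 0)) := by rw [sub_zero]; positivity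
    rw [h3, mul_sub, e2]
    have := mul_le_mul_of_nonneg_left h2 (show 0 ≤ 1 / (2 * m) by positivity)
    linarith
  linarith

/-! ### Bessel functions in the oscillatory region -/

theorem hasDerivAt_sqrt_sq_sub {n z : ℝ} (hn : 0 ≤ n) (hz : n < z) :
    HasDerivAt (fun z => √(z ^ 2 - n ^ 2)) (z / √(z ^ 2 - n ^ 2)) z := by
  have h : z ^ 2 - n ^ 2 ≠ 0 := by nlinarith
  refine (((hasDerivAt_pow 2 z).sub_const (n ^ 2)).sqrt h).congr_deriv ?_
  norm_num
  rw [mul_div_mul_left _ _ two_ne_zero]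

/-- The energy of `bes` at `z`, of constant order in the oscillatory region. -/
def besEnergy (k : ℤ) (z : ℝ) : ℝ :=
  √(z ^ 2 - |(k : ℝ)| ^ 2) * bes k z ^ 2 + (z * besD k z) ^ 2 / √(z ^ 2 - |(k : ℝ)| ^ 2)

theorem besEnergy_le_of_le (k : ℤ) {w z : ℝ} (hkw : |(k : ℝ)| < w) (hwz : w ≤ z)
    (hc : ∀ y ∈ Set.Icc w z, y ^ 2 / √(y ^ 2 - |(k : ℝ)| ^ 2) ^ 3 ≤ 1) :
    besEnergy k z ≤ 9 * besEnergy k w := by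
  set n : ℝ := |(k : ℝ)| with hn
  have hn0 : 0 ≤ n := abs_nonneg _
  set s : ℝ → ℝ := fun z => √(z ^ 2 - n ^ 2) with hs
  set c : ℝ → ℝ := fun z => z ^ 2 / s z ^ 3 with hcdef
  set F : ℝ → ℝ := fun z => s z * bes k z ^ 2 + (z * besD k z) ^ 2 / s z
    + c z * (bes k z * (z * besD k z)) with hF
  have spos : ∀ y, n < y → 0 < s y := fun y hy => Real.sqrt_pos.2 (by nlinarith)
  have ssq : ∀ y, n < y → s y ^ 2 = y ^ 2 - n ^ 2 := fun y hy => Real.sq_sqrt (by nlinarith)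
  have dc : ∀ y, n < y → HasDerivAt c (-(y * (3 * y ^ 2 - 2 * s y ^ 2)) / s y ^ 5) y := by
    intro y hy
    have hs0 := (spos y hy).ne'
    refine ((hasDerivAt_pow 2 y).div ((hasDerivAt_sqrt_sq_sub hn0 hy).pow 3)
      (pow_ne_zero 3 hs0)).congr_deriv ?_
    change (_ * s y ^ 3 - _ * (_ * s y ^ 2 * (y / s y))) / (s y ^ 3) ^ 2 = _
    field_simp
    ring
  have dF : ∀ y, n < y → HasDerivAt F
      (-(y * (3 * y ^ 2 - 2 * s y ^ 2)) / s y ^ 5 * (bes k y * (y * besD k y))) y := by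
    intro y hy
    have hs0 := (spos y hy).ne'
    have hy0 : y ≠ 0 := (hn0.trans_lt hy).ne'
    have ds : HasDerivAt s (y / s y) y := hasDerivAt_sqrt_sq_sub hn0 hy
    have h0 := hasDerivAt_bes k y
    have h1 := (hasDerivAt_id y).mul (hasDerivAt_besD k y)
    have ode := bes_ode k y
    have e : besDD k y = (-(y * besD k y) - s y ^ 2 * bes k y) / y ^ 2 := by
      rw [ssq y hy, hn, sq_abs]; field_simp; linear_combination ode
    refine (((ds.mul (h0.pow 2)).add ((h1.pow 2).div ds hs0)).add
      ((dc y hy).mul (h0.mul h1))).congr_deriv ?_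
    simp only [id_eq, e, Pi.mul_apply, Pi.pow_apply, hcdef]
    field_simp
    ring
  have hcross : ∀ y, n < y → |bes k y * (y * besD k y)| ≤
      (s y * bes k y ^ 2 + (y * besD k y) ^ 2 / s y) / 2 := by
    intro y hy
    have hs0 := spos y hy
    have e : ∀ σ : ℝ, σ ^ 2 = 1 → (s y * bes k y - σ * (y * besD k y)) ^ 2 / s y
        = s y * bes k y ^ 2 + (y * besD k y) ^ 2 / s y
          - 2 * σ * (bes k y * (y * besD k y)) := fun σ hσ => by
      field_simp; linear_combination (y ^ 2 * besD k y ^ 2) * hσ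
    have p1 : 0 ≤ (s y * bes k y - 1 * (y * besD k y)) ^ 2 / s y := by positivity
    have p2 : 0 ≤ (s y * bes k y - -1 * (y * besD k y)) ^ 2 / s y := by positivity
    rw [e 1 (by norm_num)] at p1
    rw [e (-1) (by norm_num)] at p2
    exact abs_le.2 ⟨by linarith, by linarith⟩
  have hc0 : ∀ y, n < y → 0 ≤ c y := fun y hy => by
    have := spos y hy
    positivity
  have hlow : ∀ y, n < y → c y ≤ 1 →
      (s y * bes k y ^ 2 + (y * besD k y) ^ 2 / s y) / 2 ≤ F y := by
    intro y hy h1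
    have := hcross y hy
    have h2 : |c y * (bes k y * (y * besD k y))| ≤ 1 * |bes k y * (y * besD k y)| := by
      rw [abs_mul, abs_of_nonneg (hc0 y hy)]; gcongr
    have := (abs_le.1 h2).1
    simp only [hF]
    linarith
  have hlt : ∀ y ∈ Set.Icc w z, n < y := fun y hy => hkw.trans_le hy.1
  have dG : ∀ y, n < y → HasDerivAt (fun y => F y * exp (c y))
      (-(y * (3 * y ^ 2 - 2 * s y ^ 2)) / s y ^ 5 * (bes k y * (y * besD k y) + F y)
        * exp (c y)) y := fun y hy =>
    ((dF y hy).mul (dc y hy).exp).congr_deriv (by ring)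
  have hanti : AntitoneOn (fun y => F y * exp (c y)) (Set.Icc w z) := by
    refine antitoneOn_of_hasDerivWithinAt_nonpos (convex_Icc w z)
      (fun y hy => (dG y (hlt y hy)).continuousAt.continuousWithinAt)
      (fun y hy => (dG y (hlt y (interior_subset hy))).hasDerivWithinAt) (fun y hy => ?_)
    have hy' := interior_subset hy
    have hny := hlt y hy'
    have hs0 := spos y hny
    have hy0 : 0 < y := hn0.trans_lt hny
    have h1 : 0 ≤ y * (3 * y ^ 2 - 2 * s y ^ 2) := by
      rw [ssq y hny]; have : 0 ≤ 3 * y ^ 2 - 2 * (y ^ 2 - n ^ 2) := by nlinarith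
      positivity
    have h2 : 0 ≤ bes k y * (y * besD k y) + F y := by
      have := (abs_le.1 (hcross y hny)).1
      linarith [hlow y hny (hc y hy')]
    have h3 : -(y * (3 * y ^ 2 - 2 * s y ^ 2)) / s y ^ 5 ≤ 0 :=
      div_nonpos_of_nonpos_of_nonneg (by linarith) (by positivity)
    exact mul_nonpos_of_nonpos_of_nonneg (mul_nonpos_of_nonpos_of_nonneg h3 h2) (exp_pos _).le
  have hw : w ∈ Set.Icc w z := ⟨le_rfl, hwz⟩
  have hz : z ∈ Set.Icc w z := ⟨hwz, le_rfl⟩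
  have h1 := hanti hw hz hwz
  simp only at h1
  have h2 := hlow z (hlt z hz) (hc z hz)
  have h3 : F w ≤ 3 / 2 * (s w * bes k w ^ 2 + (w * besD k w) ^ 2 / s w) := by
    have a1 := hcross w hkw
    have a2 : |c w * (bes k w * (w * besD k w))| ≤ 1 * |bes k w * (w * besD k w)| := by
      rw [abs_mul, abs_of_nonneg (hc0 w hkw)]; gcongr; exact hc w hw
    have := (abs_le.1 a2).2
    simp only [hF]
    linarith
  have hE0 : ∀ y, n < y → 0 ≤ s y * bes k y ^ 2 + (y * besD k y) ^ 2 / s y := fun y hy => by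
    have := spos y hy; positivity
  have h4 : exp (c w) ≤ 3 := (exp_le_exp.2 (hc w hw)).trans (by linarith [exp_one_lt_d9])
  have h5 : 1 ≤ exp (c z) := one_le_exp (hc0 z (hlt z hz))
  have hFz : 0 ≤ F z := le_trans (by linarith [hE0 z (hlt z hz)]) h2
  have h6 : F z ≤ F z * exp (c z) := le_mul_of_one_le_right hFz h5
  have h7 : F w * exp (c w) ≤
      3 / 2 * (s w * bes k w ^ 2 + (w * besD k w) ^ 2 / s w) * 3 := by
    have := hE0 w hkw
    exact mul_le_mul h3 h4 (exp_pos _).le (by positivity)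
  change s z * bes k z ^ 2 + (z * besD k z) ^ 2 / s z ≤
    9 * (s w * bes k w ^ 2 + (w * besD k w) ^ 2 / s w)
  linarith

theorem besEnergy_le (k : ℤ) {m z : ℝ} (hm : 1 ≤ m) (hmk : m ^ 3 = max |(k : ℝ)| 1)
    (hz : |(k : ℝ)| + 3 * m ≤ z) : besEnergy k z ≤ 4000 ^ 2 := by
  set n : ℝ := |(k : ℝ)| with hn
  have hn0 : 0 ≤ n := abs_nonneg _
  have hm0 : 0 < m := by linarith
  have hnm : n ≤ m ^ 3 := hmk ▸ le_max_left _ _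
  have hm3n : m ^ 3 ≤ n + m := by
    rw [hmk]; exact max_le (by linarith) (by linarith)
  have hmm3 : m ≤ m ^ 3 := by nlinarith [sq_nonneg (m - 1), mul_pos hm0 hm0]
  have hc : ∀ y, n + 2 * m ≤ y → y ^ 2 / √(y ^ 2 - n ^ 2) ^ 3 ≤ 1 := by
    intro y hy
    have hq : 0 < y ^ 2 - n ^ 2 := by nlinarith
    have hs : 0 < √(y ^ 2 - n ^ 2) := Real.sqrt_pos.2 hq
    rw [div_le_one (by positivity)]
    refine le_of_sq_le_sq ?_ (by positivity)
    have e : (√(y ^ 2 - n ^ 2) ^ 3) ^ 2 = (y ^ 2 - n ^ 2) ^ 3 := by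
      rw [← pow_mul, mul_comm, pow_mul, Real.sq_sqrt hq.le]
    rw [e]
    set d := y - n with hd
    have hd2 : 2 * m ≤ d := by linarith
    have hy0 : 0 < y := by linarith
    have h1 : d * y ≤ y ^ 2 - n ^ 2 := by
      have : y ^ 2 - n ^ 2 = d * y + d * n := by rw [hd]; ring
      have : 0 ≤ d * n := by apply mul_nonneg <;> linarith
      linarith
    have h2 : y ≤ d ^ 3 := by
      have a1 : (2 * m) ^ 3 ≤ d ^ 3 := by gcongr
      have a2 : (2 : ℝ) ^ 2 ≤ d ^ 2 := by gcongr; linarith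
      have a3 : 4 * d ≤ d ^ 3 := by nlinarith
      have : y = d + n := by rw [hd]; ring
      nlinarith
    calc (y ^ 2) ^ 2 = y * y ^ 3 := by ring
      _ ≤ d ^ 3 * y ^ 3 := by gcongr
      _ = (d * y) ^ 3 := by ring
      _ ≤ _ := by gcongr; nlinarith
  obtain ⟨w, ⟨hw1, hw2⟩, hw⟩ := exists_hasDerivAt_eq_slope (bes k) (besD k)
    (a := n + 2 * m) (b := n + 3 * m) (by linarith) (continuous_bes k).continuousOn
    (fun y _ => hasDerivAt_bes k y)
  have hJ : ∀ y, n + 2 * m ≤ y → |bes k y| ≤ 128 / m := by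
    intro y hy
    refine (abs_bes_le k (by linarith)).trans ?_
    rw [div_eq_mul_inv 128 m]
    have h1 : m ^ 3 ≤ y := by linarith
    have h2 : y ^ (-(1 / 3) : ℝ) ≤ (m ^ 3) ^ (-(1 / 3) : ℝ) :=
      Real.rpow_le_rpow_of_nonpos (by positivity) h1 (by norm_num)
    have h3 : (m ^ 3) ^ (-(1 / 3) : ℝ) = m⁻¹ := by
      rw [← Real.rpow_natCast, ← Real.rpow_mul hm0.le,
        show ((3 : ℕ) : ℝ) * -(1 / 3) = -1 by norm_num, Real.rpow_neg_one]
    rw [h3] at h2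
    gcongr
  refine (besEnergy_le_of_le k (by linarith) (hw2.le.trans hz) fun y hy =>
    hc y (by linarith [hy.1])).trans ?_
  have hq : 0 < w ^ 2 - n ^ 2 := by nlinarith
  have hw0 : 0 < w := by linarith
  have hw4 : w ≤ 4 * m ^ 3 := by linarith
  have hs : 0 < √(w ^ 2 - n ^ 2) := Real.sqrt_pos.2 hq
  have hs1 : √(w ^ 2 - n ^ 2) ≤ 4 * m ^ 2 := by
    rw [Real.sqrt_le_left (by positivity)]
    have : w ^ 2 - n ^ 2 = (w - n) * (w + n) := by ring
    rw [this]
    calc (w - n) * (w + n) ≤ (3 * m) * (5 * m ^ 3) := by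
          apply mul_le_mul <;> nlinarith
      _ ≤ _ := by nlinarith [pow_pos hm0 4]
  have hs2 : m ^ 2 ≤ √(w ^ 2 - n ^ 2) := by
    refine Real.le_sqrt_of_sq_le ?_
    have : w ^ 2 - n ^ 2 = (w - n) * (w + n) := by ring
    rw [this]
    calc (m ^ 2) ^ 2 = m * m ^ 3 := by ring
      _ ≤ _ := by apply mul_le_mul <;> nlinarith
  have hb := hJ w hw1.le
  have hb1 : |besD k w| ≤ 256 / m ^ 2 := by
    rw [hw, abs_div, abs_of_pos (by linarith : 0 < n + 3 * m - (n + 2 * m))]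
    have e : n + 3 * m - (n + 2 * m) = m := by ring
    rw [e, div_le_iff₀ hm0]
    have e2 : 256 / m ^ 2 * m = 128 / m + 128 / m := by field_simp; norm_num
    rw [e2]
    exact (abs_sub _ _).trans (add_le_add (hJ _ (by linarith)) (hJ _ le_rfl))
  have t1 : √(w ^ 2 - n ^ 2) * bes k w ^ 2 ≤ 65536 := by
    rw [← sq_abs (bes k w)]
    calc _ ≤ (4 * m ^ 2) * (128 / m) ^ 2 := by gcongr
      _ = 65536 := by field_simp; norm_num
  have t2 : (w * besD k w) ^ 2 / √(w ^ 2 - n ^ 2) ≤ 1048576 := by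
    rw [mul_pow, ← sq_abs (besD k w)]
    calc _ ≤ ((4 * m ^ 3) ^ 2 * (256 / m ^ 2) ^ 2) / m ^ 2 := by gcongr
      _ = 1048576 := by field_simp; norm_num
  unfold besEnergy
  linarith

/-- The phase of `bes` in the oscillatory region. -/
def besPhase (n z : ℝ) : ℝ := ∫ u in (1 : ℝ)..z, √(u ^ 2 - n ^ 2) / max u 1

theorem hasDerivAt_besPhase (n : ℝ) {z : ℝ} (hz : 1 ≤ z) :
    HasDerivAt (besPhase n) (√(z ^ 2 - n ^ 2) / z) z := by
  have hc : Continuous fun u : ℝ => √(u ^ 2 - n ^ 2) / max u 1 :=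
    Continuous.div (by fun_prop) (by fun_prop) fun u => by positivity
  have := intervalIntegral.integral_hasDerivAt_right (hc.intervalIntegrable 1 z)
    hc.aestronglyMeasurable.stronglyMeasurableAtFilter hc.continuousAt
  rwa [max_eq_left hz] at this

/-- The complex amplitude of `bes` in the oscillatory region. -/
def besAmp (k : ℤ) (z : ℝ) : ℂ :=
  1 / 2 * Complex.exp (Complex.I * (besPhase |(k : ℝ)| z : ℝ)) *
    ((bes k z : ℝ) + Complex.I * (z * besD k z / √(z ^ 2 - |(k : ℝ)| ^ 2) : ℝ))

/-- The derivative of `besAmp`. -/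
def besAmpD (k : ℤ) (z : ℝ) : ℂ :=
  1 / 2 * Complex.exp (Complex.I * (besPhase |(k : ℝ)| z : ℝ)) *
    (-(Complex.I * (z ^ 2 * besD k z / √(z ^ 2 - |(k : ℝ)| ^ 2) ^ 3 : ℝ)))

theorem hasDerivAt_besAmp (k : ℤ) {z : ℝ} (hz : 1 ≤ z) (hkz : |(k : ℝ)| < z) :
    HasDerivAt (besAmp k) (besAmpD k z) z := by
  set n : ℝ := |(k : ℝ)| with hn
  have hn0 : 0 ≤ n := abs_nonneg _
  have hq : 0 < z ^ 2 - n ^ 2 := by nlinarith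
  have hs : 0 < √(z ^ 2 - n ^ 2) := Real.sqrt_pos.2 hq
  have ds := hasDerivAt_sqrt_sq_sub hn0 hkz
  have hsq : √(z ^ 2 - n ^ 2) ^ 2 = z ^ 2 - n ^ 2 := Real.sq_sqrt hq.le
  have h0 := hasDerivAt_bes k z
  have h1 := (hasDerivAt_id z).mul (hasDerivAt_besD k z)
  have ode := bes_ode k z
  have hz0 : 0 < z := by linarith
  have e : besDD k z = (-(z * besD k z) - √(z ^ 2 - n ^ 2) ^ 2 * bes k z) / z ^ 2 := by
    rw [hsq, hn, sq_abs]; field_simp; linear_combination ode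
  have h2 : HasDerivAt (fun z => z * besD k z / √(z ^ 2 - n ^ 2))
      (-(√(z ^ 2 - n ^ 2) * bes k z / z) - z ^ 2 * besD k z / √(z ^ 2 - n ^ 2) ^ 3) z := by
    refine (h1.div ds hs.ne').congr_deriv ?_
    simp only [id_eq, e, Pi.mul_apply]
    field_simp
    ring
  have h3 := hasDerivAt_cexp_I_mul (hasDerivAt_besPhase n hz)
  refine ((h3.const_mul (1 / 2)).mul (h0.ofReal_comp.add
    (h2.ofReal_comp.const_mul Complex.I))).congr_deriv ?_
  unfold besAmpD
  simp only [← hn, Pi.add_apply]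
  push_cast
  have hz0' : (z : ℂ) ≠ 0 := by exact_mod_cast hz0.ne'
  have hs' : ((√(z ^ 2 - n ^ 2) : ℝ) : ℂ) ≠ 0 := by exact_mod_cast hs.ne'
  generalize ((√(z ^ 2 - n ^ 2) : ℝ) : ℂ) = S at *
  generalize Complex.exp (Complex.I * (besPhase n z : ℝ)) = X at *
  field_simp
  linear_combination (X * S ^ 3 * (z : ℂ) * (besD k z : ℂ)) * Complex.I_sq

theorem bes_eq_besAmp (k : ℤ) (z : ℝ) :
    (bes k z : ℂ) = Complex.exp (Complex.I * (besPhase |(k : ℝ)| z : ℝ)) *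
        (starRingEnd ℂ) (besAmp k z)
      + Complex.exp (Complex.I * (-besPhase |(k : ℝ)| z : ℝ)) * besAmp k z := by
  unfold besAmp
  simp only [map_mul, map_add, map_div₀, map_one, map_ofNat, ← Complex.exp_conj, Complex.conj_I,
    Complex.conj_ofReal]
  have e : ∀ y : ℝ, Complex.exp (Complex.I * (y : ℝ)) * Complex.exp (-Complex.I * (y : ℝ)) = 1 :=
    fun y => by rw [← Complex.exp_add]; simp
  have e' := e (besPhase |(k : ℝ)| z)
  have e2 : Complex.exp (Complex.I * ((-besPhase |(k : ℝ)| z : ℝ) : ℂ))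
      = Complex.exp (-Complex.I * (besPhase |(k : ℝ)| z : ℝ)) := by
    congr 1; push_cast; ring
  rw [e2]
  linear_combination (-(bes k z : ℂ)) * e'

theorem norm_besAmp_sq (k : ℤ) {z : ℝ} (hkz : |(k : ℝ)| < z) :
    ‖besAmp k z‖ ^ 2 = besEnergy k z / (4 * √(z ^ 2 - |(k : ℝ)| ^ 2)) ∧
    ((z - |(k : ℝ)|) * ‖besAmpD k z‖) ^ 2 ≤ besEnergy k z / (4 * √(z ^ 2 - |(k : ℝ)| ^ 2)) := by
  set n : ℝ := |(k : ℝ)| with hn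
  have hn0 : 0 ≤ n := abs_nonneg _
  have hq : 0 < z ^ 2 - n ^ 2 := by nlinarith
  have hs : 0 < √(z ^ 2 - n ^ 2) := Real.sqrt_pos.2 hq
  have hsq : √(z ^ 2 - n ^ 2) ^ 2 = z ^ 2 - n ^ 2 := Real.sq_sqrt hq.le
  unfold besAmp besAmpD besEnergy
  simp only [← hn]
  set s := √(z ^ 2 - n ^ 2)
  constructor
  · rw [norm_mul, norm_mul, norm_cexp_I_mul, mul_pow, ← Complex.normSq_eq_norm_sq (_ + _),
      mul_comm Complex.I, Complex.normSq_add_mul_I]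
    norm_num
    field_simp
  · rw [norm_mul, norm_mul, norm_cexp_I_mul, norm_neg, norm_mul, Complex.norm_I, Complex.norm_real,
      Real.norm_eq_abs]
    have e : ((z - n) * (‖(1 / 2 : ℂ)‖ * 1 * (1 * |z ^ 2 * besD k z / s ^ 3|))) ^ 2
        = ((z - n) * z / s ^ 2) ^ 2 * ((z * besD k z) ^ 2 / s / (4 * s)) := by
      norm_num
      simp only [mul_pow, div_pow, sq_abs]
      field_simp
      ring
    rw [e]
    have h1 : (z - n) * z / s ^ 2 ≤ 1 := by
      rw [div_le_one (by positivity), hsq]; nlinarith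
    have h0 : 0 ≤ (z - n) * z / s ^ 2 := by
      have : 0 ≤ z - n := by linarith
      have : 0 ≤ z := by linarith
      positivity
    have h2 : ((z - n) * z / s ^ 2) ^ 2 ≤ 1 := pow_le_one₀ h0 h1
    calc _ ≤ 1 * ((z * besD k z) ^ 2 / s / (4 * s)) := by gcongr
      _ ≤ _ := by
        rw [one_mul]; gcongr
        have : 0 ≤ s * bes k z ^ 2 := by positivity
        linarith

/-- The sign attached to a branch. -/
def sgn (b : Bool) : ℝ := if b then 1 else -1

theorem exists_bes_wkb (k : ℤ) {t : ℝ} (ht : 1 ≤ t) : ∃ (ψ : ℝ → ℝ) (A A' : Bool → ℝ → ℂ),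
    ∀ r ∈ Set.Icc (1 / 5 : ℝ) 5, |(k : ℝ)| / t + 6 * t ^ (-(2 / 3) : ℝ) ≤ r →
      HasDerivAt ψ (t * √(1 - (|(k : ℝ)| / t) ^ 2 / r ^ 2)) r ∧
      (bes k (t * r) : ℂ) = ∑ b, Complex.exp (Complex.I * (sgn b * ψ r : ℝ)) * A b r ∧
      ∀ b, HasDerivAt (A b) (A' b r) r ∧
        ‖A b r‖ ≤ 4000 * (t ^ (-(1 / 2) : ℝ) * (r - |(k : ℝ)| / t) ^ (-(1 / 4) : ℝ)) ∧
        (r - |(k : ℝ)| / t) * ‖A' b r‖ ≤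
          4000 * (t ^ (-(1 / 2) : ℝ) * (r - |(k : ℝ)| / t) ^ (-(1 / 4) : ℝ)) := by
  have ht0 : 0 < t := by linarith
  refine ⟨fun r => besPhase |(k : ℝ)| (t * r),
    fun b r => if b then (starRingEnd ℂ) (besAmp k (t * r)) else besAmp k (t * r),
    fun b r => if b then (starRingEnd ℂ) (t * besAmpD k (t * r)) else t * besAmpD k (t * r), ?_⟩
  intro r hr hvr
  set n : ℝ := |(k : ℝ)| with hn
  have hn0 : 0 ≤ n := abs_nonneg _
  have hr0 : 0 < r := by linarith [hr.1]
  set τ : ℝ := t ^ (1 / 3 : ℝ) with hτ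
  have hτ1 : 1 ≤ τ := Real.one_le_rpow ht (by norm_num)
  have hτ3 : τ ^ 3 = t := by
    rw [hτ, ← Real.rpow_natCast, ← Real.rpow_mul ht0.le]; norm_num
  have hτ2 : t * t ^ (-(2 / 3) : ℝ) = τ := by
    nth_rewrite 1 [← Real.rpow_one t]
    rw [← Real.rpow_add ht0, hτ]; norm_num
  have hM : 0 ≤ max n 1 := by positivity
  obtain ⟨m, hm1, hm3⟩ : ∃ m : ℝ, 1 ≤ m ∧ m ^ 3 = max n 1 :=
    ⟨(max n 1) ^ (1 / 3 : ℝ), Real.one_le_rpow (le_max_right _ _) (by norm_num), by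
      rw [← Real.rpow_natCast, ← Real.rpow_mul hM]; norm_num⟩
  have htr : n + 6 * τ ≤ t * r := by
    have := mul_le_mul_of_nonneg_left hvr ht0.le
    rw [mul_add, mul_div_cancel₀ _ ht0.ne', mul_left_comm, hτ2] at this
    exact this
  have hm2 : m ≤ 2 * τ := by
    refine le_of_pow_le_pow_left₀ three_ne_zero (by positivity) ?_
    rw [hm3, mul_pow, hτ3]
    refine max_le ?_ (by linarith)
    have := mul_le_mul_of_nonneg_left hr.2 ht0.le
    linarith
  have hz : n + 3 * m ≤ t * r := by linarith
  have hz1 : 1 ≤ t * r := by linarith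
  have hnz : n < t * r := by linarith
  have hE := besEnergy_le k hm1 hm3 hz
  obtain ⟨b1, b2⟩ := norm_besAmp_sq k hnz
  rw [← hn] at b1 b2
  set s := √((t * r) ^ 2 - n ^ 2) with hsdef
  have hq : 0 < (t * r) ^ 2 - n ^ 2 := by nlinarith
  have hs : 0 < s := Real.sqrt_pos.2 hq
  have hrv : 0 < r - n / t := by
    have : n / t < r := by rw [div_lt_iff₀ ht0]; linarith
    linarith
  set B : ℝ := 4000 * (t ^ (-(1 / 2) : ℝ) * (r - n / t) ^ (-(1 / 4) : ℝ)) with hB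
  have hB0 : 0 ≤ B := by positivity
  have hB2 : B ^ 2 = 4000 ^ 2 / (t * √(r - n / t)) := by
    rw [hB, mul_pow, mul_pow, ← Real.rpow_natCast (t ^ _), ← Real.rpow_mul ht0.le,
      ← Real.rpow_natCast ((r - n / t) ^ _), ← Real.rpow_mul hrv.le, Real.sqrt_eq_rpow,
      show -(1 / 2 : ℝ) * ((2 : ℕ) : ℝ) = -1 by norm_num,
      show -(1 / 4 : ℝ) * ((2 : ℕ) : ℝ) = -(1 / 2) by norm_num, Real.rpow_neg ht0.le,
      Real.rpow_neg hrv.le, Real.rpow_one]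
    field_simp
  have hsB : t * √(r - n / t) ≤ 4 * s := by
    refine le_of_sq_le_sq ?_ (by positivity)
    rw [mul_pow, Real.sq_sqrt hrv.le, mul_pow, hsdef, Real.sq_sqrt hq.le]
    have e : t ^ 2 * (r - n / t) = t * (t * r - n) := by field_simp
    have e' : (t * r) ^ 2 - n ^ 2 = (t * r - n) * (t * r + n) := by ring
    rw [e, e']
    have : t ≤ 5 * (t * r) := by nlinarith [hr.1]
    nlinarith
  have hfin : besEnergy k (t * r) / (4 * s) ≤ B ^ 2 := by
    rw [hB2]
    exact div_le_div₀ (by positivity) hE (by positivity) hsB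
  have c1 : ‖besAmp k (t * r)‖ ≤ B := le_of_sq_le_sq (b1.le.trans hfin) hB0
  have c2 : (r - n / t) * ‖(t : ℂ) * besAmpD k (t * r)‖ ≤ B := by
    have e : (r - n / t) * ‖(t : ℂ) * besAmpD k (t * r)‖ = (t * r - n) * ‖besAmpD k (t * r)‖ := by
      rw [norm_mul, Complex.norm_real, Real.norm_eq_abs, abs_of_pos ht0]; field_simp
    rw [e]
    exact le_of_sq_le_sq (b2.trans hfin) hB0
  have hsc : HasDerivAt (fun r => t * r) t r := by simpa using (hasDerivAt_id r).const_mul t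
  have dA : HasDerivAt (fun r => besAmp k (t * r)) (t * besAmpD k (t * r)) r := by
    refine ((hasDerivAt_besAmp k hz1 hnz).scomp r hsc).congr_deriv ?_
    rw [Complex.real_smul]
  refine ⟨?_, ?_, ?_⟩
  · refine ((hasDerivAt_besPhase n hz1).comp r hsc).congr_deriv ?_
    have e : (t * r) ^ 2 - n ^ 2 = (t * r) ^ 2 * (1 - (n / t) ^ 2 / r ^ 2) := by
      field_simp
    rw [e, Real.sqrt_mul (by positivity), Real.sqrt_sq (by positivity)]
    field_simp
  · rw [Fintype.sum_bool, bes_eq_besAmp]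
    simp [sgn, hn]
  · intro b
    cases b
    · exact ⟨by simpa using dA, by simpa using c1, by simpa using c2⟩
    · refine ⟨by simpa using dA.star, ?_, ?_⟩
      · simpa only [if_true, RCLike.norm_conj] using c1
      · simpa only [if_true, RCLike.norm_conj] using c2

/-! ### The phase function of the product of three Bessel functions -/

/-- `√(1 - v² / r²)`. -/
def phS (v r : ℝ) : ℝ := √(1 - v ^ 2 / r ^ 2)

theorem phS_sq {v r : ℝ} (hv : 0 ≤ v) (hr : v < r) : phS v r ^ 2 = 1 - v ^ 2 / r ^ 2 := by
  refine Real.sq_sqrt ?_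
  have : 0 < r := hv.trans_lt hr
  rw [sub_nonneg, div_le_one (by positivity)]
  gcongr

theorem phS_pos {v r : ℝ} (hv : 0 ≤ v) (hr : v < r) : 0 < phS v r := by
  refine Real.sqrt_pos.2 ?_
  have : 0 < r := hv.trans_lt hr
  rw [sub_pos, div_lt_one (by positivity)]
  gcongr

theorem phS_le_one (v r : ℝ) : phS v r ≤ 1 := by
  refine Real.sqrt_le_one.2 ?_
  have : 0 ≤ v ^ 2 / r ^ 2 := by positivity
  linarith

theorem hasDerivAt_phS {v r : ℝ} (hv : 0 ≤ v) (hr : v < r) :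
    HasDerivAt (phS v) (v ^ 2 / phS v r / r ^ 3) r := by
  have hr0 : 0 < r := hv.trans_lt hr
  have hs := phS_pos hv hr
  have h : 1 - v ^ 2 / r ^ 2 ≠ 0 := by rw [← phS_sq hv hr]; positivity
  have := (((hasDerivAt_const r (v ^ 2)).div (hasDerivAt_pow 2 r)
    (pow_ne_zero 2 hr0.ne')).const_sub 1).sqrt h
  refine this.congr_deriv ?_
  change _ / (2 * phS v r) = _
  norm_num
  field_simp

/-- `v² / √(1 - v² / r²)`. -/
def phG (v r : ℝ) : ℝ := v ^ 2 / phS v r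

/-- `v⁴ / (1 - v² / r²)^{3/2}`. -/
def phT (v r : ℝ) : ℝ := v ^ 4 / phS v r ^ 3

theorem hasDerivAt_phG {v r : ℝ} (hv : 0 ≤ v) (hr : v < r) :
    HasDerivAt (phG v) (-(phT v r / r ^ 3)) r := by
  have hr0 : 0 < r := hv.trans_lt hr
  have hs := phS_pos hv hr
  refine ((hasDerivAt_const r (v ^ 2)).div (hasDerivAt_phS hv hr) hs.ne').congr_deriv ?_
  unfold phT
  field_simp
  ring

/-- The first derivative of the phase, divided by `t`. -/
def phF (ε₁ ε₂ ε₃ v₁ v₂ v₃ r : ℝ) : ℝ :=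
  ε₁ * phS v₁ r + ε₂ * phS v₂ r + ε₃ * phS v₃ r - (7 - 1 / r ^ 2) / 2

/-- The second derivative of the phase is `-2 t r⁻³ * phGG`. -/
def phGG (ε₁ ε₂ ε₃ v₁ v₂ v₃ r : ℝ) : ℝ :=
  (1 - (ε₁ * phG v₁ r + ε₂ * phG v₂ r + ε₃ * phG v₃ r)) / 2

/-- The derivative of `phGG` is `r⁻³ * phH / 2`. -/
def phH (ε₁ ε₂ ε₃ v₁ v₂ v₃ r : ℝ) : ℝ :=
  ε₁ * phT v₁ r + ε₂ * phT v₂ r + ε₃ * phT v₃ r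

theorem hasDerivAt_phF (ε₁ ε₂ ε₃ : ℝ) {v₁ v₂ v₃ r : ℝ} (h3 : 0 ≤ v₃) (h32 : v₃ ≤ v₂)
    (h21 : v₂ ≤ v₁) (hr : v₁ < r) :
    HasDerivAt (phF ε₁ ε₂ ε₃ v₁ v₂ v₃) (-2 / r ^ 3 * phGG ε₁ ε₂ ε₃ v₁ v₂ v₃ r) r := by
  have hr0 : 0 < r := by linarith
  have d1 := (hasDerivAt_phS (by linarith) hr).const_mul ε₁
  have d2 := (hasDerivAt_phS (v := v₂) (r := r) (by linarith) (by linarith)).const_mul ε₂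
  have d3 := (hasDerivAt_phS h3 (by linarith : v₃ < r)).const_mul ε₃
  have d4 := ((((hasDerivAt_const r (1 : ℝ)).div (hasDerivAt_pow 2 r)
    (pow_ne_zero 2 hr0.ne')).const_sub 7).div_const 2)
  refine (((d1.add d2).add d3).sub d4).congr_deriv ?_
  unfold phGG phG
  norm_num
  field_simp
  ring

theorem hasDerivAt_phGG (ε₁ ε₂ ε₃ : ℝ) {v₁ v₂ v₃ r : ℝ} (h3 : 0 ≤ v₃) (h32 : v₃ ≤ v₂)
    (h21 : v₂ ≤ v₁) (hr : v₁ < r) :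
    HasDerivAt (phGG ε₁ ε₂ ε₃ v₁ v₂ v₃) (phH ε₁ ε₂ ε₃ v₁ v₂ v₃ r / (2 * r ^ 3)) r := by
  have hr0 : 0 < r := by linarith
  have d1 := (hasDerivAt_phG (by linarith) hr).const_mul ε₁
  have d2 := (hasDerivAt_phG (v := v₂) (r := r) (by linarith) (by linarith)).const_mul ε₂
  have d3 := (hasDerivAt_phG h3 (by linarith : v₃ < r)).const_mul ε₃
  refine ((((d1.add d2).add d3).const_sub 1).div_const 2).congr_deriv ?_
  unfold phH
  field_simp
  ring

/-- The standing assumptions on the phase on `[a, b]`. -/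
structure PhaseOn (t ε₁ ε₂ ε₃ v₁ v₂ v₃ : ℝ) (φ : ℝ → ℝ) (a b : ℝ) : Prop where
  ht : 0 < t
  h3 : 0 ≤ v₃
  h32 : v₃ ≤ v₂
  h21 : v₂ ≤ v₁
  hva : v₁ < a
  ha : 1 / 5 ≤ a
  hab : a ≤ b
  hb : b ≤ 5
  hφ : ∀ r ∈ Set.Icc a b, HasDerivAt φ (t * phF ε₁ ε₂ ε₃ v₁ v₂ v₃ r) r

namespace PhaseOn

variable {t ε₁ ε₂ ε₃ v₁ v₂ v₃ : ℝ} {φ : ℝ → ℝ} {a b : ℝ}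

theorem mono (h : PhaseOn t ε₁ ε₂ ε₃ v₁ v₂ v₃ φ a b) {c d : ℝ} (hac : a ≤ c) (hcd : c ≤ d)
    (hdb : d ≤ b) : PhaseOn t ε₁ ε₂ ε₃ v₁ v₂ v₃ φ c d where
  ht := h.ht
  h3 := h.h3
  h32 := h.h32
  h21 := h.h21
  hva := h.hva.trans_le hac
  ha := h.ha.trans hac
  hab := hcd
  hb := hdb.trans h.hb
  hφ := fun r hr => h.hφ r (Set.Icc_subset_Icc hac hdb hr)

theorem lt_of_mem (h : PhaseOn t ε₁ ε₂ ε₃ v₁ v₂ v₃ φ a b) {r : ℝ} (hr : r ∈ Set.Icc a b) :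
    v₁ < r := h.hva.trans_le hr.1

theorem hasDerivAt_first (h : PhaseOn t ε₁ ε₂ ε₃ v₁ v₂ v₃ φ a b) {r : ℝ} (hr : r ∈ Set.Icc a b) :
    HasDerivAt (fun r => t * phF ε₁ ε₂ ε₃ v₁ v₂ v₃ r)
      (-2 * t / r ^ 3 * phGG ε₁ ε₂ ε₃ v₁ v₂ v₃ r) r :=
  ((hasDerivAt_phF ε₁ ε₂ ε₃ h.h3 h.h32 h.h21 (h.lt_of_mem hr)).const_mul t).congr_deriv (by ring)

theorem continuousOn_second (h : PhaseOn t ε₁ ε₂ ε₃ v₁ v₂ v₃ φ a b) :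
    ContinuousOn (fun r => -2 * t / r ^ 3 * phGG ε₁ ε₂ ε₃ v₁ v₂ v₃ r) (Set.Icc a b) := by
  refine ContinuousOn.mul (continuousOn_const.div (by fun_prop) fun r hr => ?_) fun r hr =>
    (hasDerivAt_phGG ε₁ ε₂ ε₃ h.h3 h.h32 h.h21
      (h.lt_of_mem hr)).continuousAt.continuousWithinAt
  have : 0 < r := by linarith [hr.1, h.ha]
  positivity

theorem weight_le (h : PhaseOn t ε₁ ε₂ ε₃ v₁ v₂ v₃ φ a b) {r : ℝ} (hr : r ∈ Set.Icc a b) :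
    2 * t / 125 ≤ |-2 * t / r ^ 3| := by
  have hr0 : 0 < r := by linarith [hr.1, h.ha]
  have ht := h.ht
  rw [abs_div, abs_of_pos (by positivity : 0 < r ^ 3), abs_mul, abs_neg, abs_two, abs_of_pos ht]
  have : r ^ 3 ≤ 5 ^ 3 := by gcongr; exact hr.2.trans h.hb
  gcongr
  linarith

theorem norm_osc_le_third (h : PhaseOn t ε₁ ε₂ ε₃ v₁ v₂ v₃ φ a b) {A A' : ℝ → ℂ} {N η B : ℝ}
    (hA : BVAmp A A' a b N) (hη : 0 < η)
    (hh : ∀ r ∈ Set.Icc a b, η ≤ |phH ε₁ ε₂ ε₃ v₁ v₂ v₃ r|) (hB0 : 0 < B)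
    (hB : 1 ≤ t * η / 15625 * B ^ 3) :
    ‖osc φ A a b‖ ≤ 26 * N * B := by
  have ht := h.ht
  have hN : 0 ≤ N := (norm_nonneg _).trans (hA a ⟨le_rfl, h.hab⟩).2.1
  have key := vdc_third (w0 := 2 * t / 125) (μ := η / 250) h.hab (by positivity) (by positivity)
    h.hφ (fun r hr => h.hasDerivAt_first hr) h.continuousOn_second (fun r _ => rfl)
    (fun r hr => h.weight_le hr)
    (fun r hr => hasDerivAt_phGG ε₁ ε₂ ε₃ h.h3 h.h32 h.h21 (h.lt_of_mem hr))
    (fun r hr => by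
      have hr0 : 0 < r := by linarith [hr.1, h.ha]
      have h125 : r ^ 3 ≤ 5 ^ 3 := by gcongr; exact hr.2.trans h.hb
      rw [abs_div, abs_of_pos (by positivity : 0 < 2 * r ^ 3)]
      have := hh r hr
      gcongr
      linarith) hA
  refine key.trans (mul_le_mul_of_nonneg_left ?_ (by positivity))
  have e : 2 * t / 125 * (η / 250) = t * η / 15625 := by ring
  rw [e]
  have hle : (B ^ 3)⁻¹ ≤ t * η / 15625 := by
    rw [inv_le_iff_one_le_mul₀ (by positivity)]; exact hB
  refine (Real.rpow_le_rpow_of_nonpos (by positivity) hle (by norm_num)).trans_eq ?_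
  rw [Real.inv_rpow (by positivity), ← Real.rpow_natCast, ← Real.rpow_mul hB0.le,
    show ((3 : ℕ) : ℝ) * -(1 / 3) = -1 by norm_num, Real.rpow_neg_one, inv_inv]

theorem norm_osc_le_second (h : PhaseOn t ε₁ ε₂ ε₃ v₁ v₂ v₃ φ a b) {A A' : ℝ → ℂ} {N η B : ℝ}
    (hA : BVAmp A A' a b N) (hη : 0 < η)
    (hh : ∀ r ∈ Set.Icc a b, η ≤ |phGG ε₁ ε₂ ε₃ v₁ v₂ v₃ r|) (hB0 : 0 < B)
    (hB : 1 ≤ 2 * t / 125 * η * B ^ 2) :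
    ‖osc φ A a b‖ ≤ 12 * N * B := by
  have ht := h.ht
  have hN : 0 ≤ N := (norm_nonneg _).trans (hA a ⟨le_rfl, h.hab⟩).2.1
  have key := vdc_second (μ := 2 * t / 125 * η) h.hab (by positivity)
    h.hφ (fun r hr => h.hasDerivAt_first hr) h.continuousOn_second
    (fun r hr => by
      rw [abs_mul]
      exact mul_le_mul (h.weight_le hr) (hh r hr) hη.le (abs_nonneg _)) hA
  refine key.trans (mul_le_mul_of_nonneg_left ?_ (by positivity))
  have hle : (B ^ 2)⁻¹ ≤ 2 * t / 125 * η := by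
    rw [inv_le_iff_one_le_mul₀ (by positivity)]; exact hB
  refine (Real.rpow_le_rpow_of_nonpos (by positivity) hle (by norm_num)).trans_eq ?_
  rw [Real.inv_rpow (by positivity), ← Real.rpow_natCast, ← Real.rpow_mul hB0.le,
    show ((2 : ℕ) : ℝ) * -(1 / 2) = -1 by norm_num, Real.rpow_neg_one, inv_inv]

end PhaseOn

theorem phS_anti {v w r : ℝ} (hv : 0 ≤ v) (hvw : v ≤ w) (hr : 0 < r) : phS w r ≤ phS v r := by
  refine Real.sqrt_le_sqrt ?_
  gcongr

theorem phG_mono {v w r : ℝ} (hv : 0 ≤ v) (hvw : v ≤ w) (hr : w < r) : phG v r ≤ phG w r := by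
  have := phS_pos (hv.trans hvw) hr
  have := phS_anti hv hvw (by linarith : 0 < r)
  unfold phG
  gcongr

theorem phT_mono {v w r : ℝ} (hv : 0 ≤ v) (hvw : v ≤ w) (hr : w < r) : phT v r ≤ phT w r := by
  have := phS_pos (hv.trans hvw) hr
  have := phS_anti hv hvw (by linarith : 0 < r)
  unfold phT
  gcongr

theorem phT_nonneg {v r : ℝ} (hv : 0 ≤ v) (hr : v < r) : 0 ≤ phT v r := by
  have := phS_pos hv hr
  unfold phT
  positivity

theorem phG_nonneg {v r : ℝ} (hv : 0 ≤ v) (hr : v < r) : 0 ≤ phG v r := by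
  have := phS_pos hv hr
  unfold phG
  positivity

/-- If `r - v ≤ 2 e²` and `r ≥ 1/5` then `√(1 - v²/r²) ≤ 5 e`. -/
theorem phS_le {v r e : ℝ} (hv : 0 ≤ v) (hr : v < r) (hr5 : 1 / 5 ≤ r) (he : 0 ≤ e)
    (hd : r - v ≤ 2 * e ^ 2) : phS v r ≤ 5 * e := by
  refine le_of_sq_le_sq ?_ (by positivity)
  rw [phS_sq hv hr]
  have hr0 : 0 < r := by linarith
  have e1 : 1 - v ^ 2 / r ^ 2 = (r - v) * (r + v) / r ^ 2 := by field_simp; ring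
  rw [e1, div_le_iff₀ (by positivity)]
  calc (r - v) * (r + v) ≤ (2 * e ^ 2) * (2 * r) := by
        apply mul_le_mul hd <;> nlinarith [sq_nonneg e]
    _ ≤ (5 * e) ^ 2 * r ^ 2 := by nlinarith [mul_nonneg (sq_nonneg e) hr0.le]

theorem phT_ge {v r e : ℝ} (hv : 1 / 100 ≤ v) (hr : v < r) (hr5 : 1 / 5 ≤ r) (he : 0 < e)
    (hd : r - v ≤ 2 * e ^ 2) : 1 / (12500000000 * e ^ 3) ≤ phT v r := by
  have hv0 : 0 ≤ v := by linarith
  have h1 := phS_le hv0 hr hr5 he.le hd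
  have h0 := phS_pos hv0 hr
  unfold phT
  calc 1 / (12500000000 * e ^ 3) = (1 / 100) ^ 4 / (5 * e) ^ 3 := by
        field_simp; norm_num
    _ ≤ v ^ 4 / phS v r ^ 3 := by gcongr

/-- The assumptions for the estimate on a dyadic piece at distance `s²` from the largest turning
point, where `e²` is the distance to the smallest one. -/
structure DyadicPiece (t ε₁ ε₂ ε₃ v₁ v₂ v₃ : ℝ) (φ : ℝ → ℝ) (A A' : ℝ → ℂ) (N s e y a b : ℝ) :
    Prop extends PhaseOn t ε₁ ε₂ ε₃ v₁ v₂ v₃ φ a b where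
  hA : BVAmp A A' a b N
  hs : 0 < s
  hs5 : s ^ 2 ≤ 5
  he : 0 < e
  hes : e ^ 2 = s ^ 2 + v₁ - v₃
  hy : 0 < y
  hy1 : y ≤ 1
  has : v₁ + s ^ 2 ≤ a
  hbs : b ≤ v₁ + 2 * s ^ 2
  hty : t * (s ^ 2 * y ^ 4) ^ 3 = e ^ 3

theorem norm_osc_le_add {φ φ' : ℝ → ℝ} {A A' : ℝ → ℂ} {a b c N B₁ B₂ : ℝ}
    (hφ : ∀ x ∈ Set.Icc a b, HasDerivAt φ (φ' x) x) (hA : BVAmp A A' a b N)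
    (hc : c ∈ Set.Icc a b) (hB₁ : 0 ≤ B₁) (hB₂ : 0 ≤ B₂) (h₁ : a < c → ‖osc φ A a c‖ ≤ B₁)
    (h₂ : c < b → ‖osc φ A c b‖ ≤ B₂) : ‖osc φ A a b‖ ≤ B₁ + B₂ := by
  rw [osc_split hφ hA hc]
  refine (norm_add_le _ _).trans (add_le_add ?_ ?_)
  · rcases hc.1.eq_or_lt with h | h
    · simpa [osc, h] using hB₁
    · exact h₁ h
  · rcases hc.2.eq_or_lt with h | h
    · simpa [osc, h] using hB₂
    · exact h₂ h

namespace DyadicPiece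

variable {t ε₁ ε₂ ε₃ v₁ v₂ v₃ : ℝ} {φ : ℝ → ℝ} {A A' : ℝ → ℂ} {N s e y a b : ℝ}

theorem sub (h : DyadicPiece t ε₁ ε₂ ε₃ v₁ v₂ v₃ φ A A' N s e y a b) {c d : ℝ} (hac : a ≤ c)
    (hcd : c ≤ d) (hdb : d ≤ b) : DyadicPiece t ε₁ ε₂ ε₃ v₁ v₂ v₃ φ A A' N s e y c d where
  toPhaseOn := h.toPhaseOn.mono hac hcd hdb
  hA := h.hA.mono hac hdb
  hs := h.hs
  hs5 := h.hs5
  he := h.he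
  hes := h.hes
  hy := h.hy
  hy1 := h.hy1
  has := h.has.trans hac
  hbs := hdb.trans h.hbs
  hty := h.hty

theorem N_nonneg (h : DyadicPiece t ε₁ ε₂ ε₃ v₁ v₂ v₃ φ A A' N s e y a b) : 0 ≤ N :=
  (norm_nonneg _).trans (h.hA a ⟨le_rfl, h.hab⟩).2.1

theorem norm_osc_le_of_third (h : DyadicPiece t ε₁ ε₂ ε₃ v₁ v₂ v₃ φ A A' N s e y a b)
    (hh : ∀ r ∈ Set.Icc a b, 1 / (100000000000 * e ^ 3) ≤ |phH ε₁ ε₂ ε₃ v₁ v₂ v₃ r|) :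
    ‖osc φ A a b‖ ≤ 5200000 * (N * s ^ 2 * y ^ 3) := by
  have hs := h.hs
  have he := h.he
  have hy := h.hy
  have hN := h.N_nonneg
  refine (h.toPhaseOn.norm_osc_le_third (B := 200000 * (s ^ 2 * y ^ 4)) h.hA (by positivity) hh
    (by positivity) ?_).trans ?_
  · calc (1 : ℝ) ≤ e ^ 3 * (1 / (100000000000 * e ^ 3)) / 15625 * 200000 ^ 3 := by
          field_simp; norm_num
      _ = _ := by rw [← h.hty]; ring
  · calc 26 * N * (200000 * (s ^ 2 * y ^ 4)) = 5200000 * (N * s ^ 2 * y ^ 3) * y := by ring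
      _ ≤ _ := mul_le_of_le_one_right (by positivity) h.hy1

theorem phS_one_le (h : DyadicPiece t ε₁ ε₂ ε₃ v₁ v₂ v₃ φ A A' N s e y a b) {r : ℝ}
    (hr : r ∈ Set.Icc a b) : phS v₁ r ≤ 5 * s :=
  phS_le (by linarith [h.h3, h.h32, h.h21]) (h.toPhaseOn.lt_of_mem hr) (h.ha.trans hr.1) h.hs.le
    (by linarith [h.hbs, hr.2])

theorem phS_one_ge (h : DyadicPiece t ε₁ ε₂ ε₃ v₁ v₂ v₃ φ A A' N s e y a b) {r : ℝ}
    (hr : r ∈ Set.Icc a b) : s / 3 ≤ phS v₁ r := by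
  have hv0 : 0 ≤ v₁ := by linarith [h.h3, h.h32, h.h21]
  have hr1 := h.toPhaseOn.lt_of_mem hr
  have hr0 : 0 < r := by linarith
  have hs := h.hs
  refine le_of_sq_le_sq ?_ (phS_pos hv0 hr1).le
  rw [phS_sq hv0 hr1]
  have e1 : 1 - v₁ ^ 2 / r ^ 2 = (r - v₁) * (r + v₁) / r ^ 2 := by field_simp; ring
  rw [e1, le_div_iff₀ (by positivity)]
  have h5 : r ≤ 5 := hr.2.trans h.hb
  have h6 : s ^ 2 ≤ r - v₁ := by linarith [h.has, hr.1]
  calc (s / 3) ^ 2 * r ^ 2 = s ^ 2 * (r * (r / 9)) := by ring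
    _ ≤ s ^ 2 * (r * 1) := by gcongr; linarith
    _ ≤ (r - v₁) * (r + v₁) := by
        apply mul_le_mul h6 _ (by positivity) (by linarith)
        linarith

theorem phS_three_le (h : DyadicPiece t ε₁ ε₂ ε₃ v₁ v₂ v₃ φ A A' N s e y a b) {r : ℝ}
    (hr : r ∈ Set.Icc a b) : phS v₃ r ≤ 5 * e :=
  phS_le h.h3 (by linarith [h.toPhaseOn.lt_of_mem hr, h.h32, h.h21]) (h.ha.trans hr.1) h.he.le
    (by linarith [h.hbs, hr.2, h.hes, h.h32, h.h21])

theorem phT_three_ge (h : DyadicPiece t ε₁ ε₂ ε₃ v₁ v₂ v₃ φ A A' N s e y a b)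
    (h100 : 1 / 100 ≤ v₃) {r : ℝ} (hr : r ∈ Set.Icc a b) :
    1 / (12500000000 * e ^ 3) ≤ phT v₃ r :=
  phT_ge h100 (by linarith [h.toPhaseOn.lt_of_mem hr, h.h32, h.h21]) (h.ha.trans hr.1) h.he
    (by linarith [h.hbs, hr.2, h.hes, h.h32, h.h21])

/-- The exceptional signs, away from cancellation in the derivative of `W`. -/
theorem norm_osc_le_of_ratio_le {σ : ℝ} (hσ : σ = 1 ∨ σ = -1)
    (h : DyadicPiece t σ (-σ) (-σ) v₁ v₂ v₃ φ A A' N s e y a b) (h100 : 1 / 100 ≤ v₃)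
    (hz : ∀ r ∈ Set.Icc a b, v₁ ^ 2 * phS v₃ r ^ 2 ≤ 4 * (v₁ ^ 2 - v₃ ^ 2)) :
    ‖osc φ A a b‖ ≤ (6500 + 2 * 10 ^ 17) * (N * s ^ 2 * y ^ 3) := by
  have hs := h.hs
  have he := h.he
  have hy := h.hy
  have hN := h.N_nonneg
  have hv2 : 0 < v₂ := by linarith [h.h32]
  have hv1 : 0 < v₁ := by linarith [h.h21]
  have hσ1 : |σ| = 1 := by rcases hσ with rfl | rfl <;> norm_num
  set W : ℝ → ℝ := fun r => σ * (v₁ ^ 4 - v₂ ^ 4 * (phS v₁ r / phS v₂ r) ^ 3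
    - v₃ ^ 4 * (phS v₁ r / phS v₃ r) ^ 3) with hW
  set W' : ℝ → ℝ := fun r => -σ * (3 * v₂ ^ 4 * phS v₁ r * (v₁ ^ 2 - v₂ ^ 2) / (phS v₂ r ^ 5 * r ^ 3)
    + 3 * v₃ ^ 4 * phS v₁ r * (v₁ ^ 2 - v₃ ^ 2) / (phS v₃ r ^ 5 * r ^ 3)) with hW'
  have hratio : ∀ v, 0 ≤ v → v ≤ v₁ → ∀ r ∈ Set.Icc a b, HasDerivAt
      (fun r => (phS v₁ r / phS v r) ^ 3)
      (3 * phS v₁ r * (v₁ ^ 2 - v ^ 2) / (phS v r ^ 5 * r ^ 3)) r := by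
    intro v hv0 hv r hr
    have hr1 := h.toPhaseOn.lt_of_mem hr
    have hr0 : 0 < r := by linarith
    have hp1 := phS_pos hv1.le hr1
    have hp := phS_pos hv0 (hv.trans_lt hr1)
    have q1 := phS_sq hv1.le hr1
    have q := phS_sq hv0 (hv.trans_lt hr1)
    refine (((hasDerivAt_phS hv1.le hr1).div (hasDerivAt_phS hv0 (hv.trans_lt hr1)) hp.ne').pow
      3).congr_deriv ?_
    have key : v₁ ^ 2 * phS v r ^ 2 - v ^ 2 * phS v₁ r ^ 2 = v₁ ^ 2 - v ^ 2 := by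
      rw [q1, q]; field_simp; ring
    rw [← key]
    simp only [Pi.div_apply]
    norm_num
    field_simp
  have hWd : ∀ r ∈ Set.Icc a b, HasDerivAt W (W' r) r := by
    intro r hr
    refine ((((hratio v₂ hv2.le h.h21 r hr).const_mul (v₂ ^ 4)).const_sub (v₁ ^ 4)).sub
      ((hratio v₃ h.h3 (h.h32.trans h.h21) r hr).const_mul (v₃ ^ 4))).const_mul σ |>.congr_deriv ?_
    simp only [hW']
    ring
  have hl : ∀ r ∈ Set.Icc a b, s / (10 ^ 17 * e ^ 3) ≤ |W' r| := by
    intro r hr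
    have hr1 := h.toPhaseOn.lt_of_mem hr
    have hr0 : 0 < r := by linarith
    have hr5 : r ≤ 5 := hr.2.trans h.hb
    have hp1 := phS_pos hv1.le hr1
    have hp2 := phS_pos hv2.le (h.h21.trans_lt hr1)
    have hp3 := phS_pos h.h3 ((h.h32.trans h.h21).trans_lt hr1)
    have s1 : 0 ≤ v₁ ^ 2 - v₂ ^ 2 := by nlinarith [h.h21]
    have hz' := hz r hr
    have b1 := h.phS_one_ge hr
    have b3 := h.phS_three_le hr
    simp only [hW', abs_mul, abs_neg, hσ1, one_mul]
    have n2 : 0 ≤ 3 * v₂ ^ 4 * phS v₁ r * (v₁ ^ 2 - v₂ ^ 2) / (phS v₂ r ^ 5 * r ^ 3) := by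
      positivity
    have l3 : s / (10 ^ 17 * e ^ 3) ≤
        3 * v₃ ^ 4 * phS v₁ r * (v₁ ^ 2 - v₃ ^ 2) / (phS v₃ r ^ 5 * r ^ 3) := by
      calc s / (10 ^ 17 * e ^ 3)
          ≤ 3 * (1 / 100) ^ 4 * (s / 3) * ((1 / 100) ^ 2 / 4) / ((5 * e) ^ 3 * 5 ^ 3) := by
            rw [div_le_div_iff₀ (by positivity) (by positivity)]
            have : 0 < s * e ^ 3 := by positivity
            nlinarith only [this]
        _ ≤ 3 * v₃ ^ 4 * phS v₁ r * (v₁ ^ 2 / 4) / (phS v₃ r ^ 3 * r ^ 3) := by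
            gcongr
            linarith [h.h32, h.h21]
        _ = 3 * v₃ ^ 4 * phS v₁ r * (v₁ ^ 2 * phS v₃ r ^ 2 / 4) / (phS v₃ r ^ 5 * r ^ 3) := by
            field_simp
        _ ≤ _ := by
            gcongr
            linarith
    have n3 : 0 ≤ s / (10 ^ 17 * e ^ 3) := by positivity
    rw [abs_of_nonneg (add_nonneg n2 (n3.trans l3))]
    exact l3.trans (le_add_of_nonneg_left n2)
  have key := norm_osc_le_of_split (μ := s / (10 ^ 17 * e ^ 3)) (m := s ^ 3 * y ^ 3 / e ^ 3)
    (B := 26 * N * (125 * (s ^ 2 * y ^ 3))) h.hab (by positivity) (by positivity)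
    (by positivity) h.hφ hWd hl h.hA (by
      intro c d hac hcd hdb hm
      refine (h.toPhaseOn.mono hac hcd hdb).norm_osc_le_third (η := y ^ 3 / (125 * e ^ 3))
        (h.hA.mono hac hdb) (by positivity) ?_ (by positivity) ?_
      · intro r hr
        have hr' : r ∈ Set.Icc a b := Set.Icc_subset_Icc hac hdb hr
        have hr1 := h.toPhaseOn.lt_of_mem hr'
        have hp1 := phS_pos hv1.le hr1
        have hp2 := phS_pos hv2.le (h.h21.trans_lt hr1)
        have hp3 := phS_pos h.h3 ((h.h32.trans h.h21).trans_lt hr1)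
        have e1 : phH σ (-σ) (-σ) v₁ v₂ v₃ r = W r / phS v₁ r ^ 3 := by
          simp only [phH, phT, hW]
          field_simp
          ring
        rw [e1, abs_div, abs_of_pos (by positivity : 0 < phS v₁ r ^ 3)]
        have b1 := h.phS_one_le hr'
        calc y ^ 3 / (125 * e ^ 3) = s ^ 3 * y ^ 3 / e ^ 3 / (5 * s) ^ 3 := by
              field_simp; norm_num
          _ ≤ |W r| / phS v₁ r ^ 3 := by
              gcongr
              exact hm r hr
      · have : t * (y ^ 3 / (125 * e ^ 3)) / 15625 * (125 * (s ^ 2 * y ^ 3)) ^ 3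
            = t * (s ^ 2 * y ^ 4) ^ 3 / e ^ 3 := by
          field_simp; norm_num
        rw [this, h.hty, div_self (by positivity)])
  refine key.trans_eq ?_
  field_simp
  ring

theorem norm_osc_le_of_exceptional {σ : ℝ} (hσ : σ = 1 ∨ σ = -1)
    (h : DyadicPiece t σ (-σ) (-σ) v₁ v₂ v₃ φ A A' N s e y a b) (h100 : 1 / 100 ≤ v₃) :
    ‖osc φ A a b‖ ≤ 10 ^ 18 * (N * s ^ 2 * y ^ 3) := by
  have hs := h.hs
  have he := h.he
  have hy := h.hy
  have hN := h.N_nonneg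
  have hv2 : 0 < v₂ := by linarith [h.h32]
  have hv1 : 0 < v₁ := by linarith [h.h21]
  have hv3 : 0 < v₃ := by linarith
  have h31 : v₃ ≤ v₁ := h.h32.trans h.h21
  have hσ1 : |σ| = 1 := by rcases hσ with rfl | rfl <;> norm_num
  have h31' : 0 ≤ v₁ ^ 2 - v₃ ^ 2 := by nlinarith
  have hpos : ∀ r ∈ Set.Icc a b, 0 < r ^ 2 - v₃ ^ 2 := fun r hr => by
    nlinarith [h.toPhaseOn.lt_of_mem hr]
  obtain ⟨c, hc, h1, h2⟩ := exists_split_of_monotoneOn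
    (g := fun r => 1 - (v₁ ^ 2 - v₃ ^ 2) / (r ^ 2 - v₃ ^ 2)) h.hab
    (by
      refine continuousOn_const.sub (continuousOn_const.div (by fun_prop) fun r hr => ?_)
      exact (hpos r hr).ne')
    (by
      intro x hx z hz hxz
      have := hpos x hx
      have h0 : 0 ≤ x := by linarith [h.ha, hx.1]
      simp only
      gcongr) (3 / 4 * v₁ ^ 2 / v₃ ^ 2)
  have hg : ∀ r ∈ Set.Icc a b, phS v₁ r ^ 2 =
      (1 - (v₁ ^ 2 - v₃ ^ 2) / (r ^ 2 - v₃ ^ 2)) * phS v₃ r ^ 2 := by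
    intro r hr
    have hr1 := h.toPhaseOn.lt_of_mem hr
    have hr0 : 0 < r := by linarith
    have := hpos r hr
    rw [phS_sq hv1.le hr1, phS_sq hv3.le (h31.trans_lt hr1)]
    field_simp
    ring
  refine (norm_osc_le_add h.hφ h.hA hc (B₁ := (6500 + 2 * 10 ^ 17) * (N * s ^ 2 * y ^ 3))
    (B₂ := 5200000 * (N * s ^ 2 * y ^ 3)) (by positivity) (by positivity) (fun hac => ?_)
    (fun hcb => ?_)).trans ?_
  · refine (h.sub le_rfl hac.le hc.2).norm_osc_le_of_ratio_le hσ h100 fun r hr => ?_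
    have hr' : r ∈ Set.Icc a b := ⟨hr.1, hr.2.trans hc.2⟩
    have hr1 := h.toPhaseOn.lt_of_mem hr'
    have hr0 : 0 < r := by linarith
    have hz := h1 hac r hr
    have hgr := hg r hr'
    rw [le_div_iff₀ (by positivity)] at hz
    have e1 : v₁ ^ 2 * phS v₃ r ^ 2 - v₃ ^ 2 * phS v₁ r ^ 2 = v₁ ^ 2 - v₃ ^ 2 := by
      rw [phS_sq hv1.le hr1, phS_sq hv3.le (h31.trans_lt hr1)]; field_simp; ring
    have : v₃ ^ 2 * phS v₁ r ^ 2 ≤ 3 / 4 * v₁ ^ 2 * phS v₃ r ^ 2 := by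
      rw [hgr]
      calc _ = (1 - (v₁ ^ 2 - v₃ ^ 2) / (r ^ 2 - v₃ ^ 2)) * v₃ ^ 2 * phS v₃ r ^ 2 := by ring
        _ ≤ _ := by gcongr
    linarith
  · refine (h.sub hc.1 hcb.le le_rfl).norm_osc_le_of_third fun r hr => ?_
    have hr' : r ∈ Set.Icc a b := ⟨hc.1.trans hr.1, hr.2⟩
    have hr1 := h.toPhaseOn.lt_of_mem hr'
    have hr0 : 0 < r := by linarith
    have hz := h2 hcb r hr
    have hgr := hg r hr'
    rw [div_le_iff₀ (by positivity)] at hz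
    have hp1 := phS_pos hv1.le hr1
    have hp3 := phS_pos h.h3 (h31.trans_lt hr1)
    have hp13 : phS v₁ r ≤ phS v₃ r := phS_anti h.h3 h31 hr0
    have hH : 3 * (v₁ ^ 2 * phS v₃ r ^ 2) ≤ 4 * (v₃ ^ 2 * phS v₁ r ^ 2) := by
      rw [hgr]
      calc _ = 4 * (3 / 4 * v₁ ^ 2) * phS v₃ r ^ 2 := by ring
        _ ≤ 4 * ((1 - (v₁ ^ 2 - v₃ ^ 2) / (r ^ 2 - v₃ ^ 2)) * v₃ ^ 2) * phS v₃ r ^ 2 := by gcongr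
        _ = _ := by ring
    have hT : phT v₁ r ≤ 16 / 9 * phT v₃ r := by
      have h4 : 9 * (v₁ ^ 4 * phS v₃ r ^ 4) ≤ 16 * (v₃ ^ 4 * phS v₁ r ^ 4) := by
        calc _ = (3 * (v₁ ^ 2 * phS v₃ r ^ 2)) ^ 2 := by ring
          _ ≤ (4 * (v₃ ^ 2 * phS v₁ r ^ 2)) ^ 2 := by gcongr
          _ = _ := by ring
      have h5 : 9 * (v₁ ^ 4 * phS v₃ r ^ 3) ≤ 16 * (v₃ ^ 4 * phS v₁ r ^ 3) := by
        refine le_of_mul_le_mul_right ?_ hp3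
        calc _ = 9 * (v₁ ^ 4 * phS v₃ r ^ 4) := by ring
          _ ≤ _ := h4
          _ = 16 * (v₃ ^ 4 * phS v₁ r ^ 3) * phS v₁ r := by ring
          _ ≤ _ := by gcongr
      unfold phT
      rw [← mul_div_assoc, div_le_div_iff₀ (by positivity) (by positivity)]
      linarith
    have hT2 : phT v₃ r ≤ phT v₂ r := phT_mono h.h3 h.h32 (h.h21.trans_lt hr1)
    have hT3 := h.phT_three_ge h100 hr'
    have e1 : phH σ (-σ) (-σ) v₁ v₂ v₃ r = -σ * (phT v₂ r + phT v₃ r - phT v₁ r) := by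
      unfold phH; ring
    have hT30 : 0 ≤ phT v₃ r := phT_nonneg h.h3 (h31.trans_lt hr1)
    rw [e1, abs_mul, abs_neg, hσ1, one_mul, abs_of_nonneg (by linarith)]
    have : 1 / (100000000000 * e ^ 3) = 1 / 8 * (1 / (12500000000 * e ^ 3)) := by
      field_simp; norm_num
    rw [this]
    linarith
  · have : 0 ≤ N * s ^ 2 * y ^ 3 := by positivity
    linarith

theorem norm_osc_le_of_large (h : DyadicPiece t ε₁ ε₂ ε₃ v₁ v₂ v₃ φ A A' N s e y a b)
    (h₁ : ε₁ = 1 ∨ ε₁ = -1) (h₂ : ε₂ = 1 ∨ ε₂ = -1) (h₃ : ε₃ = 1 ∨ ε₃ = -1)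
    (h100 : 1 / 100 ≤ v₃) :
    ‖osc φ A a b‖ ≤ 10 ^ 18 * (N * s ^ 2 * y ^ 3) := by
  have hs := h.hs
  have hy := h.hy
  have hN := h.N_nonneg
  by_cases hex : ε₂ = -ε₁ ∧ ε₃ = -ε₁
  · obtain ⟨rfl, rfl⟩ := hex
    exact h.norm_osc_le_of_exceptional h₁ h100
  · refine (h.norm_osc_le_of_third fun r hr => ?_).trans ?_
    · have hr1 := h.toPhaseOn.lt_of_mem hr
      have t21 : phT v₂ r ≤ phT v₁ r := phT_mono (h.h3.trans h.h32) h.h21 hr1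
      have t32 : phT v₃ r ≤ phT v₂ r := phT_mono h.h3 h.h32 (h.h21.trans_lt hr1)
      have t3 := h.phT_three_ge h100 hr
      have he := h.he
      have t0 : 1 / (100000000000 * e ^ 3) = 1 / 8 * (1 / (12500000000 * e ^ 3)) := by
        field_simp; norm_num
      have t00 : 0 ≤ 1 / (12500000000 * e ^ 3) := by positivity
      rw [t0, le_abs]
      unfold phH
      rcases h₁ with rfl | rfl <;> rcases h₂ with rfl | rfl <;> rcases h₃ with rfl | rfl
      all_goals first
        | (left; linarith)
        | (right; linarith)
        | (exfalso; norm_num at hex)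
    · have : 0 ≤ N * s ^ 2 * y ^ 3 := by positivity
      linarith

theorem norm_osc_le_of_small (h : DyadicPiece t ε₁ ε₂ ε₃ v₁ v₂ v₃ φ A A' N s e y a b)
    (h₁ : ε₁ = 1 ∨ ε₁ = -1) (h₂ : ε₂ = 1 ∨ ε₂ = -1) (h₃ : ε₃ = 1 ∨ ε₃ = -1)
    (h100 : v₃ ≤ 1 / 100) :
    ‖osc φ A a b‖ ≤ 10 ^ 18 * (N * s ^ 2 * y ^ 3) := by
  have hs := h.hs
  have he := h.he
  have hy := h.hy
  have hy1 := h.hy1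
  have ht := h.ht
  have hN := h.N_nonneg
  have hv2 : 0 ≤ v₂ := h.h3.trans h.h32
  have hv1 : 0 ≤ v₁ := hv2.trans h.h21
  have he3 : 27 / 1000 ≤ e ^ 3 := by
    have h9 : (3 / 10) ^ 2 ≤ e ^ 2 := by
      rw [h.hes]; nlinarith [h.hbs, h.ha, h.hab]
    have : 3 / 10 ≤ e := le_of_sq_le_sq h9 he.le
    calc (27 / 1000 : ℝ) = (3 / 10) ^ 3 := by norm_num
      _ ≤ e ^ 3 := by gcongr
  have hp3 : ∀ r ∈ Set.Icc a b, 99 / 100 ≤ phS v₃ r := by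
    intro r hr
    have hr1 := h.toPhaseOn.lt_of_mem hr
    have hr3 : v₃ < r := by linarith [h.h32, h.h21]
    refine le_of_sq_le_sq ?_ (phS_pos h.h3 hr3).le
    rw [phS_sq h.h3 hr3]
    have hr5 : 1 / 5 ≤ r := h.ha.trans hr.1
    have : v₃ ^ 2 / r ^ 2 ≤ (1 / 100) ^ 2 / (1 / 5) ^ 2 := by
      have := h.h3
      gcongr
    norm_num at this ⊢
    linarith
  have hG3 : ∀ r ∈ Set.Icc a b, phG v₃ r ≤ 1 / 1000 := by
    intro r hr
    have := hp3 r hr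
    have := h.h3
    unfold phG
    calc v₃ ^ 2 / phS v₃ r ≤ (1 / 100) ^ 2 / (99 / 100) := by gcongr
      _ ≤ _ := by norm_num
  have hT3 : ∀ r ∈ Set.Icc a b, phT v₃ r ≤ 1 / 1000 := by
    intro r hr
    have := hp3 r hr
    have := h.h3
    unfold phT
    calc v₃ ^ 4 / phS v₃ r ^ 3 ≤ (1 / 100) ^ 4 / (99 / 100) ^ 3 := by gcongr
      _ ≤ _ := by norm_num
  set κ := ε₁ * ε₂ with hκ
  have hκ1 : κ = 1 ∨ κ = -1 := by
    rw [hκ]; rcases h₁ with rfl | rfl <;> rcases h₂ with rfl | rfl <;> norm_num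
  have hd : ∀ r ∈ Set.Icc a b, HasDerivAt (fun r => -(phG v₁ r + κ * phG v₂ r))
      ((phT v₁ r + κ * phT v₂ r) / r ^ 3) r := by
    intro r hr
    have hr1 := h.toPhaseOn.lt_of_mem hr
    refine (((hasDerivAt_phG hv1 hr1).add
      ((hasDerivAt_phG hv2 (h.h21.trans_lt hr1)).const_mul κ)).neg).congr_deriv ?_
    ring
  have hcont : ContinuousOn (fun r => -(phG v₁ r + κ * phG v₂ r)) (Set.Icc a b) :=
    fun r hr => (hd r hr).continuousAt.continuousWithinAt
  obtain ⟨c, hc, hlo, hhi⟩ := exists_split_of_monotoneOn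
    (g := fun r => -(phG v₁ r + κ * phG v₂ r)) h.hab hcont
    (by
      refine monotoneOn_of_hasDerivWithinAt_nonneg (convex_Icc a b) hcont
        (f' := fun r => (phT v₁ r + κ * phT v₂ r) / r ^ 3)
        (fun r hr => (hd r (interior_subset hr)).hasDerivWithinAt) fun r hr => ?_
      have hr' : r ∈ Set.Icc a b := interior_subset hr
      have hr1 := h.toPhaseOn.lt_of_mem hr'
      have hr0 : 0 < r := by linarith
      have t21 : phT v₂ r ≤ phT v₁ r := phT_mono hv2 h.h21 hr1
      have t2 : 0 ≤ phT v₂ r := phT_nonneg hv2 (h.h21.trans_lt hr1)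
      refine div_nonneg ?_ (by positivity)
      rcases hκ1 with h | h <;> rw [h] <;> linarith) (-(1 / 8))
  refine (norm_osc_le_add h.hφ h.hA hc (B₁ := 26000 * (N * s ^ 2 * y ^ 3))
    (B₂ := 12000 * (N * s ^ 2 * y ^ 3)) (by positivity) (by positivity) (fun hac => ?_)
    (fun hcb => ?_)).trans ?_
  · refine ((h.toPhaseOn.mono le_rfl hac.le hc.2).norm_osc_le_third (η := 1 / 512)
      (B := 1000 * (s ^ 2 * y ^ 4)) (h.hA.mono le_rfl hc.2) (by norm_num) (fun r hr => ?_)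
      (by positivity) ?_).trans ?_
    · have hr' : r ∈ Set.Icc a b := ⟨hr.1, hr.2.trans hc.2⟩
      have hr1 := h.toPhaseOn.lt_of_mem hr'
      have hr0 : 0 < r := by linarith
      have hr2 := h.h21.trans_lt hr1
      have hz := hlo hac r hr
      have hp1 := phS_pos hv1 hr1
      have hp2 := phS_pos hv2 hr2
      have hp12 : phS v₁ r ≤ phS v₂ r := phS_anti hv2 h.h21 hr0
      have g21 : phG v₂ r ≤ phG v₁ r := phG_mono hv2 h.h21 hr1
      have g2 : 0 ≤ phG v₂ r := phG_nonneg hv2 hr2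
      have eT : ∀ v, phT v r = phG v r ^ 2 / phS v r := by
        intro v
        unfold phT phG
        rw [div_pow, div_div, ← pow_mul, ← pow_succ]
      have inv1 : 1 ≤ (phS v₁ r)⁻¹ := (one_le_inv₀ hp1).2 (phS_le_one _ _)
      have inv12 : (phS v₂ r)⁻¹ ≤ (phS v₁ r)⁻¹ := by gcongr
      have inv2 : 0 < (phS v₂ r)⁻¹ := by positivity
      have main : 1 / 256 ≤ phT v₁ r + κ * phT v₂ r := by
        rw [eT, eT, div_eq_mul_inv (phG v₁ r ^ 2), div_eq_mul_inv (phG v₂ r ^ 2)]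
        rcases hκ1 with hk | hk <;> rw [hk] at hz ⊢
        · have : 1 / 16 ≤ phG v₁ r := by linarith
          have : (1 / 16) ^ 2 * 1 ≤ phG v₁ r ^ 2 * (phS v₁ r)⁻¹ := by gcongr
          have : 0 ≤ phG v₂ r ^ 2 * (phS v₂ r)⁻¹ := by positivity
          linarith
        · have q1 : 1 / 8 ≤ phG v₁ r - phG v₂ r := by linarith
          have q2 : phG v₂ r ^ 2 * (phS v₂ r)⁻¹ ≤ phG v₂ r ^ 2 * (phS v₁ r)⁻¹ := by gcongr
          have q3 : (1 / 8) * (1 / 8) ≤ (phG v₁ r - phG v₂ r) * (phG v₁ r + phG v₂ r) := by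
            apply mul_le_mul <;> linarith
          have q4 : (1 / 8) * (1 / 8) * 1 ≤
              (phG v₁ r - phG v₂ r) * (phG v₁ r + phG v₂ r) * (phS v₁ r)⁻¹ := by
            apply mul_le_mul q3 inv1 <;> linarith
          nlinarith
      have e1 : phH ε₁ ε₂ ε₃ v₁ v₂ v₃ r
          = ε₁ * (phT v₁ r + κ * phT v₂ r) + ε₃ * phT v₃ r := by
        unfold phH
        rw [hκ]
        rcases h₁ with rfl | rfl <;> ring
      have t3 := hT3 r hr'
      have t30 : 0 ≤ phT v₃ r := phT_nonneg h.h3 (h.h32.trans_lt hr2)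
      rw [e1, le_abs]
      rcases h₁ with h1 | h1 <;> rcases h₃ with h3 | h3 <;> rw [h1, h3]
      · left; linarith
      · left; linarith
      · right; linarith
      · right; linarith
    · calc (1 : ℝ) ≤ 27 / 1000 * (1 / 512) / 15625 * 1000 ^ 3 := by norm_num
        _ ≤ e ^ 3 * (1 / 512) / 15625 * 1000 ^ 3 := by gcongr
        _ = _ := by rw [← h.hty]; ring
    · calc 26 * N * (1000 * (s ^ 2 * y ^ 4)) = 26000 * (N * s ^ 2 * y ^ 3) * y := by ring
        _ ≤ _ := mul_le_of_le_one_right (by positivity) hy1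
  · refine ((h.toPhaseOn.mono hc.1 hcb.le le_rfl).norm_osc_le_second (η := 1 / 4)
      (B := 1000 * (s ^ 2 * y ^ 3)) (h.hA.mono hc.1 le_rfl) (by norm_num) (fun r hr => ?_)
      (by positivity) ?_).trans_eq (by ring)
    · have hr' : r ∈ Set.Icc a b := ⟨hc.1.trans hr.1, hr.2⟩
      have hr1 := h.toPhaseOn.lt_of_mem hr'
      have hr2 := h.h21.trans_lt hr1
      have hz := hhi hcb r hr
      have g21 : phG v₂ r ≤ phG v₁ r := phG_mono hv2 h.h21 hr1
      have g2 : 0 ≤ phG v₂ r := phG_nonneg hv2 hr2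
      have g3 := hG3 r hr'
      have g30 : 0 ≤ phG v₃ r := phG_nonneg h.h3 (h.h32.trans_lt hr2)
      have hD : 0 ≤ phG v₁ r + κ * phG v₂ r := by
        rcases hκ1 with hk | hk <;> rw [hk] <;> linarith
      have e1 : phGG ε₁ ε₂ ε₃ v₁ v₂ v₃ r
          = (1 - (ε₁ * (phG v₁ r + κ * phG v₂ r) + ε₃ * phG v₃ r)) / 2 := by
        unfold phGG
        rw [hκ]
        rcases h₁ with rfl | rfl <;> ring
      rw [e1, le_abs]
      left
      rcases h₁ with h1 | h1 <;> rcases h₃ with h3 | h3 <;> rw [h1, h3] <;> linarith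
    · have hb : 27 / 1000 ≤ t * (s ^ 4 * y ^ 6) * 5 := by
        calc 27 / 1000 ≤ e ^ 3 := he3
          _ = t * (s ^ 4 * y ^ 6) * (s ^ 2 * y ^ 6) := by rw [← h.hty]; ring
          _ ≤ t * (s ^ 4 * y ^ 6) * (5 * 1) := by
              gcongr
              · exact h.hs5
              · exact pow_le_one₀ hy.le hy1
          _ = _ := by ring
      calc (1 : ℝ) ≤ t * (s ^ 4 * y ^ 6) * 4000 := by linarith
        _ = _ := by ring
  · have : 0 ≤ N * s ^ 2 * y ^ 3 := by positivity
    linarith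

theorem norm_osc_le (h : DyadicPiece t ε₁ ε₂ ε₃ v₁ v₂ v₃ φ A A' N s e y a b)
    (h₁ : ε₁ = 1 ∨ ε₁ = -1) (h₂ : ε₂ = 1 ∨ ε₂ = -1) (h₃ : ε₃ = 1 ∨ ε₃ = -1) :
    ‖osc φ A a b‖ ≤ 10 ^ 18 * (N * s ^ 2 * y ^ 3) := by
  rcases le_total (1 / 100) v₃ with h100 | h100
  · exact h.norm_osc_le_of_large h₁ h₂ h₃ h100
  · exact h.norm_osc_le_of_small h₁ h₂ h₃ h100

end DyadicPiece

/-! ### The integral of the product of three Bessel functions -/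

theorem BVAmp.mul {A A' B B' : ℝ → ℂ} {a b N M : ℝ} (hab : a ≤ b) (hA : BVAmp A A' a b N)
    (hB : BVAmp B B' a b M) :
    BVAmp (fun x => A x * B x) (fun x => A' x * B x + A x * B' x) a b (2 * (N * M)) := by
  intro x hx
  obtain ⟨a1, a2, a3⟩ := hA x hx
  obtain ⟨b1, b2, b3⟩ := hB x hx
  have hN : 0 ≤ N := (norm_nonneg _).trans a2
  have hM : 0 ≤ M := (norm_nonneg _).trans b2
  have hba : 0 ≤ b - a := sub_nonneg.2 hab
  refine ⟨a1.mul b1, ?_, ?_⟩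
  · rw [norm_mul]
    nlinarith [mul_le_mul a2 b2 (norm_nonneg _) hN, mul_nonneg hN hM]
  · calc ‖A' x * B x + A x * B' x‖ * (b - a)
        ≤ (‖A' x‖ * ‖B x‖ + ‖A x‖ * ‖B' x‖) * (b - a) := by
          gcongr
          refine (norm_add_le _ _).trans_eq ?_
          rw [norm_mul, norm_mul]
      _ = (‖A' x‖ * (b - a)) * ‖B x‖ + ‖A x‖ * (‖B' x‖ * (b - a)) := by ring
      _ ≤ N * M + N * M := by gcongr
      _ = _ := by ring

theorem sgn_eq (b : Bool) : sgn b = 1 ∨ sgn b = -1 := by cases b <;> simp [sgn]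

/-- The integrand of the triple Bessel integral. -/
def tri (w : ℝ → ℂ) (k₁ k₂ k₃ : ℤ) (t r : ℝ) : ℂ :=
  Complex.exp (Complex.I * ((-(t / 2) * (7 * r + 1 / r) : ℝ) : ℂ)) * w r *
    ((bes k₁ (t * r) : ℂ) * (bes k₂ (t * r) : ℂ) * (bes k₃ (t * r) : ℂ))

theorem continuousOn_tri {w : ℝ → ℂ} (hw : ContinuousOn w (Set.Icc (1 / 5) 5)) (k₁ k₂ k₃ : ℤ)
    (t : ℝ) : ContinuousOn (tri w k₁ k₂ k₃ t) (Set.Icc (1 / 5) 5) := by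
  unfold tri
  have hb : ∀ k : ℤ, Continuous fun r : ℝ => (bes k (t * r) : ℂ) := fun k =>
    Complex.continuous_ofReal.comp ((continuous_bes k).comp (continuous_const.mul continuous_id))
  refine ContinuousOn.mul (ContinuousOn.mul ?_ hw)
    (((hb k₁).mul (hb k₂)).mul (hb k₃)).continuousOn
  refine Complex.continuous_exp.comp_continuousOn (continuousOn_const.mul
    (Complex.continuous_ofReal.comp_continuousOn (continuousOn_const.mul
    (ContinuousOn.add (by fun_prop) (continuousOn_const.div continuousOn_id fun r hr => ?_)))))
  have : (0 : ℝ) < r := by linarith [hr.1]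
  exact this.ne'

theorem norm_triple_osc_le {t ε₁ ε₂ ε₃ v₁ v₂ v₃ : ℝ} {φ : ℝ → ℝ} {A A' : ℝ → ℂ}
    {N θ δ σ η q a b : ℝ} (h : PhaseOn t ε₁ ε₂ ε₃ v₁ v₂ v₃ φ a b) (hA : BVAmp A A' a b N)
    (h₁ : ε₁ = 1 ∨ ε₁ = -1) (h₂ : ε₂ = 1 ∨ ε₂ = -1) (h₃ : ε₃ = 1 ∨ ε₃ = -1)
    (hθ : 0 < θ) (hθt : θ ^ 6 = t) (hσ : 0 < σ) (hσδ : σ ^ 4 = δ) (hη : 0 < η)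
    (hηv : η ^ 4 = δ + v₁ - v₃) (hq : 0 < q) (hq2 : q ^ 2 * η = θ * σ ^ 2)
    (hδ5 : δ ≤ 5) (ha : v₁ + δ ≤ a) (hb : b ≤ v₁ + 2 * δ) :
    ‖osc φ A a b‖ ≤ 10 ^ 19 * (N * δ * (1 / q ^ 2) * (q / (1 + q) ^ 2)) := by
  have hN : 0 ≤ N := (norm_nonneg _).trans (hA a ⟨le_rfl, h.hab⟩).2.1
  have hδ : 0 < δ := by rw [← hσδ]; positivity
  rcases le_total q 1 with hq1 | hq1
  · refine (norm_osc_le h.hab hA).trans ?_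
    have e1 : 1 ≤ 4 * (1 / q ^ 2 * (q / (1 + q) ^ 2)) := by
      have : 4 * (1 / q ^ 2 * (q / (1 + q) ^ 2)) = 4 / (q * (1 + q) ^ 2) := by field_simp
      rw [this, le_div_iff₀ (by positivity)]
      have : q * (1 + q) ^ 2 ≤ 1 * (1 + 1) ^ 2 := by gcongr
      linarith
    calc N * (b - a) ≤ N * δ * 1 := by rw [mul_one]; gcongr; linarith
      _ ≤ N * δ * (4 * (1 / q ^ 2 * (q / (1 + q) ^ 2))) := by gcongr
      _ = 4 * (N * δ * (1 / q ^ 2) * (q / (1 + q) ^ 2)) := by ring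
      _ ≤ _ := by gcongr; norm_num
  · have hp : DyadicPiece t ε₁ ε₂ ε₃ v₁ v₂ v₃ φ A A' N (σ ^ 2) (η ^ 2) (1 / q) a b :=
      { h with
        hA := hA
        hs := by positivity
        hs5 := by rw [← pow_mul, hσδ]; exact hδ5
        he := by positivity
        hes := by rw [← pow_mul, ← pow_mul, hσδ]; exact hηv
        hy := by positivity
        hy1 := by rw [div_le_one hq]; exact hq1
        has := by rw [← pow_mul, hσδ]; exact ha
        hbs := by rw [← pow_mul, hσδ]; exact hb
        hty := by
          have : η = θ * σ ^ 2 / q ^ 2 := by field_simp; linarith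
          rw [← hθt, this]
          field_simp }
    refine (hp.norm_osc_le h₁ h₂ h₃).trans ?_
    have e1 : (1 / q) ^ 3 ≤ 4 * (1 / q ^ 2 * (q / (1 + q) ^ 2)) := by
      have : 4 * (1 / q ^ 2 * (q / (1 + q) ^ 2)) = 4 / (q * (1 + q) ^ 2) := by field_simp
      rw [this, div_pow, one_pow, div_le_div_iff₀ (by positivity) (by positivity)]
      have : q * (1 + q) ^ 2 ≤ q * (q + q) ^ 2 := by gcongr
      nlinarith
    rw [← pow_mul, hσδ]
    calc 10 ^ 18 * (N * δ * (1 / q) ^ 3)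
        ≤ 10 ^ 18 * (N * δ * (4 * (1 / q ^ 2 * (q / (1 + q) ^ 2)))) := by gcongr
      _ = 4 * 10 ^ 18 * (N * δ * (1 / q ^ 2) * (q / (1 + q) ^ 2)) := by ring
      _ ≤ _ := by gcongr; norm_num

theorem rpow_neg_half_of_pow {θ t : ℝ} (hθ : 0 < θ) (hθt : θ ^ 6 = t) :
    t ^ (-(1 / 2) : ℝ) = 1 / θ ^ 3 := by
  rw [← hθt, ← Real.rpow_natCast, ← Real.rpow_mul hθ.le,
    show ((6 : ℕ) : ℝ) * -(1 / 2) = -(3 : ℕ) by norm_num, Real.rpow_neg hθ.le, Real.rpow_natCast,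
    one_div]

theorem rpow_neg_quarter_le {x σ : ℝ} (hσ : 0 < σ) (hx : σ ^ 4 ≤ x) :
    x ^ (-(1 / 4) : ℝ) ≤ 1 / σ := by
  refine (Real.rpow_le_rpow_of_nonpos (by positivity) hx (by norm_num)).trans_eq ?_
  rw [← Real.rpow_natCast, ← Real.rpow_mul hσ.le,
    show ((4 : ℕ) : ℝ) * -(1 / 4) = -1 by norm_num, Real.rpow_neg_one, one_div]

theorem bvamp_wkb {θ t v σ a b δ : ℝ} {A A' : ℝ → ℂ} (hθ : 0 < θ) (hθt : θ ^ 6 = t)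
    (hσ : 0 < σ) (hba : b - a ≤ δ) (hδ : ∀ r ∈ Set.Icc a b, δ ≤ r - v)
    (hσv : ∀ r ∈ Set.Icc a b, σ ^ 4 ≤ r - v)
    (h : ∀ r ∈ Set.Icc a b, HasDerivAt A (A' r) r ∧
      ‖A r‖ ≤ 4000 * (t ^ (-(1 / 2) : ℝ) * (r - v) ^ (-(1 / 4) : ℝ)) ∧
      (r - v) * ‖A' r‖ ≤ 4000 * (t ^ (-(1 / 2) : ℝ) * (r - v) ^ (-(1 / 4) : ℝ))) :
    BVAmp A A' a b (4000 / (θ ^ 3 * σ)) := by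
  intro r hr
  obtain ⟨h1, h2, h3⟩ := h r hr
  have hle : 4000 * (t ^ (-(1 / 2) : ℝ) * (r - v) ^ (-(1 / 4) : ℝ)) ≤ 4000 / (θ ^ 3 * σ) := by
    rw [rpow_neg_half_of_pow hθ hθt]
    calc 4000 * (1 / θ ^ 3 * (r - v) ^ (-(1 / 4) : ℝ)) ≤ 4000 * (1 / θ ^ 3 * (1 / σ)) := by
          gcongr
          exact rpow_neg_quarter_le hσ (hσv r hr)
      _ = _ := by field_simp
  refine ⟨h1, h2.trans hle, ?_⟩
  calc ‖A' r‖ * (b - a) ≤ ‖A' r‖ * (r - v) := mul_le_mul_of_nonneg_left (hba.trans (hδ r hr)) (norm_nonneg _)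
    _ = (r - v) * ‖A' r‖ := mul_comm _ _
    _ ≤ _ := h3.trans hle

theorem norm_integral_tri_piece_le {w w' : ℝ → ℂ} {M : ℝ}
    (hw : ∀ r ∈ Set.Icc (1 / 5 : ℝ) 5, HasDerivAt w (w' r) r ∧ ‖w r‖ ≤ M ∧ ‖w' r‖ ≤ M)
    {k₁ k₂ k₃ : ℤ} (h32 : |k₃| ≤ |k₂|) (h21 : |k₂| ≤ |k₁|) {t θ δ σ η q a b : ℝ} (ht : 1 ≤ t)
    (hθ : 0 < θ) (hθt : θ ^ 6 = t) (hσ : 0 < σ) (hσδ : σ ^ 4 = δ) (hη : 0 < η)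
    (hηv : η ^ 4 = δ + |(k₁ : ℝ)| / t - |(k₃ : ℝ)| / t) (hq : 0 < q)
    (hq2 : q ^ 2 * η = θ * σ ^ 2) (hδ6 : 6 * t ^ (-(2 / 3) : ℝ) ≤ δ)
    (ha : |(k₁ : ℝ)| / t + δ ≤ a) (ha5 : 1 / 5 ≤ a) (hab : a ≤ b)
    (hb : b ≤ |(k₁ : ℝ)| / t + 2 * δ) (hb5 : b ≤ 5) :
    ‖∫ r in a..b, tri w k₁ k₂ k₃ t r‖ ≤ 10 ^ 33 * M / θ ^ 10 * (q / (1 + q) ^ 2) := by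
  have h32' : |(k₃ : ℝ)| / t ≤ |(k₂ : ℝ)| / t := by
    have : |(k₃ : ℝ)| ≤ |(k₂ : ℝ)| := by exact_mod_cast h32
    gcongr
  have h21' : |(k₂ : ℝ)| / t ≤ |(k₁ : ℝ)| / t := by
    have : |(k₂ : ℝ)| ≤ |(k₁ : ℝ)| := by exact_mod_cast h21
    gcongr
  obtain ⟨ψ₁, A₁, A₁', H₁⟩ := exists_bes_wkb k₁ ht
  obtain ⟨ψ₂, A₂, A₂', H₂⟩ := exists_bes_wkb k₂ ht
  obtain ⟨ψ₃, A₃, A₃', H₃⟩ := exists_bes_wkb k₃ ht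
  set v₁ := |(k₁ : ℝ)| / t with hv1
  set v₂ := |(k₂ : ℝ)| / t with hv2
  set v₃ := |(k₃ : ℝ)| / t with hv3
  have hv30 : 0 ≤ v₃ := by positivity
  have hδ : 0 < δ := by rw [← hσδ]; positivity
  have hI : ∀ r ∈ Set.Icc a b, r ∈ Set.Icc (1 / 5 : ℝ) 5 := fun r hr =>
    ⟨ha5.trans hr.1, hr.2.trans hb5⟩
  have G₁ := fun r (hr : r ∈ Set.Icc a b) => H₁ r (hI r hr) (by linarith [hr.1])
  have G₂ := fun r (hr : r ∈ Set.Icc a b) => H₂ r (hI r hr) (by linarith [hr.1])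
  have G₃ := fun r (hr : r ∈ Set.Icc a b) => H₃ r (hI r hr) (by linarith [hr.1])
  have hM : 0 ≤ M := (norm_nonneg _).trans (hw 5 (by norm_num)).2.1
  have hwA : BVAmp w w' a b (5 * M) := fun r hr => by
    obtain ⟨w1, w2, w3⟩ := hw r (hI r hr)
    refine ⟨w1, by linarith, ?_⟩
    calc ‖w' r‖ * (b - a) ≤ M * 5 := by
          apply mul_le_mul w3 <;> linarith
      _ = _ := mul_comm _ _
  have B₁ : ∀ c, BVAmp (A₁ c) (A₁' c) a b (4000 / (θ ^ 3 * σ)) := fun c =>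
    bvamp_wkb (v := v₁) (δ := δ) hθ hθt hσ (by linarith) (fun r hr => by linarith [hr.1])
      (fun r hr => by linarith [hr.1]) fun r hr => (G₁ r hr).2.2 c
  have B₂ : ∀ c, BVAmp (A₂ c) (A₂' c) a b (4000 / (θ ^ 3 * σ)) := fun c =>
    bvamp_wkb (v := v₂) (δ := δ) hθ hθt hσ (by linarith) (fun r hr => by linarith [hr.1])
      (fun r hr => by linarith [hr.1]) fun r hr => (G₂ r hr).2.2 c
  have B₃ : ∀ c, BVAmp (A₃ c) (A₃' c) a b (4000 / (θ ^ 3 * η)) := fun c =>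
    bvamp_wkb (v := v₃) (δ := δ) hθ hθt hη (by linarith) (fun r hr => by linarith [hr.1])
      (fun r hr => by linarith [hr.1]) fun r hr => (G₃ r hr).2.2 c
  set φ : Bool → Bool → Bool → ℝ → ℝ := fun c₁ c₂ c₃ r =>
    sgn c₁ * ψ₁ r + sgn c₂ * ψ₂ r + sgn c₃ * ψ₃ r + -(t / 2) * (7 * r + 1 / r) with hφ
  have hP : ∀ c₁ c₂ c₃, PhaseOn t (sgn c₁) (sgn c₂) (sgn c₃) v₁ v₂ v₃ (φ c₁ c₂ c₃) a b := by
    intro c₁ c₂ c₃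
    refine ⟨by linarith, hv30, h32', h21', by linarith, ha5, hab, hb5, fun r hr => ?_⟩
    have hr0 : r ≠ 0 := by
      have : 0 < r := by linarith [hr.1]
      exact this.ne'
    have d4 := (((hasDerivAt_id r).const_mul 7).add
      ((hasDerivAt_const r (1 : ℝ)).div (hasDerivAt_id r) hr0)).const_mul (-(t / 2))
    refine (((((G₁ r hr).1.const_mul (sgn c₁)).add ((G₂ r hr).1.const_mul (sgn c₂))).add
      ((G₃ r hr).1.const_mul (sgn c₃))).add d4).congr_deriv ?_
    simp only [id_eq, phF, phS]
    field_simp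
    ring
  have hC : ∀ c₁ c₂ c₃, BVAmp (fun r => w r * (A₁ c₁ r * (A₂ c₂ r * A₃ c₃ r))) _ a b _ :=
    fun c₁ c₂ c₃ => hwA.mul hab ((B₁ c₁).mul hab ((B₂ c₂).mul hab (B₃ c₃)))
  have hO := fun c₁ c₂ c₃ => norm_triple_osc_le (hP c₁ c₂ c₃) (hC c₁ c₂ c₃) (sgn_eq c₁) (sgn_eq c₂)
    (sgn_eq c₃) hθ hθt hσ hσδ hη hηv hq hq2 (by linarith [show 0 ≤ v₁ by positivity]) ha hb
  have hsum : ∫ r in a..b, tri w k₁ k₂ k₃ t r = ∑ c₁, ∑ c₂, ∑ c₃,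
      osc (φ c₁ c₂ c₃) (fun r => w r * (A₁ c₁ r * (A₂ c₂ r * A₃ c₃ r))) a b := by
    have hint : ∀ c₁ c₂ c₃, IntervalIntegrable (fun r => Complex.exp (Complex.I * (φ c₁ c₂ c₃ r : ℂ))
        * (w r * (A₁ c₁ r * (A₂ c₂ r * A₃ c₃ r)))) volume a b := fun c₁ c₂ c₃ => by
      refine ContinuousOn.intervalIntegrable_of_Icc hab fun r hr =>
        ContinuousAt.continuousWithinAt ?_
      refine ContinuousAt.mul (Complex.continuous_exp.continuousAt.comp
        (continuousAt_const.mul (Complex.continuous_ofReal.continuousAt.comp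
          ((hP c₁ c₂ c₃).hφ r hr).continuousAt))) (hC c₁ c₂ c₃ r hr).1.continuousAt
    unfold osc
    simp_rw [Fintype.sum_bool]
    rw [← intervalIntegral.integral_add (hint _ _ _) (hint _ _ _),
      ← intervalIntegral.integral_add (hint _ _ _) (hint _ _ _),
      ← intervalIntegral.integral_add ((hint _ _ _).add (hint _ _ _))
        ((hint _ _ _).add (hint _ _ _)),
      ← intervalIntegral.integral_add (hint _ _ _) (hint _ _ _),
      ← intervalIntegral.integral_add (hint _ _ _) (hint _ _ _),
      ← intervalIntegral.integral_add ((hint _ _ _).add (hint _ _ _))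
        ((hint _ _ _).add (hint _ _ _)),
      ← intervalIntegral.integral_add
        (((hint _ _ _).add (hint _ _ _)).add ((hint _ _ _).add (hint _ _ _)))
        (((hint _ _ _).add (hint _ _ _)).add ((hint _ _ _).add (hint _ _ _)))]
    refine intervalIntegral.integral_congr fun r hr => ?_
    rw [Set.uIcc_of_le hab] at hr
    simp only [tri, (G₁ r hr).2.1, (G₂ r hr).2.1, (G₃ r hr).2.1, Fintype.sum_bool, hφ]
    push_cast
    simp only [mul_add, Complex.exp_add]
    ring
  rw [hsum]
  have hbd : ∀ c₁ c₂ c₃, ‖osc (φ c₁ c₂ c₃) (fun r => w r * (A₁ c₁ r * (A₂ c₂ r * A₃ c₃ r))) a b‖ ≤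
      10 ^ 32 * M / θ ^ 10 * (q / (1 + q) ^ 2) := by
    intro c₁ c₂ c₃
    refine (hO c₁ c₂ c₃).trans ?_
    have e0 : η = θ * σ ^ 2 / q ^ 2 := by field_simp; linarith
    rw [← hσδ, e0]
    have : 10 ^ 19 * (2 * (5 * M * (2 * (4000 / (θ ^ 3 * σ) * (2 * (4000 / (θ ^ 3 * σ) *
        (4000 / (θ ^ 3 * (θ * σ ^ 2 / q ^ 2)))))))) * σ ^ 4 * (1 / q ^ 2) * (q / (1 + q) ^ 2))
        = 25600000000000000000000000000000 * M / θ ^ 10 * (q / (1 + q) ^ 2) := by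
      field_simp
      ring
    rw [this]
    gcongr
    norm_num
  calc _ ≤ ∑ c₁, ∑ c₂, ∑ c₃, 10 ^ 32 * M / θ ^ 10 * (q / (1 + q) ^ 2) :=
        norm_sum_le_of_le _ fun c₁ _ => norm_sum_le_of_le _ fun c₂ _ => norm_sum_le_of_le _
          fun c₃ _ => hbd c₁ c₂ c₃
    _ = 8 * 10 ^ 32 * (M / θ ^ 10 * (q / (1 + q) ^ 2)) := by
        simp only [Fintype.sum_bool]; ring
    _ ≤ 10 ^ 33 * (M / θ ^ 10 * (q / (1 + q) ^ 2)) := by gcongr; norm_num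
    _ = _ := by ring

/-- The size parameter of a dyadic piece. -/
def dyQ (θ w δ : ℝ) : ℝ := √(√(θ ^ 2 * δ / √(δ + w)))

theorem dyQ_pos {θ w δ : ℝ} (hθ : 0 < θ) (hw : 0 ≤ w) (hδ : 0 < δ) : 0 < dyQ θ w δ := by
  unfold dyQ; positivity

theorem dyQ_pow {θ w δ : ℝ} (hθ : 0 < θ) (hw : 0 ≤ w) (hδ : 0 < δ) :
    dyQ θ w δ ^ 8 = θ ^ 4 * δ ^ 2 / (δ + w) := by
  have h1 : dyQ θ w δ ^ 2 = √(θ ^ 2 * δ / √(δ + w)) := Real.sq_sqrt (by positivity)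
  have h2 : √(θ ^ 2 * δ / √(δ + w)) ^ 2 = θ ^ 2 * δ / √(δ + w) := Real.sq_sqrt (by positivity)
  have h3 : √(δ + w) ^ 2 = δ + w := Real.sq_sqrt (by positivity)
  calc dyQ θ w δ ^ 8 = ((dyQ θ w δ ^ 2) ^ 2) ^ 2 := by ring
    _ = θ ^ 4 * δ ^ 2 / √(δ + w) ^ 2 := by rw [h1, h2]; ring
    _ = _ := by rw [h3]

theorem dyQ_double {θ w δ : ℝ} (hθ : 0 < θ) (hw : 0 ≤ w) (hδ : 0 < δ) :
    21 / 20 * dyQ θ w δ ≤ dyQ θ w (2 * δ) := by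
  refine le_of_pow_le_pow_left₀ (n := 8) (by norm_num) (dyQ_pos hθ hw (by positivity)).le ?_
  rw [mul_pow, dyQ_pow hθ hw hδ, dyQ_pow hθ hw (by positivity)]
  calc (21 / 20) ^ 8 * (θ ^ 4 * δ ^ 2 / (δ + w)) ≤ 2 * (θ ^ 4 * δ ^ 2 / (δ + w)) := by
        gcongr; norm_num
    _ = θ ^ 4 * (2 * δ) ^ 2 / (2 * δ + 2 * w) := by field_simp
    _ ≤ _ := by gcongr; linarith

theorem dyadic_step {q q' : ℝ} (hq : 0 < q) (h : 21 / 20 * q ≤ q') :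
    21 * (q / (1 + q)) + q / (1 + q) ^ 2 ≤ 21 * (q' / (1 + q')) := by
  have hq' : 0 < q' := by linarith
  have h1 : (21 / 20 * q) / (1 + 21 / 20 * q) ≤ q' / (1 + q') := by
    rw [div_le_div_iff₀ (by positivity) (by positivity)]; nlinarith
  have h2 : 21 * (q / (1 + q)) + q / (1 + q) ^ 2 ≤ 21 * ((21 / 20 * q) / (1 + 21 / 20 * q)) := by
    rw [← sub_nonneg]
    have : 21 * ((21 / 20 * q) / (1 + 21 / 20 * q)) - (21 * (q / (1 + q)) + q / (1 + q) ^ 2)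
        = (q / 20) / ((1 + 21 / 20 * q) * (1 + q) ^ 2) := by
      field_simp; ring
    rw [this]; positivity
  linarith

theorem norm_integral_tri_far_le {w w' : ℝ → ℂ} {M : ℝ}
    (hw : ∀ r ∈ Set.Icc (1 / 5 : ℝ) 5, HasDerivAt w (w' r) r ∧ ‖w r‖ ≤ M ∧ ‖w' r‖ ≤ M)
    {k₁ k₂ k₃ : ℤ} (h32 : |k₃| ≤ |k₂|) (h21 : |k₂| ≤ |k₁|) {t θ c : ℝ} (ht : 1 ≤ t)
    (hθ : 0 < θ) (hθt : θ ^ 6 = t) (hc5 : 1 / 5 ≤ c) (hc : c ≤ 5)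
    (hcv : |(k₁ : ℝ)| / t + 6 * t ^ (-(2 / 3) : ℝ) ≤ c) :
    ‖∫ r in c..5, tri w k₁ k₂ k₃ t r‖ ≤ 10 ^ 35 * M / θ ^ 10 := by
  have hM : 0 ≤ M := (norm_nonneg _).trans (hw 5 (by norm_num)).2.1
  have h31' : |(k₃ : ℝ)| / t ≤ |(k₁ : ℝ)| / t := by
    have : |(k₃ : ℝ)| ≤ |(k₁ : ℝ)| := by exact_mod_cast h32.trans h21
    gcongr
  set v₁ := |(k₁ : ℝ)| / t with hv1
  set v₃ := |(k₃ : ℝ)| / t with hv3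
  set u := v₁ - v₃ with hu
  have hu0 : 0 ≤ u := sub_nonneg.2 h31'
  have hτ : 0 < t ^ (-(2 / 3) : ℝ) := Real.rpow_pos_of_pos (by linarith) _
  set δ₀ := c - v₁ with hδ₀
  have hδ0 : 0 < δ₀ := by linarith
  have hcont : ContinuousOn (tri w k₁ k₂ k₃ t) (Set.Icc (1 / 5) 5) :=
    continuousOn_tri (fun r hr => (hw r hr).1.continuousAt.continuousWithinAt) k₁ k₂ k₃ t
  have hint : ∀ a b, 1 / 5 ≤ a → a ≤ b → b ≤ 5 →
      IntervalIntegrable (tri w k₁ k₂ k₃ t) volume a b := fun a b ha hab hb =>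
    (hcont.mono (Set.Icc_subset_Icc ha hb)).intervalIntegrable_of_Icc hab
  have piece : ∀ δ a b, δ₀ ≤ δ → v₁ + δ ≤ a → a ≤ b → b ≤ v₁ + 2 * δ → b ≤ 5 →
      ‖∫ r in a..b, tri w k₁ k₂ k₃ t r‖ ≤
        10 ^ 33 * M / θ ^ 10 * (dyQ θ u δ / (1 + dyQ θ u δ) ^ 2) := by
    intro δ a b hδ ha hab hb hb5
    have hδp : 0 < δ := hδ0.trans_le hδ
    have q4 : ∀ x : ℝ, 0 < x → √(√x) ^ 4 = x := fun x hx => by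
      rw [show 4 = 2 * 2 by norm_num, pow_mul, Real.sq_sqrt (by positivity), Real.sq_sqrt hx.le]
    refine norm_integral_tri_piece_le hw h32 h21 (δ := δ) (σ := √(√δ)) (η := √(√(δ + u))) ht hθ hθt
      (by positivity) (q4 δ hδp) (by positivity) ?_ (dyQ_pos hθ hu0 hδp) ?_ (by linarith) ha
      (by linarith) hab hb hb5
    · rw [q4 _ (by positivity)]; ring
    · have h1 : dyQ θ u δ ^ 2 = √(θ ^ 2 * δ / √(δ + u)) := Real.sq_sqrt (by positivity)
      rw [h1, Real.sqrt_div (by positivity), Real.sqrt_mul (by positivity), Real.sqrt_sq hθ.le,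
        Real.sq_sqrt (by positivity)]
      field_simp
  have main : ∀ n : ℕ, ∀ b, c ≤ b → b ≤ 5 → b ≤ v₁ + 2 ^ n * δ₀ →
      ‖∫ r in c..b, tri w k₁ k₂ k₃ t r‖ ≤ 10 ^ 33 * M / θ ^ 10 *
        (21 * (dyQ θ u (2 ^ n * δ₀) / (1 + dyQ θ u (2 ^ n * δ₀)))) := by
    intro n
    induction n with
    | zero =>
      intro b hcb hb5 hb
      have : b = c := by linarith
      rw [this, intervalIntegral.integral_same, norm_zero]
      have := dyQ_pos hθ hu0 (by positivity : 0 < 2 ^ 0 * δ₀)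
      positivity
    | succ n ih =>
      intro b hcb hb5 hb
      have hδn : 0 < 2 ^ n * δ₀ := by positivity
      have hqn := dyQ_pos hθ hu0 hδn
      have step := dyadic_step hqn (dyQ_double hθ hu0 hδn)
      rw [← mul_assoc 2 (2 ^ n) δ₀, ← pow_succ'] at step
      have hK : 0 ≤ 10 ^ 33 * M / θ ^ 10 := by positivity
      have hδn1 : δ₀ ≤ 2 ^ n * δ₀ := le_mul_of_one_le_left hδ0.le (one_le_pow₀ (by norm_num))
      refine le_trans ?_ (mul_le_mul_of_nonneg_left step hK)
      rw [mul_add]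
      rcases le_total b (v₁ + 2 ^ n * δ₀) with hbn | hbn
      · have := ih b hcb hb5 hbn
        have h0 : 0 ≤ 10 ^ 33 * M / θ ^ 10 *
          (dyQ θ u (2 ^ n * δ₀) / (1 + dyQ θ u (2 ^ n * δ₀)) ^ 2) := by positivity
        linarith
      · have hca : c ≤ v₁ + 2 ^ n * δ₀ := by linarith
        rw [← intervalIntegral.integral_add_adjacent_intervals
          (hint c _ hc5 hca (hbn.trans hb5)) (hint _ b (hc5.trans hca) hbn hb5)]
        refine (norm_add_le _ _).trans (add_le_add (ih _ hca (hbn.trans hb5) le_rfl) ?_)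
        refine piece _ _ _ hδn1 le_rfl hbn ?_ hb5
        rw [pow_succ] at hb
        linarith
  obtain ⟨n, hn⟩ := pow_unbounded_of_one_lt ((5 - v₁) / δ₀) (by norm_num : (1 : ℝ) < 2)
  have hn' : 5 ≤ v₁ + 2 ^ n * δ₀ := by
    rw [div_lt_iff₀ hδ0] at hn; linarith
  refine (main n 5 hc le_rfl hn').trans ?_
  have hq := dyQ_pos hθ hu0 (by positivity : 0 < 2 ^ n * δ₀)
  calc _ ≤ 10 ^ 33 * M / θ ^ 10 * (21 * 1) := by
        gcongr
        rw [div_le_one (by positivity)]; linarith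
    _ = 21 * 10 ^ 33 * (M / θ ^ 10) := by ring
    _ ≤ 10 ^ 35 * (M / θ ^ 10) := by gcongr; norm_num
    _ = _ := by ring

theorem norm_exp_mul_le (y : ℝ) (z : ℂ) : ‖Complex.exp (Complex.I * (y : ℂ)) * z‖ = ‖z‖ := by
  rw [norm_mul, norm_cexp_I_mul, one_mul]

theorem abs_bes_mul_le {θ t : ℝ} (hθ : 0 < θ) (hθt : θ ^ 6 = t) (x : ℝ) {r : ℝ} (hr : 1 / 5 ≤ r) :
    |bes x (t * r)| ≤ 256 / θ ^ 2 := by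
  have ht : 0 < t := by rw [← hθt]; positivity
  refine (abs_bes_le x (by positivity)).trans ?_
  have h1 : θ ^ 6 * (1 / 2) ^ 3 ≤ t * r := by rw [hθt]; gcongr; linarith
  have h2 : (t * r) ^ (-(1 / 3) : ℝ) ≤ (θ ^ 6 * (1 / 2) ^ 3) ^ (-(1 / 3) : ℝ) :=
    Real.rpow_le_rpow_of_nonpos (by positivity) h1 (by norm_num)
  have h3 : (θ ^ 6 * (1 / 2) ^ 3) ^ (-(1 / 3) : ℝ) = 2 / θ ^ 2 := by
    rw [show θ ^ 6 * (1 / 2) ^ 3 = (θ ^ 2 / 2) ^ 3 by ring, ← Real.rpow_natCast,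
      ← Real.rpow_mul (by positivity), show ((3 : ℕ) : ℝ) * -(1 / 3) = -1 by norm_num,
      Real.rpow_neg_one, inv_div]
  rw [h3] at h2
  calc _ ≤ 128 * (2 / θ ^ 2) := by gcongr
    _ = _ := by ring

theorem norm_integral_tri_near_le {w : ℝ → ℂ} {M : ℝ}
    (hw : ∀ r ∈ Set.Icc (1 / 5 : ℝ) 5, ‖w r‖ ≤ M)
    (k₁ k₂ k₃ : ℤ) {t θ c : ℝ} (ht : 1 ≤ t)
    (hθ : 0 < θ) (hθt : θ ^ 6 = t) (hc5 : 1 / 5 ≤ c) (hc : c ≤ 5)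
    (hcv : c = 1 / 5 ∨ c ≤ |(k₁ : ℝ)| / t + 6 * t ^ (-(2 / 3) : ℝ)) :
    ‖∫ r in (1 / 5)..c, tri w k₁ k₂ k₃ t r‖ ≤ 10 ^ 10 * M / θ ^ 10 := by
  have hM : 0 ≤ M := (norm_nonneg _).trans (hw 5 (by norm_num))
  rcases hcv with rfl | hcv
  · rw [intervalIntegral.integral_same, norm_zero]; positivity
  have ht0 : 0 < t := by linarith
  have hτ : t ^ (-(2 / 3) : ℝ) = 1 / θ ^ 4 := by
    rw [← hθt, ← Real.rpow_natCast, ← Real.rpow_mul hθ.le,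
      show ((6 : ℕ) : ℝ) * -(2 / 3) = -(4 : ℕ) by norm_num, Real.rpow_neg hθ.le,
      Real.rpow_natCast, one_div]
  rw [hτ] at hcv
  have hpt : ∀ r ∈ Set.Icc (1 / 5) c, ‖tri w k₁ k₂ k₃ t r‖ ≤
      M * (256 / θ ^ 2) * (256 / θ ^ 2) * |bes k₁ (t * r)| := by
    intro r hr
    unfold tri
    rw [mul_assoc, norm_exp_mul_le, norm_mul, norm_mul, norm_mul, Complex.norm_real,
      Complex.norm_real, Complex.norm_real, Real.norm_eq_abs, Real.norm_eq_abs, Real.norm_eq_abs]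
    have h1 := abs_bes_mul_le hθ hθt k₂ hr.1
    have h2 := abs_bes_mul_le hθ hθt k₃ hr.1
    have h3 := hw r ⟨hr.1, hr.2.trans hc⟩
    calc ‖w r‖ * (|bes k₁ (t * r)| * |bes k₂ (t * r)| * |bes k₃ (t * r)|)
        ≤ M * (|bes k₁ (t * r)| * (256 / θ ^ 2) * (256 / θ ^ 2)) := by gcongr
      _ = _ := by ring
  have hbc : Continuous fun r : ℝ => |bes k₁ (t * r)| :=
    ((continuous_bes k₁).comp (continuous_const.mul continuous_id)).abs
  have hbi : ∀ a b, IntervalIntegrable (fun r : ℝ => |bes k₁ (t * r)|) volume a b := fun a b =>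
    hbc.intervalIntegrable a b
  have hJ : ∫ r in (1 / 5)..c, |bes k₁ (t * r)| ≤ 30000 / θ ^ 6 := by
    set m := min c (max (1 / 5) (|(k₁ : ℝ)| / t)) with hm
    have hm5 : 1 / 5 ≤ m := le_min hc5 (le_max_left _ _)
    have hmc : m ≤ c := min_le_left _ _
    rw [← intervalIntegral.integral_add_adjacent_intervals (hbi _ m) (hbi m _)]
    have p1 : ∫ r in (1 / 5)..m, |bes k₁ (t * r)| ≤ 20000 / θ ^ 6 := by
      rcases le_total (|(k₁ : ℝ)| / t) (1 / 5) with h | h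
      · have : m = 1 / 5 := le_antisymm (by rw [hm, max_eq_left h]; exact min_le_right _ _) hm5
        rw [this, intervalIntegral.integral_same]; positivity
      · have hmv : m ≤ |(k₁ : ℝ)| / t := by rw [hm, max_eq_right h]; exact min_le_right _ _
        calc ∫ r in (1 / 5)..m, |bes k₁ (t * r)|
            ≤ ∫ r in 0..(|(k₁ : ℝ)| / t), |bes k₁ (t * r)| :=
              intervalIntegral.integral_mono_interval (by norm_num) hm5 hmv
                (Filter.Eventually.of_forall fun r => abs_nonneg _) (hbi _ _)
          _ = t⁻¹ * ∫ z in 0..|(k₁ : ℝ)|, |bes k₁ z| := by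
              rw [intervalIntegral.integral_comp_mul_left (fun z => |bes k₁ z|) ht0.ne',
                mul_zero, mul_div_cancel₀ _ ht0.ne', smul_eq_mul]
          _ ≤ t⁻¹ * 20000 := by gcongr; exact integral_abs_bes_forbidden k₁
          _ = _ := by rw [hθt]; ring
    have p2 : ∫ r in m..c, |bes k₁ (t * r)| ≤ 1536 / θ ^ 6 := by
      calc ∫ r in m..c, |bes k₁ (t * r)| ≤ ∫ _ in m..c, 256 / θ ^ 2 :=
            intervalIntegral.integral_mono_on hmc (hbi _ _) intervalIntegrable_const
              fun r hr => abs_bes_mul_le hθ hθt k₁ (hm5.trans hr.1)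
        _ = (c - m) * (256 / θ ^ 2) := by rw [intervalIntegral.integral_const, smul_eq_mul]
        _ ≤ (6 * (1 / θ ^ 4)) * (256 / θ ^ 2) := by
            gcongr
            rw [sub_le_comm, hm]
            have : 0 ≤ 6 * (1 / θ ^ 4) := by positivity
            refine le_min (by linarith) (le_max_of_le_right (by linarith))
        _ = _ := by field_simp; norm_num
    calc _ ≤ 20000 / θ ^ 6 + 1536 / θ ^ 6 := add_le_add p1 p2
      _ = 21536 / θ ^ 6 := by ring
      _ ≤ _ := by gcongr; norm_num
  calc ‖∫ r in (1 / 5)..c, tri w k₁ k₂ k₃ t r‖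
      ≤ ∫ r in (1 / 5)..c, M * (256 / θ ^ 2) * (256 / θ ^ 2) * |bes k₁ (t * r)| := by
        refine intervalIntegral.norm_integral_le_of_norm_le hc5
          (Filter.Eventually.of_forall fun r hr => hpt r (Set.Ioc_subset_Icc_self hr)) ?_
        exact (hbi _ _).const_mul _
    _ = M * (256 / θ ^ 2) * (256 / θ ^ 2) * ∫ r in (1 / 5)..c, |bes k₁ (t * r)| :=
        intervalIntegral.integral_const_mul _ _
    _ ≤ M * (256 / θ ^ 2) * (256 / θ ^ 2) * (30000 / θ ^ 6) := by gcongr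
    _ = 1966080000 * (M / θ ^ 10) := by field_simp; ring
    _ ≤ 10 ^ 10 * (M / θ ^ 10) := by gcongr; norm_num
    _ = _ := by ring

theorem norm_integral_tri_le_of_sorted {w w' : ℝ → ℂ} {M : ℝ}
    (hw : ∀ r ∈ Set.Icc (1 / 5 : ℝ) 5, HasDerivAt w (w' r) r ∧ ‖w r‖ ≤ M ∧ ‖w' r‖ ≤ M)
    {k₁ k₂ k₃ : ℤ} (h32 : |k₃| ≤ |k₂|) (h21 : |k₂| ≤ |k₁|) {t : ℝ} (ht : 1 ≤ t) :
    ‖∫ r in (1 / 5)..5, tri w k₁ k₂ k₃ t r‖ ≤ 10 ^ 36 * M * t ^ (-(5 / 3) : ℝ) := by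
  have ht0 : 0 < t := by linarith
  have hM : 0 ≤ M := (norm_nonneg _).trans (hw 5 (by norm_num)).2.1
  obtain ⟨θ, hθ, hθt⟩ : ∃ θ : ℝ, 0 < θ ∧ θ ^ 6 = t :=
    ⟨t ^ (1 / 6 : ℝ), by positivity, by
      rw [← Real.rpow_natCast, ← Real.rpow_mul ht0.le]; norm_num⟩
  have h53 : t ^ (-(5 / 3) : ℝ) = 1 / θ ^ 10 := by
    rw [← hθt, ← Real.rpow_natCast, ← Real.rpow_mul hθ.le,
      show ((6 : ℕ) : ℝ) * -(5 / 3) = -(10 : ℕ) by norm_num, Real.rpow_neg hθ.le,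
      Real.rpow_natCast, one_div]
  have hwc : ContinuousOn w (Set.Icc (1 / 5) 5) := fun r hr =>
    (hw r hr).1.continuousAt.continuousWithinAt
  have hcont := continuousOn_tri hwc k₁ k₂ k₃ t
  have hint : ∀ a b, 1 / 5 ≤ a → a ≤ b → b ≤ 5 →
      IntervalIntegrable (tri w k₁ k₂ k₃ t) volume a b := fun a b ha hab hb =>
    (hcont.mono (Set.Icc_subset_Icc ha hb)).intervalIntegrable_of_Icc hab
  have hK : 0 ≤ M / θ ^ 10 := by positivity
  have hR : 10 ^ 36 * M * t ^ (-(5 / 3) : ℝ) = 10 ^ 36 * (M / θ ^ 10) := by rw [h53]; ring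
  rw [hR]
  have near := fun c => norm_integral_tri_near_le (c := c) (fun r hr => (hw r hr).2.1) k₁ k₂ k₃
    ht hθ hθt
  set d := |(k₁ : ℝ)| / t + 6 * t ^ (-(2 / 3) : ℝ) with hd
  rcases le_total 5 d with h5 | h5
  · refine (near 5 (by norm_num) le_rfl (Or.inr h5)).trans ?_
    rw [mul_div_assoc]
    exact mul_le_mul_of_nonneg_right (by norm_num) hK
  · set c := max (1 / 5) d with hc
    have hc5 : 1 / 5 ≤ c := le_max_left _ _
    have hc5' : c ≤ 5 := max_le (by norm_num) h5
    rw [← intervalIntegral.integral_add_adjacent_intervals (hint _ c le_rfl hc5 hc5')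
      (hint c _ hc5 hc5' le_rfl)]
    have n1 := near c hc5 hc5' (by
      rcases le_total d (1 / 5) with h | h
      · left; rw [hc, max_eq_left h]
      · right; rw [hc, max_eq_right h])
    have n2 := norm_integral_tri_far_le hw h32 h21 ht hθ hθt hc5 hc5' (le_max_right _ _)
    refine (norm_add_le _ _).trans ((add_le_add n1 n2).trans ?_)
    rw [mul_div_assoc, mul_div_assoc, ← add_mul]
    gcongr
    norm_num

theorem tri_swap₁₂ (w : ℝ → ℂ) (k₁ k₂ k₃ : ℤ) (t : ℝ) : tri w k₁ k₂ k₃ t = tri w k₂ k₁ k₃ t := by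
  funext r; unfold tri; ring

theorem tri_swap₂₃ (w : ℝ → ℂ) (k₁ k₂ k₃ : ℤ) (t : ℝ) : tri w k₁ k₂ k₃ t = tri w k₁ k₃ k₂ t := by
  funext r; unfold tri; ring

theorem norm_integral_tri_le {w w' : ℝ → ℂ} {M : ℝ}
    (hw : ∀ r ∈ Set.Icc (1 / 5 : ℝ) 5, HasDerivAt w (w' r) r ∧ ‖w r‖ ≤ M ∧ ‖w' r‖ ≤ M)
    (k₁ k₂ k₃ : ℤ) {t : ℝ} (ht : 1 ≤ t) :
    ‖∫ r in (1 / 5)..5, tri w k₁ k₂ k₃ t r‖ ≤ 10 ^ 36 * M * t ^ (-(5 / 3) : ℝ) := by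
  rcases le_total |k₁| |k₂| with h12 | h12 <;> rcases le_total |k₂| |k₃| with h23 | h23 <;>
    rcases le_total |k₁| |k₃| with h13 | h13
  · rw [tri_swap₁₂, tri_swap₂₃, tri_swap₁₂]; exact norm_integral_tri_le_of_sorted hw h12 h23 ht
  · rw [tri_swap₁₂, tri_swap₂₃, tri_swap₁₂]; exact norm_integral_tri_le_of_sorted hw h12 h23 ht
  · rw [tri_swap₁₂, tri_swap₂₃]; exact norm_integral_tri_le_of_sorted hw h13 h23 ht
  · rw [tri_swap₁₂]; exact norm_integral_tri_le_of_sorted hw h13 h12 ht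
  · rw [tri_swap₂₃, tri_swap₁₂]; exact norm_integral_tri_le_of_sorted hw h12 h13 ht
  · rw [tri_swap₂₃]; exact norm_integral_tri_le_of_sorted hw h23 h13 ht
  · exact norm_integral_tri_le_of_sorted hw h23 h12 ht
  · exact norm_integral_tri_le_of_sorted hw h23 h12 ht

/-! ### Non-stationary tails -/

/-- The reciprocal of the derivative of `E₁ r + E₂ / r`. -/
def recipH (E₁ E₂ r : ℝ) : ℝ := r ^ 2 / (E₁ * r ^ 2 - E₂)

theorem recipH_bounds {E₁ E₂ r : ℝ} (h₁ : 1 ≤ E₁) (h₂ : 1 ≤ E₂) (h₂' : E₂ ≤ 13)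
    (hr : 4 ≤ r) :
    HasDerivAt (recipH E₁ E₂) (-(2 * E₂ * r / (E₁ * r ^ 2 - E₂) ^ 2)) r ∧
    HasDerivAt (fun r => -(2 * E₂ * r / (E₁ * r ^ 2 - E₂) ^ 2))
      (6 * E₂ / (E₁ * r ^ 2 - E₂) ^ 2 + 8 * E₂ ^ 2 / (E₁ * r ^ 2 - E₂) ^ 3) r ∧
    (E₁ - E₂ / r ^ 2) * recipH E₁ E₂ r = 1 ∧
    |recipH E₁ E₂ r| ≤ 6 ∧ |-(2 * E₂ * r / (E₁ * r ^ 2 - E₂) ^ 2)| ≤ 50 / r ∧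
    |6 * E₂ / (E₁ * r ^ 2 - E₂) ^ 2 + 8 * E₂ ^ 2 / (E₁ * r ^ 2 - E₂) ^ 3| ≤ 1100 / r ^ 2 := by
  have hr0 : 0 < r := by linarith
  have hr2 : 16 ≤ r ^ 2 := by nlinarith
  have hD : 3 / 16 * r ^ 2 ≤ E₁ * r ^ 2 - E₂ := by nlinarith
  have hD0 : 0 < E₁ * r ^ 2 - E₂ := by nlinarith
  have dD : HasDerivAt (fun r : ℝ => E₁ * r ^ 2 - E₂) (E₁ * (2 * r)) r := by
    refine (((hasDerivAt_pow 2 r).const_mul E₁).sub_const E₂).congr_deriv ?_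
    norm_num
  refine ⟨?_, ?_, ?_, ?_, ?_, ?_⟩
  · refine ((hasDerivAt_pow 2 r).div dD hD0.ne').congr_deriv ?_
    norm_num
    rw [← neg_div]
    congr 1
    ring
  · refine (((hasDerivAt_id r).const_mul (2 * E₂)).div (dD.pow 2)
      (pow_ne_zero 2 hD0.ne')).neg.congr_deriv ?_
    simp only [id_eq, Pi.pow_apply]
    norm_num
    field_simp
    ring
  · unfold recipH
    field_simp
  · unfold recipH
    rw [abs_of_pos (by positivity), div_le_iff₀ hD0]
    nlinarith
  · rw [abs_neg, abs_of_pos (by positivity), div_le_div_iff₀ (by positivity) hr0]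
    have : (3 / 16 * r ^ 2) ^ 2 ≤ (E₁ * r ^ 2 - E₂) ^ 2 := by gcongr
    have h4 : 16 * r ^ 2 ≤ r ^ 4 := by nlinarith
    nlinarith
  · rw [abs_of_pos (by positivity)]
    have a1 : (9 / 16) * r ^ 2 ≤ (E₁ * r ^ 2 - E₂) ^ 2 := by
      have : (3 / 16 * r ^ 2) ^ 2 ≤ (E₁ * r ^ 2 - E₂) ^ 2 := by gcongr
      nlinarith
    have a2 : (27 / 16) * r ^ 2 ≤ (E₁ * r ^ 2 - E₂) ^ 3 := by
      calc (27 / 16) * r ^ 2 = 3 * ((9 / 16) * r ^ 2) := by ring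
        _ ≤ (E₁ * r ^ 2 - E₂) * (E₁ * r ^ 2 - E₂) ^ 2 := by
          apply mul_le_mul _ a1 (by positivity) hD0.le
          linarith
        _ = _ := by ring
    calc _ ≤ 6 * 13 / ((9 / 16) * r ^ 2) + 8 * 13 ^ 2 / ((27 / 16) * r ^ 2) := by gcongr
      _ = (6 * 13 / (9 / 16) + 8 * 13 ^ 2 / (27 / 16)) / r ^ 2 := by field_simp
      _ ≤ _ := by gcongr; norm_num

theorem hasDerivAt_energy (E₁ E₂ : ℝ) {r : ℝ} (hr : 0 < r) :
    HasDerivAt (fun r => E₁ * r + E₂ / r) (E₁ - E₂ / r ^ 2) r := by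
  refine (((hasDerivAt_id r).const_mul E₁).add
    ((hasDerivAt_const r E₂).div (hasDerivAt_id r) hr.ne')).congr_deriv ?_
  simp only [id_eq]
  field_simp
  ring

theorem dZ_algebra {l h e g g' H H' P P' : ℂ} (hl : l ≠ 0) (hh : h * H = 1)
    (hP : h * P = g' * H + g * H') :
    Complex.I * (-(l * h)) * e * (Complex.I / l * (g * H) + 1 / l ^ 2 * P) +
      e * (Complex.I / l * (g' * H + g * H') + 1 / l ^ 2 * P') = e * g + 1 / l ^ 2 * (e * P') := by
  have : Complex.I * (-(l * h)) * e * (Complex.I / l * (g * H) + 1 / l ^ 2 * P) =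
      -(Complex.I ^ 2) * e * g * (h * H) - Complex.I * e * (h * P) / l := by
    field_simp
    ring
  rw [this, ← hP, hh, Complex.I_sq]
  ring

theorem norm_integral_tail_le {G G' G'' : ℝ → ℝ} {N : ℝ}
    (hG : ∀ r, 4 ≤ r → HasDerivAt G (G' r) r) (hG' : ∀ r, 4 ≤ r → HasDerivAt G' (G'' r) r)
    (hG''c : ContinuousOn G'' (Set.Ici 4))
    (b0 : ∀ r, 4 ≤ r → |G r| ≤ N / √r) (b1 : ∀ r, 4 ≤ r → |G' r| ≤ N / r)
    (b2 : ∀ r, 4 ≤ r → |G'' r| ≤ N / r ^ 2) (z0 : G 4 = 0) (z1 : G' 4 = 0)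
    {E₁ E₂ l R : ℝ} (h₁ : 1 ≤ E₁) (h₂ : 1 ≤ E₂) (h₂' : E₂ ≤ 13) (hl : 1 / 2 ≤ l)
    (hR : 4 ≤ R) :
    ‖∫ r in 4..R, Complex.exp (Complex.I * ((-(l * (E₁ * r + E₂ / r)) : ℝ) : ℂ)) * (G r : ℂ)‖ ≤
      100000 * N * (1 / l ^ 2 + 1 / √R) := by
  have hl0 : 0 < l := by linarith
  have hN : 0 ≤ N := by
    have := (abs_nonneg _).trans (b1 4 le_rfl); linarith
  set H := recipH E₁ E₂ with hH
  set H' : ℝ → ℝ := fun r => -(2 * E₂ * r / (E₁ * r ^ 2 - E₂) ^ 2) with hH'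
  set H'' : ℝ → ℝ := fun r => 6 * E₂ / (E₁ * r ^ 2 - E₂) ^ 2 + 8 * E₂ ^ 2 / (E₁ * r ^ 2 - E₂) ^ 3
    with hH''
  set P : ℝ → ℝ := fun r => G' r * H r ^ 2 + G r * (H r * H' r) with hP
  set P' : ℝ → ℝ := fun r => G'' r * H r ^ 2 + 3 * G' r * (H r * H' r) +
    G r * (H' r ^ 2 + H r * H'' r) with hP'
  have hb := fun r hr => recipH_bounds h₁ h₂ h₂' (r := r) hr
  have dP : ∀ r, 4 ≤ r → HasDerivAt P (P' r) r := by
    intro r hr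
    obtain ⟨d1, d2, -, -, -, -⟩ := hb r hr
    refine (((hG' r hr).mul (d1.pow 2)).add ((hG r hr).mul (d1.mul d2))).congr_deriv ?_
    simp only [hP', hH, hH', hH'', Pi.mul_apply, Pi.pow_apply]
    norm_num
    ring
  have cH'' : ContinuousOn H'' (Set.Ici 4) := by
    have hD : ∀ r ∈ Set.Ici (4 : ℝ), E₁ * r ^ 2 - E₂ ≠ 0 := fun r (hr : 4 ≤ r) => by
      have : 0 < E₁ * r ^ 2 - E₂ := by nlinarith
      exact this.ne'
    refine ContinuousOn.add (continuousOn_const.div (by fun_prop) fun r hr => pow_ne_zero _ (hD r hr))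
      (continuousOn_const.div (by fun_prop) fun r hr => pow_ne_zero _ (hD r hr))
  have cP' : ContinuousOn P' (Set.Ici 4) := by
    have c1 : ContinuousOn G (Set.Ici 4) := fun r hr => (hG r hr).continuousAt.continuousWithinAt
    have c2 : ContinuousOn G' (Set.Ici 4) := fun r hr => (hG' r hr).continuousAt.continuousWithinAt
    have c3 : ContinuousOn H (Set.Ici 4) := fun r hr => (hb r hr).1.continuousAt.continuousWithinAt
    have c4 : ContinuousOn H' (Set.Ici 4) := fun r hr =>
      (hb r hr).2.1.continuousAt.continuousWithinAt
    simp only [hP']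
    fun_prop
  have bP : ∀ r, 4 ≤ r → |P r| ≤ 336 * N / √r := by
    intro r hr
    obtain ⟨-, -, -, e0, e1, -⟩ := hb r hr
    have hr0 : 0 < r := by linarith
    have hsr : √r ≤ r := Real.sqrt_le_iff.2 ⟨hr0.le, by nlinarith⟩
    have hs0 : 0 < √r := Real.sqrt_pos.2 hr0
    have f0 := b0 r hr
    have f1 := b1 r hr
    calc |P r| ≤ |G' r| * |H r| ^ 2 + |G r| * (|H r| * |H' r|) := by
          refine (abs_add_le _ _).trans_eq ?_
          rw [abs_mul, abs_mul, abs_mul, abs_pow]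
      _ ≤ N / r * 6 ^ 2 + N / √r * (6 * (50 / r)) := by gcongr
      _ ≤ N / √r * 6 ^ 2 + N / √r * (6 * (50 / 1)) := by gcongr; linarith
      _ = _ := by ring
  have bP' : ∀ r, 4 ≤ r → |P' r| ≤ 10036 * N / r ^ 2 := by
    intro r hr
    obtain ⟨-, -, -, e0, e1, e2⟩ := hb r hr
    have hr0 : 0 < r := by linarith
    have hs1 : 1 ≤ √r := Real.one_le_sqrt.2 (by linarith)
    have f0 : |G r| ≤ N := (b0 r hr).trans (div_le_self hN hs1)
    have f1 := b1 r hr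
    have f2 := b2 r hr
    calc |P' r| ≤ |G'' r| * |H r| ^ 2 + 3 * |G' r| * (|H r| * |H' r|) +
          |G r| * (|H' r| ^ 2 + |H r| * |H'' r|) := by
          refine (abs_add_le _ _).trans (add_le_add ((abs_add_le _ _).trans_eq ?_) ?_)
          · rw [abs_mul, abs_mul, abs_mul, abs_mul, abs_pow, abs_of_pos (by norm_num : (0:ℝ) < 3)]
          · rw [abs_mul]
            gcongr
            refine (abs_add_le _ _).trans_eq ?_
            rw [abs_mul, abs_pow]
      _ ≤ N / r ^ 2 * 6 ^ 2 + 3 * (N / r) * (6 * (50 / r)) +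
          N * ((50 / r) ^ 2 + 6 * (1100 / r ^ 2)) := by gcongr
      _ = _ := by field_simp; ring
  set e : ℝ → ℂ := fun r => Complex.exp (Complex.I * ((-(l * (E₁ * r + E₂ / r)) : ℝ) : ℂ)) with he
  have de : ∀ r, 4 ≤ r →
      HasDerivAt e (Complex.I * ((-(l * (E₁ - E₂ / r ^ 2)) : ℝ) : ℂ) * e r) r := by
    intro r hr
    have : HasDerivAt (fun r => -(l * (E₁ * r + E₂ / r))) (-(l * (E₁ - E₂ / r ^ 2))) r :=
      ((hasDerivAt_energy E₁ E₂ (by linarith)).const_mul l).neg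
    exact hasDerivAt_cexp_I_mul this
  have ne1 : ∀ r, ‖e r‖ = 1 := fun r => norm_cexp_I_mul _
  set Z : ℝ → ℂ := fun r => e r * (Complex.I / l * ((G r * H r : ℝ) : ℂ) + 1 / l ^ 2 * (P r : ℂ))
    with hZ
  have dZ : ∀ r, 4 ≤ r → HasDerivAt Z (e r * (G r : ℂ) + 1 / l ^ 2 * (e r * (P' r : ℂ))) r := by
    intro r hr
    obtain ⟨d1, -, hh, -, -, -⟩ := hb r hr
    refine ((de r hr).mul ((((hG r hr).mul d1).ofReal_comp.const_mul (Complex.I / l)).add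
      ((dP r hr).ofReal_comp.const_mul (1 / (l : ℂ) ^ 2)))).congr_deriv ?_
    have hh' : ((E₁ - E₂ / r ^ 2 : ℝ) : ℂ) * (H r : ℂ) = 1 := by exact_mod_cast hh
    have hlc : (l : ℂ) ≠ 0 := by exact_mod_cast hl0.ne'
    have hPc : ((E₁ - E₂ / r ^ 2 : ℝ) : ℂ) * (P r : ℂ) = (G' r : ℂ) * H r + G r * H' r := by
      simp only [hP]
      push_cast at hh' ⊢
      linear_combination ((G' r : ℂ) * H r + G r * H' r) * hh'
    have := dZ_algebra (e := e r) (P' := P' r) hlc hh' hPc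
    simp only [Pi.add_apply, Pi.mul_apply, hH, hH'] at this ⊢
    push_cast at this ⊢
    exact this
  have cint : ∀ F : ℝ → ℂ, ContinuousOn F (Set.Ici 4) → IntervalIntegrable F volume 4 R :=
    fun F hF => (hF.mono fun r hr => hr.1).intervalIntegrable_of_Icc hR
  have ce : ContinuousOn e (Set.Ici 4) := fun r hr => (de r hr).continuousAt.continuousWithinAt
  have i1 : IntervalIntegrable (fun r => e r * (G r : ℂ)) volume 4 R :=
    cint _ (ce.mul (Complex.continuous_ofReal.comp_continuousOn fun r hr =>
      (hG r hr).continuousAt.continuousWithinAt))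
  have i2 : IntervalIntegrable (fun r => 1 / (l : ℂ) ^ 2 * (e r * (P' r : ℂ))) volume 4 R :=
    cint _ (continuousOn_const.mul (ce.mul (Complex.continuous_ofReal.comp_continuousOn cP')))
  have key := intervalIntegral.integral_eq_sub_of_hasDerivAt (a := 4) (b := R) (f := Z)
    (fun r hr => dZ r (by rw [Set.uIcc_of_le hR] at hr; exact hr.1)) (i1.add i2)
  rw [intervalIntegral.integral_add i1 i2, intervalIntegral.integral_const_mul] at key
  have hZ4 : Z 4 = 0 := by simp [hZ, hP, z0, z1]
  have hsR : 0 < √R := Real.sqrt_pos.2 (by linarith)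
  have hZR : ‖Z R‖ ≤ 2000 * N * (1 / √R) := by
    obtain ⟨-, -, -, e0, -, -⟩ := hb R hR
    simp only [hZ]
    rw [norm_mul, ne1, one_mul]
    have hl2 : 1 / l ≤ 2 := by rw [div_le_iff₀ hl0]; linarith
    calc _ ≤ ‖Complex.I / l * ((G R * H R : ℝ) : ℂ)‖ + ‖1 / (l : ℂ) ^ 2 * (P R : ℂ)‖ :=
          norm_add_le _ _
      _ = (1 / l) * (|G R| * |H R|) + (1 / l) ^ 2 * |P R| := by
          rw [norm_mul, norm_mul, norm_div, norm_div, norm_pow, Complex.norm_I, norm_one,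
            Complex.norm_real, Complex.norm_real, Complex.norm_real, Real.norm_eq_abs,
            Real.norm_eq_abs, Real.norm_eq_abs, abs_of_pos hl0, abs_mul]
          ring
      _ ≤ 2 * (N / √R * 6) + 2 ^ 2 * (336 * N / √R) := by
          have := b0 R hR
          have := bP R hR
          gcongr
      _ = 1356 * (N * (1 / √R)) := by ring
      _ ≤ 2000 * (N * (1 / √R)) := by gcongr; norm_num
      _ = _ := by ring
  have hint : ‖∫ r in 4..R, e r * (P' r : ℂ)‖ ≤ 10036 * N := by
    have i3 : IntervalIntegrable (fun r : ℝ => 10036 * N / r ^ 2) volume 4 R := by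
      refine ContinuousOn.intervalIntegrable_of_Icc hR
        (continuousOn_const.div (by fun_prop) fun r hr => ?_)
      have : 0 < r := by linarith [hr.1]
      positivity
    refine (intervalIntegral.norm_integral_le_of_norm_le hR
      (g := fun r => 10036 * N / r ^ 2) (Filter.Eventually.of_forall fun r hr => ?_) i3).trans ?_
    · rw [norm_mul, ne1, one_mul, Complex.norm_real]
      exact bP' r hr.1.le
    · rw [intervalIntegral.integral_eq_sub_of_hasDerivAt (f := fun r => -(10036 * N / r))
        (fun r hr => ?_) i3]
      · have : 0 ≤ 10036 * N / R := by positivity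
        linarith
      · rw [Set.uIcc_of_le hR] at hr
        have : 0 < r := by linarith [hr.1]
        refine ((hasDerivAt_const r (10036 * N)).div (hasDerivAt_id r) this.ne').neg.congr_deriv ?_
        simp only [id_eq]
        ring
  have : ∫ r in 4..R, e r * (G r : ℂ) = Z R - 1 / (l : ℂ) ^ 2 * ∫ r in 4..R, e r * (P' r : ℂ) := by
    rw [hZ4, sub_zero] at key
    rw [← key]; ring
  rw [this]
  refine (norm_sub_le _ _).trans ?_
  have hn : ‖1 / (l : ℂ) ^ 2 * ∫ r in 4..R, e r * (P' r : ℂ)‖ =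
      1 / l ^ 2 * ‖∫ r in 4..R, e r * (P' r : ℂ)‖ := by
    rw [norm_mul, norm_div, norm_pow, norm_one, Complex.norm_real, Real.norm_eq_abs,
      abs_of_pos hl0]
  rw [hn]
  calc _ ≤ 2000 * N * (1 / √R) + 1 / l ^ 2 * (10036 * N) := by gcongr
    _ ≤ 100000 * N * (1 / √R) + 1 / l ^ 2 * (100000 * N) := by gcongr <;> norm_num
    _ = _ := by ring

/-! ### Truncated Fresnel integrals -/

theorem continuous_cexp_neg_mul_sq (b : ℂ) :
    Continuous fun y : ℝ => Complex.exp (-b * (y : ℂ) ^ 2) := by fun_prop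

theorem norm_cexp_neg_mul_sq_le {b : ℂ} (hb : 0 ≤ b.re) (y : ℝ) :
    ‖Complex.exp (-b * (y : ℂ) ^ 2)‖ ≤ 1 := by
  rw [Complex.norm_exp]
  refine Real.exp_le_one_iff.2 ?_
  rw [← Complex.ofReal_pow, Complex.re_mul_ofReal, Complex.neg_re]
  nlinarith [sq_nonneg y]

theorem norm_integral_gaussian_tail_le {b : ℂ} (hb : 0 ≤ b.re) (hb0 : b ≠ 0) {Y Z : ℝ}
    (hY : 0 < Y) (hYZ : Y ≤ Z) :
    ‖∫ y in Y..Z, Complex.exp (-b * (y : ℂ) ^ 2)‖ ≤ 1 / (‖b‖ * Y) := by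
  have hbn : 0 < ‖b‖ := norm_pos_iff.2 hb0
  have hZ : 0 < Z := hY.trans_le hYZ
  set F : ℝ → ℂ := fun y => -(Complex.exp (-b * (y : ℂ) ^ 2) / (2 * b * y)) with hF
  have dF : ∀ y ∈ Set.uIcc Y Z, HasDerivAt F (Complex.exp (-b * (y : ℂ) ^ 2) +
      Complex.exp (-b * (y : ℂ) ^ 2) / (2 * b * (y : ℂ) ^ 2)) y := by
    intro y hy
    rw [Set.uIcc_of_le hYZ] at hy
    have hy0 : (y : ℂ) ≠ 0 := by exact_mod_cast (hY.trans_le hy.1).ne'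
    have d1 : HasDerivAt (fun z : ℂ => -(Complex.exp (-b * z ^ 2) / (2 * b * z)))
        (Complex.exp (-b * (y : ℂ) ^ 2) +
          Complex.exp (-b * (y : ℂ) ^ 2) / (2 * b * (y : ℂ) ^ 2)) (y : ℂ) := by
      refine (((((hasDerivAt_pow 2 (y : ℂ)).const_mul (-b)).cexp).div
        ((hasDerivAt_id (y : ℂ)).const_mul (2 * b))
        (mul_ne_zero (mul_ne_zero two_ne_zero hb0) hy0)).neg).congr_deriv ?_
      simp only [id_eq]
      norm_num
      field_simp
      ring
    exact d1.comp_ofReal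
  have i1 : IntervalIntegrable (fun y : ℝ => Complex.exp (-b * (y : ℂ) ^ 2)) volume Y Z :=
    (continuous_cexp_neg_mul_sq b).intervalIntegrable _ _
  have i2 : IntervalIntegrable (fun y : ℝ => Complex.exp (-b * (y : ℂ) ^ 2) /
      (2 * b * (y : ℂ) ^ 2)) volume Y Z := by
    refine ContinuousOn.intervalIntegrable_of_Icc hYZ
      ((continuous_cexp_neg_mul_sq b).continuousOn.div (by fun_prop) fun y hy => ?_)
    have : (y : ℂ) ≠ 0 := by exact_mod_cast (hY.trans_le hy.1).ne'
    exact mul_ne_zero (mul_ne_zero two_ne_zero hb0) (pow_ne_zero _ this)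
  have i3 : IntervalIntegrable (fun y : ℝ => 1 / (2 * ‖b‖) / y ^ 2) volume Y Z := by
    refine ContinuousOn.intervalIntegrable_of_Icc hYZ
      (continuousOn_const.div (by fun_prop) fun y hy => ?_)
    exact pow_ne_zero _ (hY.trans_le hy.1).ne'
  have key := intervalIntegral.integral_eq_sub_of_hasDerivAt dF (i1.add i2)
  rw [intervalIntegral.integral_add i1 i2] at key
  have hFn : ∀ y, 0 < y → ‖F y‖ ≤ 1 / (2 * ‖b‖ * y) := by
    intro y hy
    simp only [hF]
    rw [norm_neg, norm_div, norm_mul, norm_mul, Complex.norm_real, Real.norm_eq_abs, abs_of_pos hy,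
      Complex.norm_ofNat]
    gcongr
    exact norm_cexp_neg_mul_sq_le hb y
  have hI : ‖∫ y in Y..Z, Complex.exp (-b * (y : ℂ) ^ 2) / (2 * b * (y : ℂ) ^ 2)‖ ≤
      1 / (2 * ‖b‖) * (1 / Y - 1 / Z) := by
    refine (intervalIntegral.norm_integral_le_of_norm_le hYZ
      (Filter.Eventually.of_forall fun y hy => ?_) i3).trans_eq ?_
    · rw [norm_div, norm_mul, norm_mul, norm_pow, Complex.norm_real, Real.norm_eq_abs, sq_abs,
        Complex.norm_ofNat, div_div]
      have : 0 < y := hY.trans hy.1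
      gcongr
      exact norm_cexp_neg_mul_sq_le hb y
    · rw [intervalIntegral.integral_eq_sub_of_hasDerivAt
        (f := fun y => -(1 / (2 * ‖b‖) / y)) (fun y hy => ?_) i3]
      · ring
      · rw [Set.uIcc_of_le hYZ] at hy
        refine ((hasDerivAt_const y (1 / (2 * ‖b‖))).div (hasDerivAt_id y)
          (hY.trans_le hy.1).ne').neg.congr_deriv ?_
        simp only [id_eq]
        ring
  rw [eq_sub_of_add_eq key]
  calc _ ≤ ‖F Z‖ + ‖F Y‖ + 1 / (2 * ‖b‖) * (1 / Y - 1 / Z) :=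
        (norm_sub_le _ _).trans (add_le_add (norm_sub_le _ _) hI)
    _ ≤ 1 / (2 * ‖b‖ * Z) + 1 / (2 * ‖b‖ * Y) + 1 / (2 * ‖b‖) * (1 / Y - 1 / Z) := by
        gcongr
        · exact hFn Z hZ
        · exact hFn Y hY
    _ = _ := by field_simp; ring

theorem norm_integral_gaussian_sub_le {b : ℂ} (hb : 0 ≤ b.re) (hb0 : b ≠ 0) {Y Z : ℝ}
    (hY : 0 < Y) (hYZ : Y ≤ Z) :
    ‖(∫ y in -Z..Z, Complex.exp (-b * (y : ℂ) ^ 2)) -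
      ∫ y in -Y..Y, Complex.exp (-b * (y : ℂ) ^ 2)‖ ≤ 2 / (‖b‖ * Y) := by
  have hi : ∀ u v, IntervalIntegrable (fun y : ℝ => Complex.exp (-b * (y : ℂ) ^ 2)) volume u v :=
    fun u v => (continuous_cexp_neg_mul_sq b).intervalIntegrable _ _
  have h1 : ∫ y in -Z..-Y, Complex.exp (-b * (y : ℂ) ^ 2) =
      ∫ y in Y..Z, Complex.exp (-b * (y : ℂ) ^ 2) := by
    rw [← intervalIntegral.integral_comp_neg]
    simp
  rw [← intervalIntegral.integral_add_adjacent_intervals (hi (-Z) Y) (hi Y Z),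
    ← intervalIntegral.integral_add_adjacent_intervals (hi (-Z) (-Y)) (hi (-Y) Y), h1]
  have := norm_integral_gaussian_tail_le hb hb0 hY hYZ
  rw [show ∀ u v : ℂ, u + v + u - v = u + u by intros; ring]
  calc _ ≤ 1 / (‖b‖ * Y) + 1 / (‖b‖ * Y) := (norm_add_le _ _).trans (add_le_add this this)
    _ = _ := by ring

theorem norm_integral_gaussian_sub_cpow_le {b : ℂ} (hb : 0 < b.re) {Y : ℝ} (hY : 0 < Y) :
    ‖((π : ℂ) / b) ^ (1 / 2 : ℂ) - ∫ y in -Y..Y, Complex.exp (-b * (y : ℂ) ^ 2)‖ ≤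
      2 / (‖b‖ * Y) := by
  have hb0 : b ≠ 0 := fun h => by simp [h] at hb
  have h1 : Filter.Tendsto (fun Z : ℝ => ∫ y in -Z..Z, Complex.exp (-b * (y : ℂ) ^ 2))
      Filter.atTop (nhds (((π : ℂ) / b) ^ (1 / 2 : ℂ))) := by
    rw [← integral_gaussian_complex hb]
    exact intervalIntegral_tendsto_integral (integrable_cexp_neg_mul_sq hb)
      Filter.tendsto_neg_atTop_atBot Filter.tendsto_id
  refine le_of_tendsto ((h1.sub_const _).norm) ?_
  filter_upwards [Filter.eventually_ge_atTop Y] with Z hZ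
  exact norm_integral_gaussian_sub_le hb.le hb0 hY hZ

/-- The value of the complete Fresnel integral `∫ e^{-iλy²} dy`. -/
def fresnel (l : ℝ) : ℂ := ((π : ℂ) / (Complex.I * l)) ^ (1 / 2 : ℂ)

theorem norm_fresnel {l : ℝ} (hl : 0 < l) : ‖fresnel l‖ = √(π / l) := by
  unfold fresnel
  rw [show (1 / 2 : ℂ) = ((1 / 2 : ℝ) : ℂ) by norm_num, Complex.norm_cpow_real, Real.sqrt_eq_rpow]
  simp [abs_of_pos hl, abs_of_pos Real.pi_pos]

theorem norm_fresnel_sub_le {l Y : ℝ} (hl : 0 < l) (hY : 0 < Y) :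
    ‖fresnel l - ∫ y in -Y..Y, Complex.exp (Complex.I * ((-(l * y ^ 2) : ℝ) : ℂ))‖ ≤
      2 / (l * Y) := by
  set b : ℝ → ℂ := fun e => e + Complex.I * l with hb
  have hb0 : b 0 = Complex.I * l := by simp [hb]
  have hbc : Continuous b := by fun_prop
  have hslit : (π : ℂ) / b 0 ∈ Complex.slitPlane := by
    rw [hb0, Complex.mem_slitPlane_iff]
    right
    rw [show (π : ℂ) / (Complex.I * l) = ((-(π / l) : ℝ) : ℂ) * Complex.I by
      have : (l : ℂ) ≠ 0 := by exact_mod_cast hl.ne'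
      push_cast
      field_simp
      rw [Complex.I_sq]
      ring]
    rw [Complex.im_ofReal_mul, Complex.I_im, mul_one]
    have : 0 < π / l := by positivity
    linarith
  have hb0' : b 0 ≠ 0 := by
    rw [hb0]
    exact mul_ne_zero Complex.I_ne_zero (by exact_mod_cast hl.ne')
  have c1 : ContinuousAt (fun e => ((π : ℂ) / b e) ^ (1 / 2 : ℂ)) 0 :=
    (continuousAt_const.div hbc.continuousAt hb0').cpow continuousAt_const hslit
  have c2 : Continuous fun e => ∫ y in -Y..Y, Complex.exp (-b e * (y : ℂ) ^ 2) :=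
    intervalIntegral.continuous_parametric_intervalIntegral_of_continuous' (by fun_prop) _ _
  have h1 := ((c1.sub c2.continuousAt).norm.tendsto).mono_left
    (nhdsWithin_le_nhds (s := Set.Ioi (0 : ℝ)))
  have h2 : fresnel l - ∫ y in -Y..Y, Complex.exp (Complex.I * ((-(l * y ^ 2) : ℝ) : ℂ)) =
      ((π : ℂ) / b 0) ^ (1 / 2 : ℂ) - ∫ y in -Y..Y, Complex.exp (-b 0 * (y : ℂ) ^ 2) := by
    rw [hb0, fresnel]
    congr 2
    ext y
    push_cast
    ring_nf
  rw [h2]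
  refine le_of_tendsto h1 ?_
  filter_upwards [self_mem_nhdsWithin] with e he
  have hre : (b e).re = e := by simp [hb]
  have him : (b e).im = l := by simp [hb]
  refine (norm_integral_gaussian_sub_cpow_le (by rw [hre]; exact he) hY).trans ?_
  gcongr
  have := Complex.abs_im_le_norm (b e)
  rwa [him, abs_of_pos hl] at this

/-! ### Smooth cutoffs and the reduction of the propagator to an integral over a compact range -/

/-- A smooth step from `0` on `(-∞, 4]` to `1` on `[5, ∞)`. -/
def cut (r : ℝ) : ℝ := Real.smoothTransition (r - 4)

theorem cut_eq_zero {r : ℝ} (h : r ≤ 4) : cut r = 0 :=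
  Real.smoothTransition.zero_of_nonpos (by linarith)

theorem cut_eq_one {r : ℝ} (h : 5 ≤ r) : cut r = 1 :=
  Real.smoothTransition.one_of_one_le (by linarith)

theorem abs_cut_le_one (r : ℝ) : |cut r| ≤ 1 := by
  have h : 0 ≤ cut r := Real.smoothTransition.nonneg _
  rw [abs_of_nonneg h]
  exact Real.smoothTransition.le_one _

theorem contDiff_cut {n : ℕ} : ContDiff ℝ n cut :=
  Real.smoothTransition.contDiff.comp (contDiff_id.sub contDiff_const)

theorem deriv_cut_eq_zero {r : ℝ} (h : r ≤ 4 ∨ 5 ≤ r) : deriv cut r = 0 := by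
  rcases h with h | h
  · refine IsLocalMin.deriv_eq_zero (Filter.Eventually.of_forall fun y => ?_)
    rw [cut_eq_zero h]
    exact Real.smoothTransition.nonneg _
  · refine IsLocalMax.deriv_eq_zero (Filter.Eventually.of_forall fun y => ?_)
    rw [cut_eq_one h]
    exact Real.smoothTransition.le_one _

theorem hasDerivAt_cut (r : ℝ) : HasDerivAt cut (deriv cut r) r :=
  ((contDiff_cut (n := 1)).differentiable (by norm_num) r).hasDerivAt

theorem contDiff_deriv_cut : ContDiff ℝ 1 (deriv cut) := by
  have := contDiff_cut (n := 2)
  rw [show ((2 : ℕ) : WithTop ℕ∞) = 1 + 1 by norm_num] at this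
  exact (contDiff_succ_iff_deriv.1 this).2.2

theorem hasDerivAt_deriv_cut (r : ℝ) : HasDerivAt (deriv cut) (deriv (deriv cut) r) r :=
  (contDiff_deriv_cut.differentiable (by norm_num) r).hasDerivAt

theorem exists_cut_bound : ∃ S : ℝ, 1 ≤ S ∧ (∀ r, |deriv cut r| ≤ S) ∧
    (∀ r, 4 ≤ r → |deriv cut r| ≤ 5 * S / r) ∧
    (∀ r, 4 ≤ r → |deriv (deriv cut) r| ≤ 25 * S / r ^ 2) := by
  have c1 : Continuous (deriv cut) := contDiff_deriv_cut.continuous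
  have c2 : Continuous (deriv (deriv cut)) := contDiff_deriv_cut.continuous_deriv le_rfl
  obtain ⟨S₁, h₁⟩ := isCompact_Icc.exists_bound_of_continuousOn (s := Set.Icc (4 : ℝ) 5)
    c1.continuousOn
  obtain ⟨S₂, h₂⟩ := isCompact_Icc.exists_bound_of_continuousOn (s := Set.Icc (4 : ℝ) 5)
    c2.continuousOn
  have hS : 1 ≤ max 1 (max S₁ S₂) := le_max_left _ _
  have hS0 : 0 < max 1 (max S₁ S₂) := by linarith
  have b1 : ∀ r ∈ Set.Icc (4 : ℝ) 5, |deriv cut r| ≤ max 1 (max S₁ S₂) := fun r hr =>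
    (h₁ r hr).trans ((le_max_left _ _).trans (le_max_right _ _))
  have b2 : ∀ r ∈ Set.Icc (4 : ℝ) 5, |deriv (deriv cut) r| ≤ max 1 (max S₁ S₂) := fun r hr =>
    (h₂ r hr).trans ((le_max_right _ _).trans (le_max_right _ _))
  refine ⟨max 1 (max S₁ S₂), hS, fun r => ?_, fun r hr => ?_, fun r hr => ?_⟩
  · by_cases h : r ∈ Set.Icc (4 : ℝ) 5
    · exact b1 r h
    · rw [deriv_cut_eq_zero, abs_zero]
      · exact hS0.le
      · rw [Set.mem_Icc, not_and_or] at h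
        exact h.imp (fun h => (not_le.1 h).le) fun h => (not_le.1 h).le
  · rcases le_or_gt r 5 with h | h
    · refine (b1 r ⟨hr, h⟩).trans ?_
      rw [le_div_iff₀ (by linarith)]
      nlinarith
    · rw [deriv_cut_eq_zero (Or.inr h.le), abs_zero]
      have : 0 < r := by linarith
      positivity
  · rcases le_or_gt r 5 with h | h
    · refine (b2 r ⟨hr, h⟩).trans ?_
      have : 0 < r := by linarith
      rw [le_div_iff₀ (by positivity)]
      nlinarith [mul_le_mul h h this.le (by norm_num)]
    · have : deriv (deriv cut) r = 0 := by
        have : deriv cut =ᶠ[nhds r] fun _ => 0 := by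
          filter_upwards [lt_mem_nhds h] with y hy
          exact deriv_cut_eq_zero (Or.inr hy.le)
        rw [this.deriv_eq, deriv_const]
      rw [this, abs_zero]
      have : 0 < r := by linarith
      positivity

/-- The phase factor `e^{-i l (E₁ r + E₂ / r)}`. -/
def ph (l E₁ E₂ r : ℝ) : ℂ := Complex.exp (Complex.I * ((-(l * (E₁ * r + E₂ / r)) : ℝ) : ℂ))

/-- The weight `r^{-1/2}`. -/
def wHalf (r : ℝ) : ℝ := 1 / √r

/-- The weight `r^{-3/2}`. -/
def wThree (r : ℝ) : ℝ := 1 / (r * √r)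

theorem hasDerivAt_wHalf {r : ℝ} (hr : 0 < r) :
    HasDerivAt wHalf (-(1 / 2) * wThree r) r := by
  have hs := Real.sqrt_pos.2 hr
  refine ((hasDerivAt_const r (1 : ℝ)).div (Real.hasDerivAt_sqrt hr.ne') hs.ne').congr_deriv ?_
  unfold wThree
  have h2 : √r ^ 2 = r := Real.sq_sqrt hr.le
  rw [h2]
  field_simp
  ring

theorem hasDerivAt_wThree {r : ℝ} (hr : 0 < r) :
    HasDerivAt wThree (-(3 / 2) * (wThree r / r)) r := by
  have hs := Real.sqrt_pos.2 hr
  refine ((hasDerivAt_const r (1 : ℝ)).div ((hasDerivAt_id r).mul (Real.hasDerivAt_sqrt hr.ne'))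
    (mul_pos hr hs).ne').congr_deriv ?_
  unfold wThree
  have h2 : √r ^ 2 = r := Real.sq_sqrt hr.le
  simp only [id_eq, Pi.mul_apply]
  field_simp
  rw [h2]
  ring

theorem norm_integral_cut_le_of_weight {f f' f'' : ℝ → ℝ} {S : ℝ} (hS : 1 ≤ S)
    (s1 : ∀ r, 4 ≤ r → |deriv cut r| ≤ 5 * S / r)
    (s2 : ∀ r, 4 ≤ r → |deriv (deriv cut) r| ≤ 25 * S / r ^ 2)
    (hf : ∀ r, 4 ≤ r → HasDerivAt f (f' r) r) (hf' : ∀ r, 4 ≤ r → HasDerivAt f' (f'' r) r)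
    (hf''c : ContinuousOn f'' (Set.Ici 4))
    (b0 : ∀ r, 4 ≤ r → |f r| ≤ 1 / √r) (b1 : ∀ r, 4 ≤ r → |f' r| ≤ 2 / r)
    (b2 : ∀ r, 4 ≤ r → |f'' r| ≤ 4 / r ^ 2)
    {E₁ E₂ l R : ℝ} (h₁ : 1 ≤ E₁) (h₂ : 1 ≤ E₂) (h₂' : E₂ ≤ 13) (hl : 1 / 2 ≤ l)
    (hR : 4 ≤ R) :
    ‖∫ r in 4..R, ph l E₁ E₂ r * ((cut r * f r : ℝ) : ℂ)‖ ≤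
      100000 * (49 * S) * (1 / l ^ 2 + 1 / √R) := by
  have fb : ∀ r, 4 ≤ r → |f r| ≤ 1 := fun r hr => (b0 r hr).trans
    ((div_le_one (Real.sqrt_pos.2 (by linarith))).2 (Real.one_le_sqrt.2 (by linarith)))
  refine norm_integral_tail_le (G := fun r => cut r * f r)
    (G' := fun r => deriv cut r * f r + cut r * f' r)
    (G'' := fun r => (deriv (deriv cut) r * f r + deriv cut r * f' r) +
      (deriv cut r * f' r + cut r * f'' r))
    (fun r hr => (hasDerivAt_cut r).mul (hf r hr))
    (fun r hr => ((hasDerivAt_deriv_cut r).mul (hf r hr)).add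
      ((hasDerivAt_cut r).mul (hf' r hr))) ?_ ?_ ?_ ?_ ?_ ?_ h₁ h₂ h₂' hl hR
  · have c0 : ContinuousOn f (Set.Ici 4) := fun r hr => (hf r hr).continuousAt.continuousWithinAt
    have c1 : ContinuousOn f' (Set.Ici 4) := fun r hr => (hf' r hr).continuousAt.continuousWithinAt
    have c2 : Continuous cut := (contDiff_cut (n := 0)).continuous
    have c3 : Continuous (deriv cut) := contDiff_deriv_cut.continuous
    have c4 : Continuous (deriv (deriv cut)) := contDiff_deriv_cut.continuous_deriv le_rfl
    fun_prop
  · intro r hr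
    rw [abs_mul]
    calc _ ≤ 1 * (1 / √r) := by
          gcongr
          · exact abs_cut_le_one r
          · exact b0 r hr
      _ ≤ 49 * S * (1 / √r) := by gcongr; linarith
      _ = _ := by ring
  · intro r hr
    have hr0 : 0 < r := by linarith
    calc _ ≤ |deriv cut r| * |f r| + |cut r| * |f' r| := by
          refine (abs_add_le _ _).trans_eq ?_
          rw [abs_mul, abs_mul]
      _ ≤ 5 * S / r * 1 + 1 * (2 / r) := by
          have := s1 r hr
          have := fb r hr
          have := b1 r hr
          have := abs_cut_le_one r
          gcongr
      _ = (5 * S + 2) / r := by ring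
      _ ≤ _ := by gcongr; linarith
  · intro r hr
    have hr0 : 0 < r := by linarith
    calc _ ≤ |deriv (deriv cut) r| * |f r| + |deriv cut r| * |f' r| +
          (|deriv cut r| * |f' r| + |cut r| * |f'' r|) := by
          refine (abs_add_le _ _).trans (add_le_add ((abs_add_le _ _).trans_eq ?_)
            ((abs_add_le _ _).trans_eq ?_)) <;> rw [abs_mul, abs_mul]
      _ ≤ 25 * S / r ^ 2 * 1 + 5 * S / r * (2 / r) + (5 * S / r * (2 / r) + 1 * (4 / r ^ 2)) := by
          have := s1 r hr
          have := s2 r hr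
          have := fb r hr
          have := b1 r hr
          have := b2 r hr
          have := abs_cut_le_one r
          gcongr
      _ = (45 * S + 4) / r ^ 2 := by field_simp; ring
      _ ≤ _ := by gcongr; linarith
  · simp [cut_eq_zero]
  · simp [cut_eq_zero, deriv_cut_eq_zero]

theorem exists_norm_integral_cut_le : ∃ K : ℝ, 0 < K ∧ ∀ E₁ E₂ l R : ℝ, 1 ≤ E₁ → 1 ≤ E₂ →
    E₂ ≤ 13 → 1 / 2 ≤ l → 4 ≤ R →
    ‖∫ r in 4..R, ph l E₁ E₂ r * ((cut r * wHalf r : ℝ) : ℂ)‖ ≤ K * (1 / l ^ 2 + 1 / √R) ∧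
    ‖∫ r in 4..R, ph l E₁ E₂ r * ((cut r * wThree r : ℝ) : ℂ)‖ ≤ K * (1 / l ^ 2 + 1 / √R) := by
  obtain ⟨S, hS, -, s1, s2⟩ := exists_cut_bound
  refine ⟨100000 * (49 * S), by positivity, fun E₁ E₂ l R h₁ h₂ h₂' hl hR => ?_⟩
  have w3 : ∀ r : ℝ, 4 ≤ r → 0 < r ∧ 0 ≤ wThree r ∧ wThree r ≤ 1 / r ∧ wThree r ≤ 1 / √r := by
    intro r hr
    have hr0 : 0 < r := by linarith
    have hs1 : 1 ≤ √r := Real.one_le_sqrt.2 (by linarith)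
    unfold wThree
    refine ⟨hr0, by positivity, ?_, ?_⟩
    · apply one_div_le_one_div_of_le hr0
      nlinarith
    · apply one_div_le_one_div_of_le (by linarith)
      nlinarith
  have d3 : ∀ r : ℝ, 4 ≤ r → HasDerivAt (fun r => wThree r / r)
      (-(5 / 2) * (wThree r / r ^ 2)) r := by
    intro r hr
    have hr0 := (w3 r hr).1
    refine ((hasDerivAt_wThree hr0).div (hasDerivAt_id r) hr0.ne').congr_deriv ?_
    simp only [id_eq]
    field_simp
    ring
  have c3 : ContinuousOn wThree (Set.Ici 4) := fun r hr =>
    (hasDerivAt_wThree (w3 r hr).1).continuousAt.continuousWithinAt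
  constructor
  · refine norm_integral_cut_le_of_weight hS s1 s2
      (f := wHalf) (f' := fun r => -(1 / 2) * wThree r)
      (f'' := fun r => -(1 / 2) * (-(3 / 2) * (wThree r / r)))
      (fun r hr => hasDerivAt_wHalf (w3 r hr).1)
      (fun r hr => (hasDerivAt_wThree (w3 r hr).1).const_mul _) ?_ ?_ ?_ ?_ h₁ h₂ h₂' hl hR
    · exact continuousOn_const.mul (continuousOn_const.mul
        (c3.div continuousOn_id fun r hr => (w3 r hr).1.ne'))
    · intro r hr
      unfold wHalf
      rw [abs_of_nonneg (by positivity)]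
    · intro r hr
      obtain ⟨h0, h1, h2, -⟩ := w3 r hr
      rw [abs_mul, abs_of_nonneg h1, abs_neg, abs_of_pos (by norm_num : (0 : ℝ) < 1 / 2)]
      calc _ ≤ 1 * (1 / r) := by gcongr; norm_num
        _ ≤ _ := by rw [one_mul]; gcongr; norm_num
    · intro r hr
      obtain ⟨h0, h1, h2, -⟩ := w3 r hr
      have : -(1 / 2) * (-(3 / 2) * (wThree r / r)) = 3 / 4 * (wThree r / r) := by ring
      rw [this, abs_of_nonneg (by positivity)]
      calc _ ≤ 4 * (1 / r / r) := by gcongr; norm_num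
        _ = _ := by field_simp
  · refine norm_integral_cut_le_of_weight hS s1 s2
      (f := wThree) (f' := fun r => -(3 / 2) * (wThree r / r))
      (f'' := fun r => -(3 / 2) * (-(5 / 2) * (wThree r / r ^ 2)))
      (fun r hr => hasDerivAt_wThree (w3 r hr).1)
      (fun r hr => (d3 r hr).const_mul _) ?_ ?_ ?_ ?_ h₁ h₂ h₂' hl hR
    · exact continuousOn_const.mul (continuousOn_const.mul
        (c3.div (by fun_prop) fun r hr => pow_ne_zero 2 (w3 r hr).1.ne'))
    · intro r hr
      obtain ⟨h0, h1, -, h2⟩ := w3 r hr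
      rwa [abs_of_nonneg h1]
    · intro r hr
      obtain ⟨h0, h1, h2, -⟩ := w3 r hr
      have hp : 0 ≤ wThree r / r := by positivity
      rw [abs_mul, abs_of_nonneg hp, abs_neg,
        abs_of_pos (by norm_num : (0 : ℝ) < 3 / 2)]
      calc _ ≤ 2 * (1 / r / 1) := by gcongr; norm_num; linarith
        _ = _ := by ring
    · intro r hr
      obtain ⟨h0, h1, h2, -⟩ := w3 r hr
      have : -(3 / 2) * (-(5 / 2) * (wThree r / r ^ 2)) = 15 / 4 * (wThree r / r ^ 2) := by ring
      rw [this, abs_of_nonneg (by positivity)]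
      calc _ ≤ 4 * (1 / r / r ^ 2) := by gcongr; norm_num
        _ = 4 / r ^ 2 * (1 / r) := by field_simp
        _ ≤ 4 / r ^ 2 * 1 := by
          gcongr
          rw [div_le_one h0]
          linarith
        _ = _ := mul_one _

theorem continuousOn_ph (l E₁ E₂ : ℝ) : ContinuousOn (ph l E₁ E₂) (Set.Ioi 0) := by
  have : ContinuousOn (fun r : ℝ => -(l * (E₁ * r + E₂ / r))) (Set.Ioi 0) := by
    refine (continuousOn_const.mul ((continuousOn_const.mul continuousOn_id).add
      (continuousOn_const.div continuousOn_id fun r hr => ?_))).neg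
    exact (Set.mem_Ioi.1 hr).ne'
  exact (continuousOn_const.mul (Complex.continuous_ofReal.comp_continuousOn this)).cexp

theorem continuousOn_wHalf : ContinuousOn wHalf (Set.Ioi 0) := fun _ hr =>
  (hasDerivAt_wHalf hr).continuousAt.continuousWithinAt

theorem continuousOn_wThree : ContinuousOn wThree (Set.Ioi 0) := fun _ hr =>
  (hasDerivAt_wThree hr).continuousAt.continuousWithinAt

theorem intervalIntegrable_ph_mul {l E₁ E₂ α β : ℝ} {f : ℝ → ℝ} (hf : ContinuousOn f (Set.Ioi 0))
    (hα : 0 < α) (hβ : 0 < β) :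
    IntervalIntegrable (fun r => ph l E₁ E₂ r * (f r : ℂ)) volume α β := by
  refine ContinuousOn.intervalIntegrable (((continuousOn_ph l E₁ E₂).mul
    (Complex.continuous_ofReal.comp_continuousOn hf)).mono fun r hr => ?_)
  exact (lt_min hα hβ).trans_le hr.1

theorem integral_ph_subst {l s ε α β : ℝ} (hε : ε ^ 2 = 1) (hα : 0 < α) (hβ : 0 < β) :
    ∫ r in α..β, ph l (s ^ 2) 1 r * ((1 / 2 * (s * wHalf r + ε * wThree r) : ℝ) : ℂ) =
      Complex.exp (Complex.I * ((-(2 * l * ε * s) : ℝ) : ℂ)) *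
        ∫ y in (s * √α - ε * (1 / √α))..(s * √β - ε * (1 / √β)),
          Complex.exp (Complex.I * ((-(l * y ^ 2) : ℝ) : ℂ)) := by
  have hpos : ∀ r ∈ Set.uIcc α β, 0 < r := fun r hr => (lt_min hα hβ).trans_le hr.1
  have hd : ∀ r ∈ Set.uIcc α β, HasDerivAt (fun r => s * √r - ε * wHalf r)
      (1 / 2 * (s * wHalf r + ε * wThree r)) r := by
    intro r hr
    have := hpos r hr
    refine (((Real.hasDerivAt_sqrt this.ne').const_mul s).sub
      ((hasDerivAt_wHalf this).const_mul ε)).congr_deriv ?_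
    unfold wHalf
    field_simp
    ring
  have key := intervalIntegral.integral_deriv_smul_comp
    (g := fun y : ℝ => Complex.exp (Complex.I * ((-(l * y ^ 2) : ℝ) : ℂ))) hd ?_ (by fun_prop)
  · change _ = ∫ y in (s * √α - ε * wHalf α)..(s * √β - ε * wHalf β), _ at key
    change _ = _ * ∫ y in (s * √α - ε * wHalf α)..(s * √β - ε * wHalf β), _
    rw [← key, ← intervalIntegral.integral_const_mul]
    refine intervalIntegral.integral_congr fun r hr => ?_
    have hr0 := hpos r hr
    have hs := Real.sqrt_pos.2 hr0
    have h2 : √r ^ 2 = r := Real.sq_sqrt hr0.le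
    have e1 : -(l * (s ^ 2 * r + 1 / r)) =
        -(2 * l * ε * s) + -(l * (s * √r - ε * wHalf r) ^ 2) := by
      have : (s * √r - ε * wHalf r) ^ 2 = s ^ 2 * √r ^ 2 - 2 * ε * s + ε ^ 2 / √r ^ 2 := by
        unfold wHalf
        field_simp
        ring
      rw [this, h2, hε]
      ring
    simp only [ph, Function.comp_apply, Complex.real_smul]
    rw [e1, Complex.ofReal_add, mul_add, Complex.exp_add]
    ring
  · have h0 : Set.uIcc α β ⊆ Set.Ioi 0 := hpos
    have c1 := continuousOn_wHalf.mono h0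
    have c2 := continuousOn_wThree.mono h0
    fun_prop

/-- The truncated Fresnel integral bounds appearing after the substitution. -/
theorem integral_ph_eq {l s R : ℝ} (hs : 0 < s) (hR : 0 < R) :
    (∫ r in (1 / (s * R))..(R / s), ph l (s ^ 2) 1 r * (wThree r : ℂ) =
      Complex.exp (Complex.I * ((-(2 * l * s) : ℝ) : ℂ)) *
        ∫ y in (-(√s * (√R - 1 / √R)))..(√s * (√R - 1 / √R)),
          Complex.exp (Complex.I * ((-(l * y ^ 2) : ℝ) : ℂ))) ∧
    (s : ℂ) * ∫ r in (1 / (s * R))..(R / s), ph l (s ^ 2) 1 r * (wHalf r : ℂ) =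
      ∫ r in (1 / (s * R))..(R / s), ph l (s ^ 2) 1 r * (wThree r : ℂ) := by
  have hα : 0 < 1 / (s * R) := by positivity
  have hβ : 0 < R / s := by positivity
  have hs2 : √s ^ 2 = s := Real.sq_sqrt hs.le
  have hR2 : √R ^ 2 = R := Real.sq_sqrt hR.le
  have hs' := Real.sqrt_pos.2 hs
  have hR' := Real.sqrt_pos.2 hR
  have eα : √(1 / (s * R)) = 1 / (√s * √R) := by
    rw [Real.sqrt_div zero_le_one, Real.sqrt_mul hs.le, Real.sqrt_one]
  have eβ : √(R / s) = √R / √s := Real.sqrt_div hR.le s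
  have k1 := integral_ph_subst (l := l) (s := s) (ε := 1) (by norm_num) hα hβ
  have k2 := integral_ph_subst (l := l) (s := s) (ε := -1) (by norm_num) hα hβ
  have y1 : s * √(1 / (s * R)) - 1 * (1 / √(1 / (s * R))) = -(√s * (√R - 1 / √R)) := by
    rw [eα]
    nth_rewrite 1 [← hs2]
    field_simp
    ring
  have y2 : s * √(R / s) - 1 * (1 / √(R / s)) = √s * (√R - 1 / √R) := by
    rw [eβ]
    nth_rewrite 1 [← hs2]
    field_simp
  have y3 : s * √(1 / (s * R)) - -1 * (1 / √(1 / (s * R))) =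
      s * √(R / s) - -1 * (1 / √(R / s)) := by
    rw [eα, eβ]
    field_simp
    simp only [hs2]
    ring
  have i1 := intervalIntegrable_ph_mul (l := l) (E₁ := s ^ 2) (E₂ := 1) continuousOn_wHalf hα hβ
  have i3 := intervalIntegrable_ph_mul (l := l) (E₁ := s ^ 2) (E₂ := 1) continuousOn_wThree hα hβ
  have split : ∀ ε : ℝ, ∫ r in (1 / (s * R))..(R / s),
      ph l (s ^ 2) 1 r * ((1 / 2 * (s * wHalf r + ε * wThree r) : ℝ) : ℂ) =
      1 / 2 * ((s : ℂ) * (∫ r in (1 / (s * R))..(R / s), ph l (s ^ 2) 1 r * (wHalf r : ℂ)) +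
        ε * ∫ r in (1 / (s * R))..(R / s), ph l (s ^ 2) 1 r * (wThree r : ℂ)) := by
    intro ε
    rw [← intervalIntegral.integral_const_mul, ← intervalIntegral.integral_const_mul,
      ← intervalIntegral.integral_add (i1.const_mul _) (i3.const_mul _),
      ← intervalIntegral.integral_const_mul]
    refine intervalIntegral.integral_congr fun r _ => ?_
    push_cast
    ring
  rw [split, y3, intervalIntegral.integral_same, mul_zero] at k2
  rw [split, y1, y2] at k1
  have h2 : (s : ℂ) * ∫ r in (1 / (s * R))..(R / s), ph l (s ^ 2) 1 r * (wHalf r : ℂ) =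
      ∫ r in (1 / (s * R))..(R / s), ph l (s ^ 2) 1 r * (wThree r : ℂ) := by
    push_cast at k2
    linear_combination 2 * k2
  refine ⟨?_, h2⟩
  rw [h2] at k1
  rw [mul_one] at k1
  rw [← k1]
  push_cast
  ring

/-- A smooth cutoff supported in `[1/5, 5]` and equal to `1` on `[1/4, 4]`. -/
def chi (r : ℝ) : ℝ := 1 - cut r - cut r⁻¹

theorem continuous_cut : Continuous cut := (contDiff_cut (n := 0)).continuous

theorem continuousOn_cut_inv : ContinuousOn (fun r => cut r⁻¹) (Set.Ioi 0) :=
  continuous_cut.comp_continuousOn (continuousOn_inv₀.mono fun _ hr => (Set.mem_Ioi.1 hr).ne')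

theorem continuousOn_chi : ContinuousOn chi (Set.Ioi 0) :=
  (continuousOn_const.sub continuous_cut.continuousOn).sub continuousOn_cut_inv

theorem integral_ph_split {l E₁ E₂ α β : ℝ} {f : ℝ → ℝ} (hf : ContinuousOn f (Set.Ioi 0))
    (hα : 0 < α) (hα' : α ≤ 1 / 5) (hβ : 5 ≤ β) :
    ∫ r in α..β, ph l E₁ E₂ r * (f r : ℂ) =
      (∫ r in (1 / 5)..5, ph l E₁ E₂ r * ((chi r * f r : ℝ) : ℂ)) +
      (∫ r in 4..β, ph l E₁ E₂ r * ((cut r * f r : ℝ) : ℂ)) +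
      ∫ r in 4..(1 / α), ph l E₂ E₁ r * ((cut r * (f r⁻¹ / r ^ 2) : ℝ) : ℂ) := by
  have hα5 : 5 ≤ 1 / α := by rw [le_div_iff₀ hα]; linarith
  have hβ0 : 0 < β := by linarith
  have ii : ∀ (g : ℝ → ℝ), ContinuousOn g (Set.Ioi 0) → ∀ {u v : ℝ}, 0 < u → 0 < v →
      IntervalIntegrable (fun r => ph l E₁ E₂ r * ((g r : ℝ) : ℂ)) volume u v :=
    fun g hg u v hu hv => intervalIntegrable_ph_mul hg hu hv
  have zero : ∀ (g : ℝ → ℝ) {u v : ℝ}, u ≤ v → (∀ r ∈ Set.Icc u v, g r = 0) →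
      ∫ r in u..v, ph l E₁ E₂ r * ((g r : ℝ) : ℂ) = 0 := by
    intro g u v huv hg
    rw [← intervalIntegral.integral_zero (a := u) (b := v) (μ := volume)]
    refine intervalIntegral.integral_congr fun r hr => ?_
    rw [Set.uIcc_of_le huv] at hr
    simp [hg r hr]
  have cA : ContinuousOn (fun r => chi r * f r) (Set.Ioi 0) := continuousOn_chi.mul hf
  have cB : ContinuousOn (fun r => cut r * f r) (Set.Ioi 0) := continuous_cut.continuousOn.mul hf
  have cC : ContinuousOn (fun r => cut r⁻¹ * f r) (Set.Ioi 0) := continuousOn_cut_inv.mul hf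
  have hA : ∫ r in α..β, ph l E₁ E₂ r * ((chi r * f r : ℝ) : ℂ) =
      ∫ r in (1 / 5)..5, ph l E₁ E₂ r * ((chi r * f r : ℝ) : ℂ) := by
    rw [← intervalIntegral.integral_add_adjacent_intervals (ii _ cA hα (by norm_num))
        (ii _ cA (by norm_num : (0 : ℝ) < 1 / 5) hβ0),
      ← intervalIntegral.integral_add_adjacent_intervals (b := 5)
        (ii _ cA (by norm_num : (0 : ℝ) < 1 / 5) (by norm_num)) (ii _ cA (by norm_num) hβ0),
      zero _ hα' fun r hr => ?_, zero _ hβ fun r hr => ?_, zero_add, add_zero]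
    · have hr0 : 0 < r := by linarith [hr.1]
      have : r⁻¹ ≤ 4 := by
        rw [inv_le_comm₀ hr0 (by norm_num)]; linarith [hr.1]
      simp [chi, cut_eq_one hr.1, cut_eq_zero this]
    · have hr0 : 0 < r := by linarith [hr.1]
      have : 5 ≤ r⁻¹ := by
        rw [le_inv_comm₀ (by norm_num) hr0]; linarith [hr.2]
      simp [chi, cut_eq_one this, cut_eq_zero (show r ≤ 4 by linarith [hr.2])]
  have hB : ∫ r in α..β, ph l E₁ E₂ r * ((cut r * f r : ℝ) : ℂ) =
      ∫ r in 4..β, ph l E₁ E₂ r * ((cut r * f r : ℝ) : ℂ) := by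
    rw [← intervalIntegral.integral_add_adjacent_intervals (b := 4) (ii _ cB hα (by norm_num))
        (ii _ cB (by norm_num) hβ0), zero _ (by linarith) fun r hr => ?_, zero_add]
    rw [cut_eq_zero hr.2, zero_mul]
  have hC : ∫ r in α..β, ph l E₁ E₂ r * ((cut r⁻¹ * f r : ℝ) : ℂ) =
      ∫ r in 4..(1 / α), ph l E₂ E₁ r * ((cut r * (f r⁻¹ / r ^ 2) : ℝ) : ℂ) := by
    rw [← intervalIntegral.integral_add_adjacent_intervals (b := 1 / 4)
        (ii _ cC hα (by norm_num)) (ii _ cC (by norm_num) hβ0),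
      zero _ (u := 1 / 4) (by linarith) fun r hr => ?_, add_zero]
    · have hpos : ∀ u ∈ Set.uIcc 4 (1 / α), 0 < u := fun u hu => by
        rw [Set.uIcc_of_le (by linarith)] at hu; linarith [hu.1]
      have key := intervalIntegral.integral_deriv_smul_comp' (a := 4) (b := 1 / α)
        (f := fun u : ℝ => u⁻¹) (f' := fun u => -(u ^ 2)⁻¹)
        (g := fun r => ph l E₁ E₂ r * ((cut r⁻¹ * f r : ℝ) : ℂ))
        (fun u hu => hasDerivAt_inv (hpos u hu).ne') ?_ ?_
      · rw [show (4 : ℝ)⁻¹ = 1 / 4 by norm_num, one_div α, inv_inv] at key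
        rw [intervalIntegral.integral_symm, ← key, ← intervalIntegral.integral_neg, one_div α]
        refine intervalIntegral.integral_congr fun u hu => ?_
        have hu0 : u ≠ 0 := (hpos u (by rwa [one_div])).ne'
        simp only [Function.comp_apply, Complex.real_smul, inv_inv, ph]
        rw [show E₁ * u⁻¹ + E₂ / u⁻¹ = E₂ * u + E₁ / u by field_simp; ring]
        push_cast
        ring
      · exact (ContinuousOn.inv₀ (by fun_prop) fun u hu => pow_ne_zero 2 (hpos u hu).ne').neg
      · refine ((continuousOn_ph l E₁ E₂).mul
          (Complex.continuous_ofReal.comp_continuousOn cC)).mono ?_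
        rintro _ ⟨u, hu, rfl⟩
        exact inv_pos.2 (hpos u hu)
    · have hr0 : 0 < r := by linarith [hr.1]
      have : r⁻¹ ≤ 4 := by
        rw [inv_le_comm₀ hr0 (by norm_num)]; linarith [hr.1]
      rw [cut_eq_zero this, zero_mul]
  rw [← hA, ← hB, ← hC, ← intervalIntegral.integral_add (ii _ cA hα hβ0) (ii _ cB hα hβ0),
    ← intervalIntegral.integral_add ((ii _ cA hα hβ0).add (ii _ cB hα hβ0)) (ii _ cC hα hβ0)]
  refine intervalIntegral.integral_congr fun r _ => ?_
  simp only [chi]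
  push_cast
  ring

theorem wHalf_inv_div {r : ℝ} (hr : 0 < r) : wHalf r⁻¹ / r ^ 2 = wThree r := by
  unfold wHalf wThree
  have h2 : √r ^ 2 = r := Real.sq_sqrt hr.le
  have hs := Real.sqrt_pos.2 hr
  rw [Real.sqrt_inv, div_div, div_eq_div_iff (by positivity) (by positivity)]
  field_simp
  linear_combination h2

theorem wThree_inv_div {r : ℝ} (hr : 0 < r) : wThree r⁻¹ / r ^ 2 = wHalf r := by
  unfold wHalf wThree
  have h2 : √r ^ 2 = r := Real.sq_sqrt hr.le
  have hs := Real.sqrt_pos.2 hr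
  rw [Real.sqrt_inv, div_div, div_eq_div_iff (by positivity) (by positivity)]
  field_simp
  linear_combination h2

/-- The oscillatory factor `e^{-2ils}` is an integral over `[1/5, 5]` up to rapidly decaying
errors, with either of the two weights. -/
theorem exists_fresnel_sub_le : ∃ K : ℝ, 0 < K ∧ ∀ s l : ℝ, 1 ≤ s → s ^ 2 ≤ 13 → 1 / 2 ≤ l →
    ‖fresnel l * Complex.exp (Complex.I * ((-(2 * l * s) : ℝ) : ℂ)) -
      ∫ r in (1 / 5)..5, ph l (s ^ 2) 1 r * ((chi r * wThree r : ℝ) : ℂ)‖ ≤ K / l ^ 2 ∧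
    ‖fresnel l * Complex.exp (Complex.I * ((-(2 * l * s) : ℝ) : ℂ)) * (s : ℂ)⁻¹ -
      ∫ r in (1 / 5)..5, ph l (s ^ 2) 1 r * ((chi r * wHalf r : ℝ) : ℂ)‖ ≤ K / l ^ 2 := by
  obtain ⟨K, hK, hcut⟩ := exists_norm_integral_cut_le
  refine ⟨2 * K, by positivity, fun s l hs hs13 hl => ?_⟩
  have hs0 : 0 < s := by linarith
  have hl0 : 0 < l := by linarith
  have hs4 : s ≤ 4 := by nlinarith
  have hs1 : 1 ≤ s ^ 2 := by nlinarith
  have hsc : (s : ℂ) ≠ 0 := by exact_mod_cast hs0.ne'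
  have main : ∀ R : ℝ, 20 ≤ R →
      ‖fresnel l * Complex.exp (Complex.I * ((-(2 * l * s) : ℝ) : ℂ)) -
        ∫ r in (1 / 5)..5, ph l (s ^ 2) 1 r * ((chi r * wThree r : ℝ) : ℂ)‖ ≤
        2 * K / l ^ 2 + (8 + 3 * K) / √R ∧
      ‖fresnel l * Complex.exp (Complex.I * ((-(2 * l * s) : ℝ) : ℂ)) * (s : ℂ)⁻¹ -
        ∫ r in (1 / 5)..5, ph l (s ^ 2) 1 r * ((chi r * wHalf r : ℝ) : ℂ)‖ ≤
        2 * K / l ^ 2 + (8 + 3 * K) / √R := by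
    intro R hR
    have hR0 : 0 < R := by linarith
    have hRs := Real.sqrt_pos.2 hR0
    have hR4 : 4 ≤ √R := Real.le_sqrt_of_sq_le (by linarith)
    have hα : 0 < 1 / (s * R) := by positivity
    have hα' : 1 / (s * R) ≤ 1 / 5 := one_div_le_one_div_of_le (by norm_num) (by nlinarith)
    have hβ : 5 ≤ R / s := by rw [le_div_iff₀ hs0]; nlinarith
    have hα4 : 4 ≤ 1 / (1 / (s * R)) := by rw [one_div_one_div]; nlinarith
    have b1 : 1 / √(R / s) ≤ 2 / √R := by
      have h4 : √R / 2 ≤ √(R / s) := by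
        refine Real.le_sqrt_of_sq_le ?_
        rw [div_pow, Real.sq_sqrt hR0.le]
        gcongr
        linarith
      calc _ ≤ 1 / (√R / 2) := one_div_le_one_div_of_le (by positivity) h4
        _ = _ := by field_simp
    have b2 : 1 / √(1 / (1 / (s * R))) ≤ 1 / √R := by
      rw [one_div_one_div]
      refine one_div_le_one_div_of_le hRs (Real.sqrt_le_sqrt ?_)
      nlinarith
    obtain ⟨q1, q2⟩ := integral_ph_eq (l := l) hs0 hR0
    have hY : √R / 2 ≤ √s * (√R - 1 / √R) := by
      have h1 : 1 ≤ √s := Real.one_le_sqrt.2 hs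
      have h2 : 1 / √R ≤ 1 := (div_le_one hRs).2 (by linarith)
      nlinarith
    have hY0 : 0 < √s * (√R - 1 / √R) := lt_of_lt_of_le (by positivity) hY
    have hF := norm_fresnel_sub_le hl0 hY0
    have hF' : ‖fresnel l * Complex.exp (Complex.I * ((-(2 * l * s) : ℝ) : ℂ)) -
        ∫ r in (1 / (s * R))..(R / s), ph l (s ^ 2) 1 r * (wThree r : ℂ)‖ ≤ 8 / √R := by
      rw [q1, mul_comm (fresnel l), ← mul_sub, norm_mul, norm_cexp_I_mul, one_mul]
      refine hF.trans ?_
      calc _ ≤ 2 / (1 / 2 * (√R / 2)) := by gcongr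
        _ = _ := by field_simp; norm_num
    obtain ⟨a1, a3⟩ := hcut (s ^ 2) 1 l (R / s) hs1 le_rfl (by norm_num) hl (by linarith)
    obtain ⟨c1, c3⟩ := hcut 1 (s ^ 2) l (1 / (1 / (s * R))) le_rfl hs1 hs13 hl hα4
    have tail : ∀ {A B C X : ℂ} {D : ℝ}, ‖X - (A + B + C)‖ ≤ D →
        ‖B‖ ≤ K * (1 / l ^ 2 + 1 / √(R / s)) →
        ‖C‖ ≤ K * (1 / l ^ 2 + 1 / √(1 / (1 / (s * R)))) →
        ‖X - A‖ ≤ D + (2 * K / l ^ 2 + 3 * K / √R) := by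
      intro A B C X D h1 h2 h3
      calc ‖X - A‖ = ‖(X - (A + B + C)) + B + C‖ := by ring_nf
        _ ≤ D + K * (1 / l ^ 2 + 2 / √R) + K * (1 / l ^ 2 + 1 / √R) := by
          refine (norm_add_le _ _).trans (add_le_add ((norm_add_le _ _).trans
            (add_le_add h1 (h2.trans ?_))) (h3.trans ?_)) <;> gcongr
        _ = _ := by ring
    have w3 : ∫ r in 4..(1 / (1 / (s * R))), ph l 1 (s ^ 2) r *
        ((cut r * (wThree r⁻¹ / r ^ 2) : ℝ) : ℂ) =
        ∫ r in 4..(1 / (1 / (s * R))), ph l 1 (s ^ 2) r * ((cut r * wHalf r : ℝ) : ℂ) := by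
      refine intervalIntegral.integral_congr fun r hr => ?_
      rw [Set.uIcc_of_le hα4] at hr
      simp only [wThree_inv_div (show 0 < r by linarith [hr.1])]
    have w1 : ∫ r in 4..(1 / (1 / (s * R))), ph l 1 (s ^ 2) r *
        ((cut r * (wHalf r⁻¹ / r ^ 2) : ℝ) : ℂ) =
        ∫ r in 4..(1 / (1 / (s * R))), ph l 1 (s ^ 2) r * ((cut r * wThree r : ℝ) : ℂ) := by
      refine intervalIntegral.integral_congr fun r hr => ?_
      rw [Set.uIcc_of_le hα4] at hr
      simp only [wHalf_inv_div (show 0 < r by linarith [hr.1])]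
    have s3 := integral_ph_split (l := l) (E₁ := s ^ 2) (E₂ := 1) continuousOn_wThree hα hα' hβ
    have s1 := integral_ph_split (l := l) (E₁ := s ^ 2) (E₂ := 1) continuousOn_wHalf hα hα' hβ
    rw [w3] at s3
    rw [w1] at s1
    have final : ∀ x : ℝ, x ≤ 8 / √R + (2 * K / l ^ 2 + 3 * K / √R) →
        x ≤ 2 * K / l ^ 2 + (8 + 3 * K) / √R := by
      intro x hx
      refine hx.trans_eq ?_
      ring
    constructor
    · refine final _ (tail (D := 8 / √R) ?_ a3 c1)
      rw [← s3]
      exact hF'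
    · refine final _ (tail (D := 8 / √R) ?_ a1 c3)
      rw [← s1]
      have e : ∫ r in (1 / (s * R))..(R / s), ph l (s ^ 2) 1 r * (wHalf r : ℂ) =
          (∫ r in (1 / (s * R))..(R / s), ph l (s ^ 2) 1 r * (wThree r : ℂ)) * (s : ℂ)⁻¹ := by
        rw [← q2]
        field_simp
      rw [e, ← sub_mul, norm_mul, norm_inv, Complex.norm_real, Real.norm_eq_abs, abs_of_pos hs0]
      calc _ ≤ 8 / √R * 1 := by
            gcongr
            exact inv_le_one_of_one_le₀ hs
        _ = _ := by simp
  have lim : Filter.Tendsto (fun R : ℝ => 2 * K / l ^ 2 + (8 + 3 * K) / √R) Filter.atTop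
      (nhds (2 * K / l ^ 2 + 0)) :=
    tendsto_const_nhds.add (tendsto_const_nhds.div_atTop Real.tendsto_sqrt_atTop)
  rw [add_zero] at lim
  constructor
  · refine ge_of_tendsto lim ?_
    filter_upwards [Filter.eventually_ge_atTop 20] with R hR using (main R hR).1
  · refine ge_of_tendsto lim ?_
    filter_upwards [Filter.eventually_ge_atTop 20] with R hR using (main R hR).2

/-! ### Factorization over the coordinates -/

theorem integral_coord_eq (k : ℤ) (z : ℝ) :
    ∫ θ in (0)..(2 * π), Complex.exp (Complex.I * (((k : ℝ) * θ + z * Real.cos θ : ℝ) : ℂ)) =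
      Complex.exp (Complex.I * (((k : ℝ) * (π / 2) : ℝ) : ℂ)) * (2 * (bes k z : ℂ)) := by
  set g : ℝ → ℂ := fun θ => Complex.exp (Complex.I * (((k : ℝ) * θ + z * Real.cos θ : ℝ) : ℂ))
    with hg
  have hper : Function.Periodic g (2 * π) := by
    intro θ
    simp only [hg, Real.cos_add_two_pi]
    rw [Complex.exp_eq_exp_iff_exists_int]
    refine ⟨k, ?_⟩
    push_cast
    ring
  have h1 : ∫ θ in (0)..(2 * π), g θ = ∫ θ in (-π)..π, g (θ + π / 2) := by
    rw [intervalIntegral.integral_comp_add_right,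
      show π + π / 2 = (-π + π / 2) + 2 * π by ring,
      hper.intervalIntegral_add_eq (-π + π / 2) 0, zero_add]
  set h : ℝ → ℂ := fun θ => Complex.exp (Complex.I * (((k : ℝ) * θ - z * Real.sin θ : ℝ) : ℂ))
    with hh
  have h2 : ∀ θ, g (θ + π / 2) =
      Complex.exp (Complex.I * (((k : ℝ) * (π / 2) : ℝ) : ℂ)) * h θ := by
    intro θ
    simp only [hg, hh, Real.cos_add_pi_div_two]
    rw [← Complex.exp_add]
    push_cast
    ring_nf
  have hc : Continuous h := by
    simp only [hh]
    fun_prop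
  have h3 : ∫ θ in (-π)..0, h θ = ∫ θ in (0)..π, h (-θ) := by
    rw [intervalIntegral.integral_comp_neg]
    simp
  have hc' : Continuous fun θ => h (-θ) := hc.comp continuous_neg
  change ∫ θ in (0)..(2 * π), g θ = _
  rw [h1, intervalIntegral.integral_congr fun θ _ => h2 θ, intervalIntegral.integral_const_mul]
  congr 1
  rw [← intervalIntegral.integral_add_adjacent_intervals (b := 0) (hc.intervalIntegrable _ _)
    (hc.intervalIntegrable _ _), h3, ← intervalIntegral.integral_add (hc'.intervalIntegrable _ _)
    (hc.intervalIntegrable _ _), bes, ← intervalIntegral.integral_ofReal,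
    ← intervalIntegral.integral_const_mul]
  refine intervalIntegral.integral_congr fun θ _ => ?_
  simp only [hh]
  rw [Complex.ofReal_cos, Complex.two_cos, Real.sin_neg]
  push_cast
  ring_nf

theorem cube_eq_pi (d : ℕ) : cube d = Set.univ.pi fun _ => Set.Icc 0 (2 * π) :=
  (Set.pi_univ_Icc _ _).symm

theorem isCompact_cube (d : ℕ) : IsCompact (cube d) := isCompact_Icc

theorem setIntegral_cube_prod {d : ℕ} (F : Fin d → ℝ → ℂ) :
    ∫ ξ in cube d, ∏ j, F j (ξ j) = ∏ j, ∫ θ in (0)..(2 * π), F j θ := by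
  rw [cube_eq_pi, volume_pi, Measure.restrict_pi_pi, integral_fintype_prod_eq_prod]
  refine Finset.prod_congr rfl fun j _ => ?_
  rw [intervalIntegral.integral_of_le (by positivity), integral_Icc_eq_integral_Ioc]

theorem one_le_omegaKG_sq (d : ℕ) (ξ : Fin d → ℝ) :
    omegaKG d ξ ^ 2 = 1 + ∑ j : Fin d, 2 * (1 - Real.cos (ξ j)) ∧ 1 ≤ omegaKG d ξ := by
  have h : 0 ≤ ∑ j : Fin d, 2 * (1 - Real.cos (ξ j)) :=
    Finset.sum_nonneg fun j _ => by linarith [Real.cos_le_one (ξ j)]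
  refine ⟨Real.sq_sqrt (by linarith), Real.one_le_sqrt.2 (by linarith)⟩

theorem omegaKG_three_sq_le (ξ : Fin 3 → ℝ) : omegaKG 3 ξ ^ 2 ≤ 13 := by
  rw [(one_le_omegaKG_sq 3 ξ).1]
  have : ∑ j : Fin 3, 2 * (1 - Real.cos (ξ j)) ≤ ∑ _j : Fin 3, (4 : ℝ) :=
    Finset.sum_le_sum fun j _ => by linarith [Real.neg_one_le_cos (ξ j)]
  simp at this
  linarith

theorem continuous_omegaKG (d : ℕ) : Continuous (omegaKG d) := by
  unfold omegaKG
  fun_prop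

theorem setIntegral_cube_ph_eq (w : ℝ → ℂ) (t : ℝ) (x : Fin 3 → ℤ) {r : ℝ} :
    ∫ ξ in cube 3, Complex.exp (Complex.I * ((∑ j : Fin 3, (x j : ℝ) * ξ j : ℝ) : ℂ)) *
      (ph (t / 2) (omegaKG 3 ξ ^ 2) 1 r * w r) =
    (8 * ∏ j, Complex.exp (Complex.I * (((x j : ℝ) * (π / 2) : ℝ) : ℂ))) *
      tri w (x 0) (x 1) (x 2) t r := by
  have h : ∀ ξ : Fin 3 → ℝ,
      Complex.exp (Complex.I * ((∑ j : Fin 3, (x j : ℝ) * ξ j : ℝ) : ℂ)) *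
        (ph (t / 2) (omegaKG 3 ξ ^ 2) 1 r * w r) =
      (Complex.exp (Complex.I * ((-(t / 2) * (7 * r + 1 / r) : ℝ) : ℂ)) * w r) *
        ∏ j, Complex.exp (Complex.I *
          (((x j : ℝ) * ξ j + (t * r) * Real.cos (ξ j) : ℝ) : ℂ)) := by
    intro ξ
    rw [ph, (one_le_omegaKG_sq 3 ξ).1, ← Complex.exp_sum, ← mul_assoc, ← Complex.exp_add,
      mul_right_comm, ← Complex.exp_add]
    congr 2
    simp only [Fin.sum_univ_three]
    push_cast
    ring
  have hp := setIntegral_cube_prod fun (j : Fin 3) θ =>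
    Complex.exp (Complex.I * (((x j : ℝ) * θ + (t * r) * Real.cos θ : ℝ) : ℂ))
  simp_rw [integral_coord_eq] at hp
  simp_rw [h]
  rw [integral_const_mul, hp, Finset.prod_mul_distrib, tri]
  simp only [Fin.prod_univ_three]
  ring

/-- Swapping the torus integral with the `r`-integral. -/
theorem cube_integral_swap {w : ℝ → ℂ} (hw : ContinuousOn w (Set.Icc (1 / 5) 5)) (t : ℝ)
    (x : Fin 3 → ℤ) :
    IntegrableOn (fun ξ => Complex.exp (Complex.I * ((∑ j : Fin 3, (x j : ℝ) * ξ j : ℝ) : ℂ)) *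
      ∫ r in (1 / 5)..5, ph (t / 2) (omegaKG 3 ξ ^ 2) 1 r * w r) (cube 3) ∧
    ‖∫ ξ in cube 3, Complex.exp (Complex.I * ((∑ j : Fin 3, (x j : ℝ) * ξ j : ℝ) : ℂ)) *
      ∫ r in (1 / 5)..5, ph (t / 2) (omegaKG 3 ξ ^ 2) 1 r * w r‖ =
    8 * ‖∫ r in (1 / 5)..5, tri w (x 0) (x 1) (x 2) t r‖ := by
  set H : (Fin 3 → ℝ) → ℝ → ℂ := fun ξ r =>
    Complex.exp (Complex.I * ((∑ j : Fin 3, (x j : ℝ) * ξ j : ℝ) : ℂ)) *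
      (ph (t / 2) (omegaKG 3 ξ ^ 2) 1 r * w r) with hH
  have e : ∀ ξ, Complex.exp (Complex.I * ((∑ j : Fin 3, (x j : ℝ) * ξ j : ℝ) : ℂ)) *
      (∫ r in (1 / 5)..5, ph (t / 2) (omegaKG 3 ξ ^ 2) 1 r * w r) =
      ∫ r in Set.Ioc (1 / 5) 5, H ξ r := by
    intro ξ
    rw [← intervalIntegral.integral_const_mul, intervalIntegral.integral_of_le (by norm_num)]
  have hc : ContinuousOn (Function.uncurry H) (cube 3 ×ˢ Set.Icc (1 / 5 : ℝ) 5) := by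
    have hr : ∀ p ∈ cube 3 ×ˢ Set.Icc (1 / 5 : ℝ) 5, p.2 ≠ 0 := fun p hp => by
      have : 0 < p.2 := by linarith [hp.2.1]
      exact this.ne'
    have c1 : Continuous fun p : (Fin 3 → ℝ) × ℝ => omegaKG 3 p.1 :=
      (continuous_omegaKG 3).comp continuous_fst
    have c2 : ContinuousOn (fun p : (Fin 3 → ℝ) × ℝ =>
        -(t / 2 * (omegaKG 3 p.1 ^ 2 * p.2 + 1 / p.2))) (cube 3 ×ˢ Set.Icc (1 / 5 : ℝ) 5) :=
      (continuousOn_const.mul (((c1.pow 2).mul continuous_snd).continuousOn.add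
        (continuousOn_const.div continuousOn_snd hr))).neg
    have c3 : Continuous fun p : (Fin 3 → ℝ) × ℝ =>
        Complex.exp (Complex.I * ((∑ j : Fin 3, (x j : ℝ) * p.1 j : ℝ) : ℂ)) := by fun_prop
    exact c3.continuousOn.mul (((continuousOn_const.mul
      (Complex.continuous_ofReal.comp_continuousOn c2)).cexp).mul
      (hw.comp continuousOn_snd fun p hp => hp.2))
  have hi : Integrable (Function.uncurry H)
      ((volume.restrict (cube 3)).prod (volume.restrict (Set.Ioc (1 / 5 : ℝ) 5))) := by
    rw [Measure.prod_restrict]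
    exact (hc.integrableOn_compact ((isCompact_cube 3).prod isCompact_Icc)).mono_set
      (Set.prod_mono le_rfl Set.Ioc_subset_Icc_self)
  constructor
  · simp_rw [e]
    exact hi.integral_prod_left
  · simp_rw [e]
    rw [integral_integral_swap hi]
    have : ∀ r, ∫ ξ in cube 3, H ξ r =
        (8 * ∏ j, Complex.exp (Complex.I * (((x j : ℝ) * (π / 2) : ℝ) : ℂ))) *
          tri w (x 0) (x 1) (x 2) t r := fun r => setIntegral_cube_ph_eq w t x
    simp_rw [this]
    rw [integral_const_mul, ← intervalIntegral.integral_of_le (by norm_num), norm_mul, norm_mul,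
      norm_prod, Finset.prod_congr rfl fun j _ => norm_cexp_I_mul _]
    simp

/-! ### Decay of the propagators -/

theorem exists_chi_mul_bound {f f' : ℝ → ℝ} (hf : ∀ r, 0 < r → HasDerivAt f (f' r) r)
    (hf' : ContinuousOn f' (Set.Ioi 0)) : ∃ (w' : ℝ → ℂ) (M : ℝ), ∀ r ∈ Set.Icc (1 / 5 : ℝ) 5,
      HasDerivAt (fun r => ((chi r * f r : ℝ) : ℂ)) (w' r) r ∧ ‖((chi r * f r : ℝ) : ℂ)‖ ≤ M ∧
      ‖w' r‖ ≤ M := by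
  have hsub : Set.Icc (1 / 5 : ℝ) 5 ⊆ Set.Ioi 0 := fun r hr => by
    have := hr.1
    exact Set.mem_Ioi.2 (by linarith)
  have hfc : ContinuousOn f (Set.Ioi 0) := fun r hr =>
    (hf r hr).continuousAt.continuousWithinAt
  have hinv : ContinuousOn (fun r : ℝ => r⁻¹) (Set.Ioi 0) :=
    continuousOn_inv₀.mono fun r hr => (Set.mem_Ioi.1 hr).ne'
  set chi' : ℝ → ℝ := fun r => -deriv cut r - deriv cut r⁻¹ * (-(r ^ 2)⁻¹) with hchi'
  have hchi : ∀ r, 0 < r → HasDerivAt chi (chi' r) r := by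
    intro r hr
    refine (((hasDerivAt_const r (1 : ℝ)).sub (hasDerivAt_cut r)).sub
      ((hasDerivAt_cut r⁻¹).comp r (hasDerivAt_inv hr.ne'))).congr_deriv ?_
    simp only [hchi', zero_sub]
  have cd : Continuous (deriv cut) := contDiff_deriv_cut.continuous
  have hchi'c : ContinuousOn chi' (Set.Ioi 0) :=
    cd.continuousOn.neg.sub ((cd.comp_continuousOn hinv).mul
      (ContinuousOn.neg (ContinuousOn.inv₀ (by fun_prop) fun r hr =>
        pow_ne_zero 2 (Set.mem_Ioi.1 hr).ne')))
  obtain ⟨M₁, h₁⟩ := isCompact_Icc.exists_bound_of_continuousOn (s := Set.Icc (1 / 5 : ℝ) 5)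
    ((continuousOn_chi.mul hfc).mono hsub)
  obtain ⟨M₂, h₂⟩ := isCompact_Icc.exists_bound_of_continuousOn (s := Set.Icc (1 / 5 : ℝ) 5)
    (((hchi'c.mul hfc).add (continuousOn_chi.mul hf')).mono hsub)
  refine ⟨fun r => ((chi' r * f r + chi r * f' r : ℝ) : ℂ), max M₁ M₂, fun r hr => ⟨?_, ?_, ?_⟩⟩
  · exact ((hchi r (hsub hr)).mul (hf r (hsub hr))).ofReal_comp
  · rw [Complex.norm_real]
    exact (h₁ r hr).trans (le_max_left _ _)
  · rw [Complex.norm_real]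
    exact (h₂ r hr).trans (le_max_right _ _)

theorem oscInt_neg {a : (Fin 3 → ℝ) → ℂ} (ha : ∀ ξ, (starRingEnd ℂ) (a ξ) = a ξ) (t : ℝ)
    (x : Fin 3 → ℤ) : oscInt 3 a (-t) x = (starRingEnd ℂ) (oscInt 3 a t (-x)) := by
  unfold oscInt
  rw [← integral_conj]
  congr 1
  ext ξ
  rw [map_mul, ha, ← Complex.exp_conj, map_mul, Complex.conj_I, Complex.conj_ofReal]
  congr 2
  simp only [Pi.neg_apply, Fin.sum_univ_three]
  push_cast
  ring

theorem norm_oscInt_le_volume {a : (Fin 3 → ℝ) → ℂ} (ha : ∀ ξ, ‖a ξ‖ ≤ 1) (t : ℝ)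
    (x : Fin 3 → ℤ) : ‖oscInt 3 a t x‖ ≤ volume.real (cube 3) := by
  refine (norm_setIntegral_le_of_norm_le_const (isCompact_cube 3).measure_lt_top
    fun ξ _ => ?_).trans_eq (one_mul _)
  rw [norm_mul, norm_cexp_I_mul, one_mul]
  exact ha ξ

/-- Decay for large times, given the representation of the propagator as an integral over
`[1/5, 5]`. -/
theorem exists_norm_oscInt_le_of_one_le {a : (Fin 3 → ℝ) → ℂ} (hac : Continuous a) {f f' : ℝ → ℝ}
    (hf : ∀ r, 0 < r → HasDerivAt f (f' r) r) (hf' : ContinuousOn f' (Set.Ioi 0)) {K : ℝ}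
    (hK : 0 < K) (herr : ∀ (l : ℝ) (ξ : Fin 3 → ℝ), 1 / 2 ≤ l →
      ‖fresnel l * Complex.exp (Complex.I * ((-(2 * l * omegaKG 3 ξ) : ℝ) : ℂ)) * a ξ -
        ∫ r in (1 / 5)..5, ph l (omegaKG 3 ξ ^ 2) 1 r * ((chi r * f r : ℝ) : ℂ)‖ ≤ K / l ^ 2) :
    ∃ C : ℝ, 0 < C ∧ ∀ (t : ℝ) (x : Fin 3 → ℤ), 1 ≤ t →
      ‖oscInt 3 a t x‖ ≤ C * t ^ (-(7 / 6) : ℝ) := by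
  obtain ⟨w', M, hw⟩ := exists_chi_mul_bound hf hf'
  have hM : 0 ≤ M := (norm_nonneg _).trans (hw 5 (by norm_num)).2.1
  set V := volume.real (cube 3)
  have hV : 0 ≤ V := measureReal_nonneg
  refine ⟨8 * (10 ^ 36 * M) + 4 * K * V + 1, by positivity, fun t x ht => ?_⟩
  have ht0 : 0 < t := by linarith
  have hl0 : 0 < t / 2 := by linarith
  set w : ℝ → ℂ := fun r => ((chi r * f r : ℝ) : ℂ) with hwdef
  have hwc : ContinuousOn w (Set.Icc (1 / 5) 5) := fun r hr =>
    (hw r hr).1.continuousAt.continuousWithinAt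
  obtain ⟨hGi, hGn⟩ := cube_integral_swap hwc t x
  set e : (Fin 3 → ℝ) → ℂ := fun ξ =>
    Complex.exp (Complex.I * ((∑ j : Fin 3, (x j : ℝ) * ξ j : ℝ) : ℂ)) with he
  set A : (Fin 3 → ℝ) → ℂ := fun ξ =>
    fresnel (t / 2) * Complex.exp (Complex.I * ((-(2 * (t / 2) * omegaKG 3 ξ) : ℝ) : ℂ)) * a ξ
    with hA
  have hωc := continuous_omegaKG 3
  have hFi : IntegrableOn (fun ξ => e ξ * A ξ) (cube 3) := by
    refine Continuous.integrableOn_Icc ?_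
    simp only [he, hA]
    fun_prop
  have hosc : fresnel (t / 2) * oscInt 3 a t x = ∫ ξ in cube 3, e ξ * A ξ := by
    rw [oscInt, ← integral_const_mul]
    congr 1
    ext ξ
    have : Complex.exp (Complex.I *
        (((∑ j : Fin 3, (x j : ℝ) * ξ j) - t * omegaKG 3 ξ : ℝ) : ℂ)) =
        e ξ * Complex.exp (Complex.I * ((-(2 * (t / 2) * omegaKG 3 ξ) : ℝ) : ℂ)) := by
      rw [he, ← Complex.exp_add]
      congr 1
      push_cast
      ring
    rw [this]
    ring
  have hdiff : ‖(∫ ξ in cube 3, e ξ * A ξ) - ∫ ξ in cube 3, e ξ *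
      ∫ r in (1 / 5)..5, ph (t / 2) (omegaKG 3 ξ ^ 2) 1 r * w r‖ ≤ K / (t / 2) ^ 2 * V := by
    rw [← integral_sub hFi hGi]
    refine norm_setIntegral_le_of_norm_le_const (isCompact_cube 3).measure_lt_top fun ξ _ => ?_
    rw [← mul_sub, norm_mul, norm_cexp_I_mul, one_mul]
    exact herr (t / 2) ξ (by linarith)
  have htri := norm_integral_tri_le hw (x 0) (x 1) (x 2) ht
  have hfr : 1 / √t ≤ ‖fresnel (t / 2)‖ := by
    rw [norm_fresnel hl0, one_div, ← Real.sqrt_inv]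
    apply Real.sqrt_le_sqrt
    rw [inv_eq_one_div, div_le_div_iff₀ ht0 hl0]
    nlinarith [Real.pi_gt_three]
  have hst := Real.sqrt_pos.2 ht0
  have h53 : 1 / t ^ 2 ≤ t ^ (-(5 / 3) : ℝ) := by
    rw [one_div, ← Real.rpow_natCast, ← Real.rpow_neg ht0.le]
    exact Real.rpow_le_rpow_of_exponent_le ht (by norm_num)
  have hmain : 1 / √t * ‖oscInt 3 a t x‖ ≤
      (8 * (10 ^ 36 * M) + 4 * K * V + 1) * t ^ (-(5 / 3) : ℝ) := by
    have hp : 0 < t ^ (-(5 / 3) : ℝ) := Real.rpow_pos_of_pos ht0 _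
    calc 1 / √t * ‖oscInt 3 a t x‖ ≤ ‖fresnel (t / 2)‖ * ‖oscInt 3 a t x‖ := by gcongr
      _ = ‖∫ ξ in cube 3, e ξ * A ξ‖ := by rw [← norm_mul, hosc]
      _ ≤ K / (t / 2) ^ 2 * V + 8 * (10 ^ 36 * M * t ^ (-(5 / 3) : ℝ)) := by
        refine (norm_le_norm_sub_add _ _).trans (add_le_add hdiff ?_)
        rw [hGn]
        exact mul_le_mul_of_nonneg_left htri (by norm_num)
      _ = 4 * K * V * (1 / t ^ 2) + 8 * (10 ^ 36 * M) * t ^ (-(5 / 3) : ℝ) := by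
        rw [div_pow, div_div_eq_mul_div]
        ring
      _ ≤ 4 * K * V * t ^ (-(5 / 3) : ℝ) + 8 * (10 ^ 36 * M) * t ^ (-(5 / 3) : ℝ) := by
        exact add_le_add (mul_le_mul_of_nonneg_left h53 (by positivity)) le_rfl
      _ ≤ _ := by linarith
  calc ‖oscInt 3 a t x‖ = √t * (1 / √t * ‖oscInt 3 a t x‖) := by field_simp
    _ ≤ √t * ((8 * (10 ^ 36 * M) + 4 * K * V + 1) * t ^ (-(5 / 3) : ℝ)) := by
      exact mul_le_mul_of_nonneg_left hmain hst.le
    _ = (8 * (10 ^ 36 * M) + 4 * K * V + 1) * (t ^ (1 / 2 : ℝ) * t ^ (-(5 / 3) : ℝ)) := by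
      rw [Real.sqrt_eq_rpow]
      ring
    _ = _ := by
      rw [← Real.rpow_add ht0]
      norm_num

/-- Decay of the propagator for all times, from decay for large times. -/
theorem exists_norm_oscInt_le {a : (Fin 3 → ℝ) → ℂ} (ha : ∀ ξ, (starRingEnd ℂ) (a ξ) = a ξ)
    (ha1 : ∀ ξ, ‖a ξ‖ ≤ 1) {C : ℝ} (hC : 0 < C)
    (h : ∀ (t : ℝ) (x : Fin 3 → ℤ), 1 ≤ t → ‖oscInt 3 a t x‖ ≤ C * t ^ (-(7 / 6) : ℝ)) :
    ∃ C > 0, ∀ (t : ℝ) (x : Fin 3 → ℤ),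
      ‖oscInt 3 a t x‖ ≤ C * (1 + |t|) ^ (-(7 : ℝ) / 6) := by
  set V := volume.real (cube 3)
  have hV : 0 ≤ V := measureReal_nonneg
  have h4 : (1 : ℝ) ≤ 4 * 2 ^ (-(7 : ℝ) / 6) := by
    have : (2 : ℝ) ^ (-(2 : ℝ)) ≤ 2 ^ (-(7 : ℝ) / 6) :=
      Real.rpow_le_rpow_of_exponent_le (by norm_num) (by norm_num)
    rw [Real.rpow_neg (by norm_num), Real.rpow_two] at this
    linarith
  have pos : ∀ (t : ℝ) (x : Fin 3 → ℤ), 0 ≤ t →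
      ‖oscInt 3 a t x‖ ≤ 4 * (C + V) * (1 + t) ^ (-(7 : ℝ) / 6) := by
    intro t x ht
    rcases le_total t 1 with h1 | h1
    · calc _ ≤ V * 1 := (norm_oscInt_le_volume ha1 t x).trans_eq (mul_one _).symm
        _ ≤ (C + V) * (4 * 2 ^ (-(7 : ℝ) / 6)) := by gcongr; linarith
        _ ≤ (C + V) * (4 * (1 + t) ^ (-(7 : ℝ) / 6)) := by
          have := Real.rpow_le_rpow_of_nonpos (x := 1 + t) (y := 2) (z := -(7 : ℝ) / 6)
            (by linarith) (by linarith) (by norm_num)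
          gcongr
        _ = _ := by ring
    · have ht0 : 0 < t := by linarith
      calc _ ≤ C * t ^ (-(7 / 6) : ℝ) := h t x h1
        _ ≤ (C + V) * (1 * t ^ (-(7 / 6) : ℝ)) := by
          rw [one_mul]
          gcongr
          linarith
        _ ≤ (C + V) * (4 * 2 ^ (-(7 : ℝ) / 6) * t ^ (-(7 / 6) : ℝ)) := by gcongr
        _ = 4 * (C + V) * (2 * t) ^ (-(7 : ℝ) / 6) := by
          rw [Real.mul_rpow (by norm_num) ht, ← neg_div]
          ring
        _ ≤ _ := by
          have := Real.rpow_le_rpow_of_nonpos (x := 1 + t) (y := 2 * t) (z := -(7 : ℝ) / 6)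
            (by linarith) (by linarith) (by norm_num)
          gcongr
  refine ⟨4 * (C + V), by positivity, fun t x => ?_⟩
  rcases le_total 0 t with ht | ht
  · rw [abs_of_nonneg ht]
    exact pos t x ht
  · rw [abs_of_nonpos ht, ← neg_neg t, oscInt_neg ha, RCLike.norm_conj, neg_neg]
    exact pos (-t) (-x) (by linarith)

/-- Decay of the propagators, for both amplitudes. -/
theorem exists_norm_oscInt_amplitude_le {a : (Fin 3 → ℝ) → ℂ}
    (ha : a = (fun _ => 1) ∨ a = fun ξ => ((omegaKG 3 ξ : ℝ) : ℂ)⁻¹) :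
    ∃ C > 0, ∀ (t : ℝ) (x : Fin 3 → ℤ),
      ‖oscInt 3 a t x‖ ≤ C * (1 + |t|) ^ (-(7 : ℝ) / 6) := by
  obtain ⟨K, hK, hfr⟩ := exists_fresnel_sub_le
  have hc3 : ContinuousOn (fun r => wThree r / r) (Set.Ioi 0) :=
    continuousOn_wThree.div continuousOn_id fun r hr => (Set.mem_Ioi.1 hr).ne'
  rcases ha with rfl | rfl
  · obtain ⟨C, hC, h⟩ := exists_norm_oscInt_le_of_one_le (a := fun _ => 1) continuous_const
      (fun r hr => hasDerivAt_wThree hr) (continuousOn_const.mul hc3) hK fun l ξ hl => by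
        rw [mul_one]
        exact (hfr _ l (one_le_omegaKG_sq 3 ξ).2 (omegaKG_three_sq_le ξ) hl).1
    exact exists_norm_oscInt_le (fun _ => map_one _) (fun _ => by simp) hC h
  · have hω : ∀ ξ, 0 < omegaKG 3 ξ := fun ξ => by linarith [(one_le_omegaKG_sq 3 ξ).2]
    have hac : Continuous fun ξ => ((omegaKG 3 ξ : ℝ) : ℂ)⁻¹ :=
      (Complex.continuous_ofReal.comp (continuous_omegaKG 3)).inv₀ fun ξ => 
        Complex.ofReal_ne_zero.2 (hω ξ).ne'
    obtain ⟨C, hC, h⟩ := exists_norm_oscInt_le_of_one_le hac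
      (fun r hr => hasDerivAt_wHalf hr) (continuousOn_const.mul continuousOn_wThree) hK
      fun l ξ hl => (hfr _ l (one_le_omegaKG_sq 3 ξ).2 (omegaKG_three_sq_le ξ) hl).2
    refine exists_norm_oscInt_le (fun ξ => ?_) (fun ξ => ?_) hC h
    · rw [map_inv₀, Complex.conj_ofReal]
    · rw [norm_inv, Complex.norm_real, Real.norm_eq_abs, abs_of_pos (hω ξ)]
      exact inv_le_one_of_one_le₀ (one_le_omegaKG_sq 3 ξ).2

end DiscreteKG

/-- Sharp dispersive decay for the discrete Klein--Gordon equation in dimension `d = 3`: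
the `ℓ^∞` norm of the oscillatory integral decays like `(1+|t|)^{-7/6}`. -/
theorem dispersive_decay_d3
    (a : (Fin 3 → ℝ) → ℂ)
    (ha : a = (fun _ => 1) ∨ a = fun ξ => ((omegaKG 3 ξ : ℝ) : ℂ)⁻¹) :
    ∃ C > 0, ∀ (t : ℝ) (x : Fin 3 → ℤ),
      ‖oscInt 3 a t x‖ ≤ C * (1 + |t|) ^ (-(7 : ℝ)/6) :=
  DiscreteKG.exists_norm_oscInt_amplitude_le ha
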